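/- arXiv:1006.3867 — 4 statements merged into one kernel-verified Lean document; each statement's English description precedes it below -/
import Mathlib

section
/- Let T be the binary tree and suppose α(t)σ(t) ≤ c |t|^{-γ/q} for all t ∈ T with |t| ≥ 1, for some γ > 1 with γ ≠ q/p' + 1, where p = min{2,q} and 1/p' = 1 − 1/p. Then there is a constant C > 0 such that for all n ≥ 2: (a) if 1 < q ≤ 2, then e_n(V_{α,σ} : ℓ_1(T) → ℓ_q(T)) ≤ C n^{-1/q'} (log n)^{1 − γ/q} when γ > q, and e_n(V_{α,σ}) ≤ C n^{-(γ−1)/q} when γ < q, where 1/q' = 1 − 1/q; (b) if 2 ≤ q < ∞, then e_n(V_{α,σ}) ≤ C n^{-1/2} (log n)^{1/2 − (γ−1)/q} when γ > q/2 + 1, and e_n(V_{α,σ}) ≤ C n^{-(γ−1)/q} when γ < q/2 + 1. -/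
open scoped ENNReal NNReal
open MeasureTheory

noncomputable section

/-- A rooted tree structure on a partially ordered type with bottom element (the root):
the set of ancestors of any node is finite and totally ordered, and every node has
finitely many offspring (covering elements). -/
def IsTree (T : Type) [PartialOrder T] [OrderBot T] : Prop :=
  (∀ s : T, (Set.Iic s).Finite) ∧
  (∀ s a b : T, a ≤ s → b ≤ s → a ≤ b ∨ b ≤ a) ∧
  (∀ t : T, {s : T | t ⋖ s}.Finite)

/-- The binary tree: a rooted tree in which every node has exactly two offspring. -/
def IsBinaryTree (T : Type) [PartialOrder T] [OrderBot T] : Prop :=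
  IsTree T ∧ ∀ t : T, Nat.card {s : T | t ⋖ s} = 2

/-- `glb` assigns to any two nodes their greatest common ancestor. -/
def IsGCA {T : Type} [PartialOrder T] (glb : T → T → T) : Prop :=
  ∀ t s : T, glb t s ≤ t ∧ glb t s ≤ s ∧ ∀ u : T, u ≤ t → u ≤ s → u ≤ glb t s

/-- The generation `|t|` of a node: the number of its strict ancestors. -/
def gen {T : Type} [PartialOrder T] (t : T) : ℕ := Nat.card (Set.Iio t)

/-- The distance `max_{t ≺ v ⪯ s} (∑_{t ≺ r ⪯ v} α(r)^q)^{1/q} σ(v)` along a branch. -/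
def dOrd {T : Type} [PartialOrder T] (q : ℝ) (α σ : T → ℝ) (t s : T) : ℝ :=
  sSup ((fun v => (∑ᶠ r ∈ Set.Ioc t v, α r ^ q) ^ (1 / q) * σ v) '' Set.Ioc t s)

/- The tree metric `d`, extended by symmetry and via greatest common ancestors. -/
open Classical in
def treeDist {T : Type} [PartialOrder T] (q : ℝ) (α σ : T → ℝ)
    (glb : T → T → T) (t s : T) : ℝ :=
  if t ≤ s then dOrd q α σ t s
  else if s ≤ t then dOrd q α σ s t
  else dOrd q α σ (glb t s) t + dOrd q α σ (glb t s) s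

/-- `N(T,d,ε)`: minimal number of open `ε`-balls needed to cover `T` (`∞` if none). -/
def coveringNumber {T : Type} (d : T → T → ℝ) (ε : ℝ) : ℝ≥0∞ :=
  ⨅ S ∈ {S : Finset T | ∀ t : T, ∃ s ∈ S, d s t < ε}, (S.card : ℝ≥0∞)

/-- `Ñ(T,d,ε)`: minimal cardinality of an order `ε`-net of `T`. -/
def orderCoveringNumber {T : Type} [PartialOrder T] (d : T → T → ℝ) (ε : ℝ) : ℝ≥0∞ :=
  ⨅ S ∈ {S : Finset T | ∀ t : T, ∃ s ∈ S, s ≤ t ∧ d s t < ε}, (S.card : ℝ≥0∞)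

/-- Minimal number of open `ε`-balls of a normed space needed to cover the set `A`. -/
def setCoveringNumber {Y : Type} [NormedAddCommGroup Y] (A : Set Y) (ε : ℝ) : ℝ≥0∞ :=
  ⨅ F ∈ {F : Finset Y | ∀ a ∈ A, ∃ y ∈ F, ‖a - y‖ < ε}, (F.card : ℝ≥0∞)

/-- The dyadic entropy numbers `e_n(V)` of an operator `V`. -/
def entropyNumber {X Y : Type} [NormedAddCommGroup X] [NormedSpace ℝ X]
    [NormedAddCommGroup Y] [NormedSpace ℝ Y] (n : ℕ) (V : X →L[ℝ] Y) : ℝ :=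
  sInf {ε : ℝ | 0 < ε ∧ ∃ F : Finset Y, F.card ≤ 2 ^ (n - 1) ∧
    ∀ x : X, ‖x‖ ≤ 1 → ∃ y ∈ F, ‖V x - y‖ < ε}

/-- The space `ℓ₁(T)`. -/
abbrev ellOne (T : Type) := lp (fun _ : T => ℝ) 1

/-- The space `ℓ_q(T)`. -/
abbrev ellQ (T : Type) (q : ℝ) := lp (fun _ : T => ℝ) (ENNReal.ofReal q)

/-! ### Sign choices in `ℓ_q` -/

lemma exists_abs_rpow_le_exp_add_exp_neg (q : ℝ) (hq : 0 < q) :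
    ∃ C > 0, ∀ x : ℝ, |x| ^ q ≤ C * (Real.exp x + Real.exp (-x)) := by
  obtain ⟨n, hn⟩ := exists_nat_ge q
  have hf : (0 : ℝ) < n.factorial := by exact_mod_cast n.factorial_pos
  refine ⟨1 + n.factorial, by positivity, fun x => ?_⟩
  have h1 : |x| ^ q ≤ 1 + |x| ^ n := by
    rcases le_total |x| 1 with h | h
    · exact (Real.rpow_le_one (abs_nonneg x) h hq.le).trans
        (le_add_of_nonneg_right (by positivity))
    · have := Real.rpow_le_rpow_of_exponent_le h hn
      rw [Real.rpow_natCast] at this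
      linarith
  have h2 : |x| ^ n ≤ n.factorial * Real.exp |x| := by
    have := Real.pow_div_factorial_le_exp |x| (abs_nonneg x) n
    rwa [div_le_iff₀' hf] at this
  have h3 : 1 ≤ Real.exp |x| := Real.one_le_exp (abs_nonneg x)
  have h4 : Real.exp |x| ≤ Real.exp x + Real.exp (-x) := by
    have := Real.exp_pos x
    have := Real.exp_pos (-x)
    rcases abs_cases x with h | h <;> rw [h.1] <;> linarith
  nlinarith

lemma sum_powerset_exp_signed_sum_le {ι : Type} [DecidableEq ι] (O : Finset ι) (a : ι → ℝ) :
    ∑ A ∈ O.powerset, Real.exp (∑ u ∈ A, a u - ∑ u ∈ O \ A, a u) ≤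
      2 ^ O.card * Real.exp ((∑ u ∈ O, a u ^ 2) / 2) := by
  calc ∑ A ∈ O.powerset, Real.exp (∑ u ∈ A, a u - ∑ u ∈ O \ A, a u)
      = ∏ u ∈ O, (Real.exp (a u) + Real.exp (-a u)) := by
        rw [Finset.prod_add]
        refine Finset.sum_congr rfl fun A _ => ?_
        rw [← Real.exp_sum, ← Real.exp_sum, ← Real.exp_add, Finset.sum_neg_distrib,
          sub_eq_add_neg]
    _ ≤ ∏ u ∈ O, (2 * Real.exp (a u ^ 2 / 2)) := by
        refine Finset.prod_le_prod (fun u _ => by positivity) fun u _ => ?_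
        have := Real.cosh_le_exp_half_sq (a u)
        rw [Real.cosh_eq] at this
        linarith
    _ = _ := by
        rw [Finset.prod_mul_distrib, Finset.prod_const, ← Real.exp_sum, Finset.sum_div]

/-- The upper Khintchine inequality, for sums over all sign patterns. -/
lemma exists_sum_powerset_abs_signed_sum_rpow_le (q : ℝ) (hq : 0 < q) :
    ∃ C > 0, ∀ (ι : Type) [DecidableEq ι] (O : Finset ι) (a : ι → ℝ),
      ∑ A ∈ O.powerset, |∑ u ∈ A, a u - ∑ u ∈ O \ A, a u| ^ q ≤
        C * 2 ^ O.card * (∑ u ∈ O, a u ^ 2) ^ (q / 2) := by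
  obtain ⟨C, hC, hCx⟩ := exists_abs_rpow_le_exp_add_exp_neg q hq
  refine ⟨C * (2 * Real.exp (1 / 2)), by positivity, fun ι _ O a => ?_⟩
  set S := ∑ u ∈ O, a u ^ 2 with hS
  have hS0 : 0 ≤ S := Finset.sum_nonneg fun u _ => sq_nonneg _
  rcases hS0.eq_or_lt with h0 | hpos
  · have ha : ∀ u ∈ O, a u = 0 := fun u hu => by
      have := (Finset.sum_eq_zero_iff_of_nonneg fun u _ => sq_nonneg (a u)).1 h0.symm u hu
      simpa using this
    have : ∑ A ∈ O.powerset, |∑ u ∈ A, a u - ∑ u ∈ O \ A, a u| ^ q = 0 := by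
      refine Finset.sum_eq_zero fun A hA => ?_
      rw [Finset.sum_eq_zero fun u hu => ha u (Finset.mem_powerset.1 hA hu),
        Finset.sum_eq_zero fun u hu => ha u (Finset.sdiff_subset hu)]
      simp [hq.ne']
    rw [this]
    positivity
  set s := Real.sqrt S with hs
  have hspos : 0 < s := Real.sqrt_pos.2 hpos
  have hsq : s ^ 2 = S := Real.sq_sqrt hS0
  have hsS : S ^ (q / 2) = s ^ q := by
    rw [← hsq, ← Real.rpow_natCast, ← Real.rpow_mul hspos.le]
    congr 1
    push_cast
    ring
  have hunit : ∑ u ∈ O, (a u / s) ^ 2 = 1 := by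
    simp_rw [div_pow]
    rw [← Finset.sum_div, hsq, ← hS, div_self hpos.ne']
  have hunit' : ∑ u ∈ O, (-(a u / s)) ^ 2 = 1 := by simpa using hunit
  have e1 := sum_powerset_exp_signed_sum_le O fun u => a u / s
  have e2 := sum_powerset_exp_signed_sum_le O fun u => -(a u / s)
  simp only [hunit, hunit'] at e1 e2
  calc ∑ A ∈ O.powerset, |∑ u ∈ A, a u - ∑ u ∈ O \ A, a u| ^ q
      = ∑ A ∈ O.powerset, s ^ q * |∑ u ∈ A, a u / s - ∑ u ∈ O \ A, a u / s| ^ q := by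
        refine Finset.sum_congr rfl fun A _ => ?_
        rw [← Finset.sum_div, ← Finset.sum_div, ← sub_div, abs_div, abs_of_pos hspos,
          Real.div_rpow (abs_nonneg _) hspos.le, mul_div_cancel₀ _ (by positivity)]
    _ ≤ ∑ A ∈ O.powerset, s ^ q * (C *
          (Real.exp (∑ u ∈ A, a u / s - ∑ u ∈ O \ A, a u / s) +
            Real.exp (∑ u ∈ A, -(a u / s) - ∑ u ∈ O \ A, -(a u / s)))) := by
        refine Finset.sum_le_sum fun A _ => mul_le_mul_of_nonneg_left ?_ (by positivity)
        have := hCx (∑ u ∈ A, a u / s - ∑ u ∈ O \ A, a u / s)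
        rw [neg_sub] at this
        rwa [Finset.sum_neg_distrib, Finset.sum_neg_distrib, neg_sub_neg]
    _ ≤ s ^ q * (C * (2 ^ O.card * Real.exp (1 / 2) + 2 ^ O.card * Real.exp (1 / 2))) := by
        rw [← Finset.mul_sum, ← Finset.mul_sum, Finset.sum_add_distrib]
        gcongr
    _ = _ := by rw [hsS]; ring

lemma sum_sq_rpow_le {ι : Type} (q : ℝ) (hq : 0 < q) (O : Finset ι) (a : ι → ℝ) :
    (∑ u ∈ O, a u ^ 2) ^ (q / 2) ≤
      (O.card : ℝ) ^ (q * max (1 / 2) (1 / q) - 1) * ∑ u ∈ O, |a u| ^ q := by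
  have hterm : ∀ u, |a u ^ 2| ^ (q / 2) = |a u| ^ q := fun u => by
    rw [abs_pow, ← Real.rpow_natCast, ← Real.rpow_mul (abs_nonneg _)]
    congr 1
    push_cast
    ring
  rcases le_total 2 q with h | h
  · have := Real.rpow_sum_le_const_mul_sum_rpow O (fun u => a u ^ 2)
      (p := q / 2) (by linarith)
    simp only [hterm] at this
    simp only [abs_pow, sq_abs] at this
    rw [max_eq_left (one_div_le_one_div_of_le two_pos h)]
    convert this using 3
    ring
  · rw [max_eq_right (one_div_le_one_div_of_le hq h), mul_one_div_cancel hq.ne', sub_self,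
      Real.rpow_zero, one_mul]
    induction O using Finset.cons_induction with
    | empty => simp [hq.ne']
    | cons u O hu ih =>
      rw [Finset.sum_cons, Finset.sum_cons]
      refine (Real.rpow_add_le_add_rpow (sq_nonneg _) (Finset.sum_nonneg fun u _ => sq_nonneg _)
        (by positivity) (by linarith)).trans (add_le_add ?_ ih)
      rw [← hterm u, abs_of_nonneg (sq_nonneg (a u))]

/-- `Y` has sign constant `C` with exponent `η`: any finite family of vectors of norm at most `r`
admits signs for which the signed sum has norm at most `C * r * card ^ η`.
For `η = 1 / p` this is a consequence of `Y` having type `p`. -/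
def HasSmallSignedSums (Y : Type) [NormedAddCommGroup Y] (η C : ℝ) : Prop :=
  ∀ (ι : Type) [DecidableEq ι] (O : Finset ι) (v : ι → Y) (r : ℝ), (∀ u ∈ O, ‖v u‖ ≤ r) →
    ∃ A ⊆ O, ‖∑ u ∈ A, v u - ∑ u ∈ O \ A, v u‖ ≤ C * r * (O.card : ℝ) ^ η

lemma hasSum_ellQ_rpow {T : Type} {q : ℝ} (hq : 0 < q) (f : ellQ T q) :
    HasSum (fun t => |f t| ^ q) (‖f‖ ^ q) := by
  have := lp.hasSum_norm (p := ENNReal.ofReal q)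
    (by rwa [ENNReal.toReal_ofReal hq.le]) f
  simpa only [ENNReal.toReal_ofReal hq.le, Real.norm_eq_abs] using this

lemma exists_hasSmallSignedSums_ellQ (T : Type) (q : ℝ) (hq : 0 < q)
    [Fact (1 ≤ ENNReal.ofReal q)] :
    ∃ C > 0, HasSmallSignedSums (ellQ T q) (max (1 / 2) (1 / q)) C := by
  obtain ⟨C, hC, hkh⟩ := exists_sum_powerset_abs_signed_sum_rpow_le q hq
  set η : ℝ := max (1 / 2) (1 / q)
  have hη : 0 < η := lt_max_of_lt_left (by norm_num)
  refine ⟨C ^ (1 / q), by positivity, fun ι _ O v r hv => ?_⟩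
  rcases O.eq_empty_or_nonempty with rfl | ⟨u₀, hu₀⟩
  · exact ⟨∅, le_rfl, by simp [hη.ne']⟩
  have hr : 0 ≤ r := (norm_nonneg _).trans (hv u₀ hu₀)
  have hcard : (0 : ℝ) < O.card := by exact_mod_cast Finset.card_pos.2 ⟨u₀, hu₀⟩
  have hsum : ∑ A ∈ O.powerset, ‖∑ u ∈ A, v u - ∑ u ∈ O \ A, v u‖ ^ q ≤
      C * 2 ^ O.card * ((O.card : ℝ) ^ (q * η - 1) * ∑ u ∈ O, ‖v u‖ ^ q) := by
    refine hasSum_le (fun t => ?_)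
      (hasSum_sum fun A _ => hasSum_ellQ_rpow hq (∑ u ∈ A, v u - ∑ u ∈ O \ A, v u))
      (((hasSum_sum fun u (_ : u ∈ O) => hasSum_ellQ_rpow hq (v u)).mul_left
        ((O.card : ℝ) ^ (q * η - 1))).mul_left (C * 2 ^ O.card))
    simp only [lp.coeFn_sub, lp.coeFn_sum, Pi.sub_apply, Finset.sum_apply]
    exact (hkh ι O fun u => v u t).trans
      (mul_le_mul_of_nonneg_left (sum_sq_rpow_le q hq O _) (by positivity))
  have hbound : C * 2 ^ O.card * ((O.card : ℝ) ^ (q * η - 1) * ∑ u ∈ O, ‖v u‖ ^ q) ≤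
      ∑ A ∈ O.powerset, C * (r ^ q * (O.card : ℝ) ^ (q * η)) := by
    rw [Finset.sum_const, Finset.card_powerset, nsmul_eq_mul]
    have h1 : ∑ u ∈ O, ‖v u‖ ^ q ≤ O.card * r ^ q := by
      rw [← nsmul_eq_mul]
      exact Finset.sum_le_card_nsmul _ _ _ fun u hu =>
        Real.rpow_le_rpow (norm_nonneg _) (hv u hu) hq.le
    calc _ ≤ C * 2 ^ O.card * ((O.card : ℝ) ^ (q * η - 1) * (O.card * r ^ q)) := by gcongr
      _ = _ := by
        rw [Real.rpow_sub_one hcard.ne']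
        push_cast
        field_simp
  obtain ⟨A, hA, hle⟩ := Finset.exists_le_of_sum_le
    (Finset.powerset_nonempty O) (hsum.trans hbound)
  refine ⟨A, Finset.mem_powerset.1 hA, ?_⟩
  have := Real.rpow_le_rpow (by positivity) hle (one_div_nonneg.2 hq.le)
  rw [← Real.rpow_mul (norm_nonneg _), mul_one_div_cancel hq.ne', Real.rpow_one,
    Real.mul_rpow hC.le (by positivity), Real.mul_rpow (by positivity) (by positivity),
    ← Real.rpow_mul hr, ← Real.rpow_mul hcard.le, mul_one_div_cancel hq.ne', Real.rpow_one] at this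
  rw [mul_assoc]
  convert this using 4
  field_simp

/-! ### Entropy of absolutely convex hulls of finite sets -/

section Maurey

variable {ι Y : Type} [NormedAddCommGroup Y] [NormedSpace ℝ Y]

lemma HasSmallSignedSums.exists_half {η C : ℝ} (hY : HasSmallSignedSums Y η C) (hη : 0 ≤ η)
    (hC : 0 < C) (U : Finset ι) (v : ι → Y) {r : ℝ} (hr : 0 < r) (hv : ∀ u ∈ U, ‖v u‖ ≤ r)
    (k : ι → ℕ) (M : ℕ) (hk : ∑ u ∈ U, k u ≤ 2 * M) :
    ∃ k' : ι → ℕ, ∑ u ∈ U, k' u ≤ M ∧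
      ‖∑ u ∈ U, (k u : ℝ) • v u - (2 : ℝ) • ∑ u ∈ U, (k' u : ℝ) • v u‖ ≤
        C * r * (2 * M : ℝ) ^ η := by
  classical
  set O := U.filter fun u => Odd (k u) with hO
  have hOU : O ⊆ U := Finset.filter_subset _ _
  obtain ⟨A, hAO, hA2, hA⟩ : ∃ A ⊆ O, 2 * A.card ≤ O.card ∧
      ‖∑ u ∈ O \ A, v u - ∑ u ∈ A, v u‖ ≤ C * r * (O.card : ℝ) ^ η := by
    obtain ⟨A, hAO, hA⟩ := hY ι O v r fun u hu => hv u (hOU hu)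
    have hcard := Finset.card_sdiff_add_card_eq_card hAO
    rcases le_total (2 * A.card) O.card with h | h
    · exact ⟨A, hAO, h, by rwa [norm_sub_rev]⟩
    · refine ⟨O \ A, Finset.sdiff_subset, by omega, ?_⟩
      rwa [Finset.sdiff_sdiff_eq_self hAO]
  have hkO : ∀ u ∈ U, k u = 2 * (k u / 2) + if u ∈ O then 1 else 0 := fun u hu => by
    by_cases h : Odd (k u)
    · rw [if_pos (Finset.mem_filter.2 ⟨hu, h⟩)]
      have := Nat.odd_iff.1 h
      omega
    · rw [if_neg (by simp [hO, h])]
      have := Nat.even_iff.1 (Nat.not_odd_iff_even.1 h)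
      omega
  have hsumk : ∑ u ∈ U, k u = 2 * ∑ u ∈ U, k u / 2 + O.card := by
    rw [Finset.sum_congr rfl hkO, Finset.sum_add_distrib, ← Finset.mul_sum, Finset.sum_ite_mem,
      Finset.inter_eq_right.2 hOU, Finset.card_eq_sum_ones]
  have hvec : ∑ u ∈ U, (k u : ℝ) • v u =
      (2 : ℝ) • ∑ u ∈ U, ((k u / 2 : ℕ) : ℝ) • v u + ∑ u ∈ O, v u := by
    rw [Finset.smul_sum, ← Finset.inter_eq_right.2 hOU, ← Finset.sum_ite_mem,
      ← Finset.sum_add_distrib]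
    refine Finset.sum_congr rfl fun u hu => ?_
    conv_lhs => rw [hkO u hu]
    split_ifs <;> push_cast <;> module
  refine ⟨fun u => k u / 2 + if u ∈ A then 1 else 0, ?_, ?_⟩
  · rw [Finset.sum_add_distrib, Finset.sum_ite_mem, Finset.inter_eq_right.2 (hAO.trans hOU),
      ← Finset.card_eq_sum_ones]
    omega
  · have hvec' : ∑ u ∈ U, ((k u / 2 + if u ∈ A then 1 else 0 : ℕ) : ℝ) • v u =
        ∑ u ∈ U, ((k u / 2 : ℕ) : ℝ) • v u + ∑ u ∈ A, v u := by
      rw [← Finset.inter_eq_right.2 (hAO.trans hOU), ← Finset.sum_ite_mem,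
        ← Finset.sum_add_distrib, Finset.inter_eq_right.2 (hAO.trans hOU)]
      refine Finset.sum_congr rfl fun u _ => ?_
      split_ifs <;> push_cast <;> module
    have hOA := Finset.sum_sdiff (f := v) hAO
    rw [hvec, hvec', ← hOA]
    have hOM : (O.card : ℝ) ≤ 2 * M := by
      have : O.card ≤ 2 * M := by omega
      exact_mod_cast this
    calc _ = ‖∑ u ∈ O \ A, v u - ∑ u ∈ A, v u‖ := by congr 1; module
      _ ≤ C * r * (O.card : ℝ) ^ η := hA
      _ ≤ _ := by gcongr

lemma HasSmallSignedSums.exists_iterated_half {η C : ℝ} (hY : HasSmallSignedSums Y η C)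
    (hη : 0 ≤ η) (hC : 0 < C) (U : Finset ι) (v : ι → Y) {r : ℝ} (hr : 0 < r)
    (hv : ∀ u ∈ U, ‖v u‖ ≤ r) (m l : ℕ) (k : ι → ℕ) (hk : ∑ u ∈ U, k u ≤ 2 ^ l * m) :
    ∃ k' : ι → ℕ, ∑ u ∈ U, k' u ≤ m ∧
      ‖((2 : ℝ) ^ l)⁻¹ • ∑ u ∈ U, (k u : ℝ) • v u - ∑ u ∈ U, (k' u : ℝ) • v u‖ ≤
        C * r * (m : ℝ) ^ η * ∑ i ∈ Finset.range l, ((2 : ℝ) ^ (η - 1)) ^ (i + 1) := by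
  induction l generalizing k with
  | zero => exact ⟨k, by simpa using hk, by simp⟩
  | succ l ih =>
    obtain ⟨k₁, hk₁, hn₁⟩ := hY.exists_half hη hC U v hr hv k (2 ^ l * m)
      (by rw [← mul_assoc, ← pow_succ']; exact hk)
    obtain ⟨k', hk', hn'⟩ := ih k₁ hk₁
    refine ⟨k', hk', ?_⟩
    rw [Finset.sum_range_succ, mul_add]
    set X := ∑ u ∈ U, (k u : ℝ) • v u
    set X₁ := ∑ u ∈ U, (k₁ u : ℝ) • v u
    set X' := ∑ u ∈ U, (k' u : ℝ) • v u
    have hsplit : ((2 : ℝ) ^ (l + 1))⁻¹ • X - X' =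
        ((2 : ℝ) ^ (l + 1))⁻¹ • (X - (2 : ℝ) • X₁) + (((2 : ℝ) ^ l)⁻¹ • X₁ - X') := by
      have : ((2 : ℝ) ^ l)⁻¹ = ((2 : ℝ) ^ (l + 1))⁻¹ * 2 := by
        rw [pow_succ]
        field_simp
      rw [this]
      module
    rw [hsplit]
    refine (norm_add_le _ _).trans ((add_comm _ _).trans_le (add_le_add hn' ?_))
    rw [norm_smul, Real.norm_of_nonneg (by positivity)]
    refine (mul_le_mul_of_nonneg_left hn₁ (by positivity)).trans_eq ?_
    have h2 : (2 * ((2 ^ l * m : ℕ) : ℝ)) = 2 ^ (l + 1) * m := by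
      push_cast
      ring
    rw [h2, Real.mul_rpow (by positivity) (by positivity), ← Real.rpow_natCast,
      ← Real.rpow_natCast, ← Real.rpow_mul two_pos.le, ← Real.rpow_mul two_pos.le,
      ← Real.rpow_neg two_pos.le, sub_mul, Real.rpow_sub two_pos, one_mul, mul_comm η,
      Real.rpow_neg two_pos.le]
    ring

lemma sum_range_pow_succ_le {ρ : ℝ} (h0 : 0 ≤ ρ) (h1 : ρ < 1) (l : ℕ) :
    ∑ i ∈ Finset.range l, ρ ^ (i + 1) ≤ (1 - ρ)⁻¹ := by
  rw [← tsum_geometric_of_lt_one h0 h1]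
  refine (Finset.sum_le_sum fun i _ => pow_le_pow_of_le_one h0 h1.le i.le_succ).trans ?_
  exact (summable_geometric_of_lt_one h0 h1).sum_le_tsum _ fun i _ => by positivity

/-- Maurey's empirical method for convex combinations. -/
lemma HasSmallSignedSums.exists_approx {η C : ℝ} (hY : HasSmallSignedSums Y η C)
    (hη : 0 ≤ η) (hη1 : η < 1) (hC : 0 < C) (U : Finset ι) (v : ι → Y) {r : ℝ} (hr : 0 < r)
    (hv : ∀ u ∈ U, ‖v u‖ ≤ r) {m : ℕ} (hm : 1 ≤ m) (w : ι → ℝ) (hw0 : ∀ u ∈ U, 0 ≤ w u)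
    (hw1 : ∑ u ∈ U, w u ≤ 1) :
    ∃ k : ι → ℕ, ∑ u ∈ U, k u ≤ m ∧
      ‖∑ u ∈ U, w u • v u - (m : ℝ)⁻¹ • ∑ u ∈ U, (k u : ℝ) • v u‖ ≤
        (C * (1 - (2 : ℝ) ^ (η - 1))⁻¹ + 1) * r * (m : ℝ) ^ (η - 1) := by
  have hmpos : (0 : ℝ) < m := by exact_mod_cast hm
  obtain ⟨l, hl⟩ := exists_nat_ge (U.card / (m : ℝ) ^ η)
  have hl2 : (U.card : ℝ) ≤ 2 ^ l * (m : ℝ) ^ η := by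
    rw [div_le_iff₀ (by positivity)] at hl
    have : (l : ℝ) ≤ 2 ^ l := by exact_mod_cast Nat.lt_two_pow_self.le
    exact hl.trans (by gcongr)
  have hP : (0 : ℝ) < 2 ^ l * m := by positivity
  set k₀ : ι → ℕ := fun u => ⌊2 ^ l * m * w u⌋₊
  have hk₀ : ∑ u ∈ U, k₀ u ≤ 2 ^ l * m := by
    have : ∑ u ∈ U, (k₀ u : ℝ) ≤ 2 ^ l * m := by
      calc ∑ u ∈ U, (k₀ u : ℝ) ≤ ∑ u ∈ U, 2 ^ l * m * w u :=
            Finset.sum_le_sum fun u hu => Nat.floor_le (mul_nonneg hP.le (hw0 u hu))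
        _ = 2 ^ l * m * ∑ u ∈ U, w u := by rw [Finset.mul_sum]
        _ ≤ 2 ^ l * m := mul_le_of_le_one_right hP.le hw1
    exact_mod_cast this
  obtain ⟨k, hk, hkn⟩ := hY.exists_iterated_half hη hC U v hr hv m l k₀ hk₀
  refine ⟨k, hk, ?_⟩
  set X := ∑ u ∈ U, w u • v u
  set X₀ := ∑ u ∈ U, (k₀ u : ℝ) • v u with hX₀
  set X' := ∑ u ∈ U, (k u : ℝ) • v u
  have hround : ‖X - ((2 : ℝ) ^ l * m)⁻¹ • X₀‖ ≤ r * (m : ℝ) ^ (η - 1) := by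
    have heq : X - ((2 : ℝ) ^ l * m)⁻¹ • X₀ =
        ∑ u ∈ U, (w u - ((2 : ℝ) ^ l * m)⁻¹ * k₀ u) • v u := by
      rw [hX₀, Finset.smul_sum, ← Finset.sum_sub_distrib]
      exact Finset.sum_congr rfl fun u _ => by module
    have hterm : ∀ u ∈ U, ‖(w u - ((2 : ℝ) ^ l * m)⁻¹ * k₀ u) • v u‖ ≤
        ((2 : ℝ) ^ l * m)⁻¹ * r := fun u hu => by
      rw [norm_smul]
      refine mul_le_mul ?_ (hv u hu) (norm_nonneg _) (by positivity)
      have h1 := Nat.floor_le (mul_nonneg hP.le (hw0 u hu))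
      have h2 := Nat.lt_floor_add_one (2 ^ l * m * w u)
      have h3 : w u - ((2 : ℝ) ^ l * m)⁻¹ * k₀ u =
          ((2 : ℝ) ^ l * m)⁻¹ * (2 ^ l * m * w u - k₀ u) := by field_simp
      rw [h3, norm_mul, Real.norm_of_nonneg (by positivity : (0 : ℝ) ≤ ((2 : ℝ) ^ l * m)⁻¹)]
      refine mul_le_of_le_one_right (by positivity) ?_
      rw [Real.norm_eq_abs, abs_le]
      constructor <;> simp only [k₀] <;> linarith
    rw [heq]
    calc _ ≤ U.card * (((2 : ℝ) ^ l * m)⁻¹ * r) := by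
          rw [← nsmul_eq_mul]
          exact (norm_sum_le _ _).trans (Finset.sum_le_card_nsmul _ _ _ hterm)
      _ ≤ (2 ^ l * (m : ℝ) ^ η) * (((2 : ℝ) ^ l * m)⁻¹ * r) := by gcongr
      _ = _ := by
          rw [Real.rpow_sub_one hmpos.ne']
          field_simp
  have hρ : (2 : ℝ) ^ (η - 1) < 1 := Real.rpow_lt_one_of_one_lt_of_neg one_lt_two (by linarith)
  have hmaurey : ‖((2 : ℝ) ^ l * m)⁻¹ • X₀ - (m : ℝ)⁻¹ • X'‖ ≤
      C * (1 - (2 : ℝ) ^ (η - 1))⁻¹ * r * (m : ℝ) ^ (η - 1) := by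
    have heq : ((2 : ℝ) ^ l * m)⁻¹ • X₀ - (m : ℝ)⁻¹ • X' =
        (m : ℝ)⁻¹ • (((2 : ℝ) ^ l)⁻¹ • X₀ - X') := by
      rw [mul_inv]
      module
    rw [heq, norm_smul, Real.norm_of_nonneg (by positivity)]
    calc _ ≤ (m : ℝ)⁻¹ * (C * r * (m : ℝ) ^ η * (1 - (2 : ℝ) ^ (η - 1))⁻¹) := by
          refine mul_le_mul_of_nonneg_left (hkn.trans ?_) (by positivity)
          exact mul_le_mul_of_nonneg_left (sum_range_pow_succ_le (by positivity) hρ l)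
            (by positivity)
      _ = _ := by
          rw [Real.rpow_sub_one hmpos.ne']
          ring
  calc _ = ‖(X - ((2 : ℝ) ^ l * m)⁻¹ • X₀) +
        (((2 : ℝ) ^ l * m)⁻¹ • X₀ - (m : ℝ)⁻¹ • X')‖ := by congr 1; abel
    _ ≤ _ := norm_add_le _ _
    _ ≤ r * (m : ℝ) ^ (η - 1) + C * (1 - (2 : ℝ) ^ (η - 1))⁻¹ * r * (m : ℝ) ^ (η - 1) :=
        add_le_add hround hmaurey
    _ = _ := by ring

open scoped Pointwise in
lemma sum_natCast_smul_mem_nsmul [DecidableEq Y] (G : Finset Y) (h0 : 0 ∈ G) (U : Finset ι)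
    (v : ι → Y) (hv : ∀ u ∈ U, v u ∈ G) (k : ι → ℕ) {m : ℕ} (hk : ∑ u ∈ U, k u ≤ m) :
    ∑ u ∈ U, (k u : ℝ) • v u ∈ m • G := by
  refine Finset.nsmul_subset_nsmul_right h0 hk ?_
  clear hk
  induction U using Finset.cons_induction with
  | empty => simp
  | cons u U hu ih =>
    rw [Finset.sum_cons, Finset.sum_cons, add_nsmul, Nat.cast_smul_eq_nsmul]
    exact Finset.add_mem_add
      (Finset.nsmul_mem_nsmul (hv u (Finset.mem_cons_self u U)))
      (ih fun u' hu' => hv u' (Finset.mem_cons_of_mem hu'))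

open scoped Pointwise in
/-- Maurey's bound for the entropy of the absolutely convex hull of a finite set. -/
lemma HasSmallSignedSums.exists_cover {η C : ℝ} (hY : HasSmallSignedSums Y η C)
    (hη : 0 ≤ η) (hη1 : η < 1) (hC : 0 < C) (U : Finset ι) (v : ι → Y) {r : ℝ} (hr : 0 < r)
    (hv : ∀ u ∈ U, ‖v u‖ ≤ r) {m : ℕ} (hm : 1 ≤ m) :
    ∃ F : Finset Y, F.card ≤ (2 * U.card + 1) ^ m ∧
      ∀ w : ι → ℝ, ∑ u ∈ U, |w u| ≤ 1 → ∃ y ∈ F, ‖∑ u ∈ U, w u • v u - y‖ ≤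
        (C * (1 - (2 : ℝ) ^ (η - 1))⁻¹ + 1) * r * (m : ℝ) ^ (η - 1) := by
  classical
  set U' := U.disjSum U
  set v' : ι ⊕ ι → Y := Sum.elim v fun u => -v u with hv'def
  have hv' : ∀ u ∈ U', ‖v' u‖ ≤ r := by
    rintro (u | u) hu
    · exact hv u (Finset.inl_mem_disjSum.1 hu)
    · simpa [v'] using hv u (Finset.inr_mem_disjSum.1 hu)
  set G := insert 0 (U'.image v')
  have hG : G.card ≤ 2 * U.card + 1 := by
    refine (Finset.card_insert_le _ _).trans (Nat.add_le_add_right ?_ 1)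
    refine Finset.card_image_le.trans ?_
    rw [Finset.card_disjSum, two_mul]
  refine ⟨(m • G).image fun y => (m : ℝ)⁻¹ • y,
    Finset.card_image_le.trans (Finset.card_nsmul_le.trans (Nat.pow_le_pow_left hG m)),
    fun w hw => ?_⟩
  set w' : ι ⊕ ι → ℝ := Sum.elim (fun u => max (w u) 0) fun u => max (-w u) 0 with hw'def
  obtain ⟨k, hk, hkn⟩ := hY.exists_approx hη hη1 hC U' v' hr hv' hm w'
    (by rintro (u | u) _ <;> simp [w'])
    (by
      rw [Finset.sum_disjSum, ← Finset.sum_add_distrib]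
      refine (Finset.sum_congr rfl fun u _ => ?_).trans_le hw
      simp only [hw'def, Sum.elim_inl, Sum.elim_inr]
      exact max_zero_add_max_neg_zero_eq_abs_self (w u))
  refine ⟨_, Finset.mem_image_of_mem _ (sum_natCast_smul_mem_nsmul G (Finset.mem_insert_self _ _)
    U' v' (fun u hu => Finset.mem_insert_of_mem (Finset.mem_image_of_mem _ hu)) k hk), ?_⟩
  convert hkn using 3
  rw [Finset.sum_disjSum, ← Finset.sum_add_distrib]
  refine Finset.sum_congr rfl fun u _ => ?_
  simp only [hw'def, hv'def, Sum.elim_inl, Sum.elim_inr]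
  rw [smul_neg, ← sub_eq_add_neg, ← sub_smul, max_comm, max_comm (-w u)]
  congr 1
  rcases le_total (w u) 0 with h | h
  · rw [max_eq_left h, max_eq_right (by linarith)]
    ring
  · rw [max_eq_right h, max_eq_left (by linarith)]
    ring

end Maurey

/-! ### Generations of a binary tree -/

section Tree

variable {T : Type} [PartialOrder T] [OrderBot T]

lemma IsTree.finite_Iio (hT : IsTree T) (s : T) : (Set.Iio s).Finite :=
  (hT.1 s).subset Set.Iio_subset_Iic_self

lemma IsTree.gen_lt_gen (hT : IsTree T) {t s : T} (h : t < s) : gen t < gen s := by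
  rw [gen, gen, Nat.card_coe_set_eq, Nat.card_coe_set_eq]
  refine Set.ncard_lt_ncard ⟨Set.Iio_subset_Iio h.le, fun h' => ?_⟩ (hT.finite_Iio s)
  exact lt_irrefl t (h' h)

lemma IsTree.gen_injOn_Iic (hT : IsTree T) (s : T) : Set.InjOn gen (Set.Iic s) := by
  intro a ha b hb hab
  rcases hT.2.1 s a b ha hb with h | h
  · exact h.eq_or_lt.resolve_right fun h => (hT.gen_lt_gen h).ne hab
  · exact (h.eq_or_lt.resolve_right fun h => (hT.gen_lt_gen h).ne hab.symm).symm

lemma IsTree.exists_covBy (hT : IsTree T) {s : T} {k : ℕ} (hs : gen s = k + 1) :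
    ∃ u, u ⋖ s ∧ gen u = k := by
  have hfin := hT.finite_Iio s
  have hne : (Set.Iio s).Nonempty := by
    rw [gen, Nat.card_coe_set_eq] at hs
    exact (Set.ncard_pos hfin).1 (by omega)
  obtain ⟨u, hu⟩ := hfin.exists_maximal hne
  have hcov : u ⋖ s := ⟨hu.prop, fun c huc hcs => huc.not_ge (hu.le_of_ge hcs huc.le)⟩
  refine ⟨u, hcov, ?_⟩
  have hins : Set.Iio s = insert u (Set.Iio u) := by
    ext x
    simp only [Set.mem_Iio, Set.mem_insert_iff]
    constructor
    · intro hx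
      rcases hT.2.1 s x u hx.le hcov.lt.le with h | h
      · exact h.eq_or_lt
      · exact Or.inl (le_antisymm (hu.le_of_ge hx h) h)
    · rintro (rfl | hx)
      · exact hcov.lt
      · exact hx.trans hcov.lt
  rw [gen, Nat.card_coe_set_eq, hins,
    Set.ncard_insert_of_notMem (s := Set.Iio u) (lt_irrefl u) (hT.finite_Iio u)] at hs
  rw [gen, Nat.card_coe_set_eq]
  omega

lemma IsTree.exists_ancestor (hT : IsTree T) (s : T) {k : ℕ} (hk : k ≤ gen s) :
    ∃ u ≤ s, gen u = k := by
  obtain ⟨d, hd⟩ := Nat.exists_eq_add_of_le hk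
  induction d generalizing s with
  | zero => exact ⟨s, le_rfl, hd⟩
  | succ d ih =>
    obtain ⟨u, hus, hu⟩ := hT.exists_covBy hd
    obtain ⟨u', hu', hk'⟩ := ih u (hu ▸ Nat.le_add_right k d) hu
    exact ⟨u', hu'.trans hus.lt.le, hk'⟩

lemma IsBinaryTree.exists_finset_gen_eq (hT : IsBinaryTree T) (k : ℕ) :
    ∃ F : Finset T, F.card ≤ 2 ^ k ∧ ∀ t, gen t = k → t ∈ F := by
  classical
  induction k with
  | zero =>
    refine ⟨{⊥}, by simp, fun t ht => ?_⟩
    rw [gen, Nat.card_coe_set_eq, Set.ncard_eq_zero (hT.1.finite_Iio t)] at ht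
    by_contra h
    have : (⊥ : T) ∈ Set.Iio t := bot_lt_iff_ne_bot.2 (by simpa using h)
    rw [ht] at this
    exact this
  | succ k ih =>
    obtain ⟨F, hF, hFk⟩ := ih
    refine ⟨F.biUnion fun t => (hT.1.2.2 t).toFinset, ?_, fun t ht => ?_⟩
    · refine (Finset.card_biUnion_le_card_mul F _ 2 fun t _ => ?_).trans ?_
      · have := hT.2 t
        rw [Nat.card_coe_set_eq, Set.ncard_eq_toFinset_card _ (hT.1.2.2 t)] at this
        exact this.le
      · rw [pow_succ]
        exact Nat.mul_le_mul_right 2 hF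
    · obtain ⟨u, hut, hu⟩ := hT.1.exists_covBy ht
      exact Finset.mem_biUnion.2 ⟨u, hFk u hu, by simpa using hut⟩

lemma IsBinaryTree.exists_finset_gen_lt (hT : IsBinaryTree T) (b : ℕ) :
    ∃ F : Finset T, F.card ≤ 2 ^ b ∧ ∀ t, t ∈ F ↔ gen t < b := by
  classical
  induction b with
  | zero => exact ⟨∅, by simp, by simp⟩
  | succ b ih =>
    obtain ⟨F, hF, hFb⟩ := ih
    obtain ⟨G, hG, hGb⟩ := hT.exists_finset_gen_eq b
    refine ⟨F ∪ G.filter fun t => gen t = b, ?_, fun t => ?_⟩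
    · refine (Finset.card_union_le _ _).trans ?_
      have := Finset.card_filter_le G fun t => gen t = b
      rw [pow_succ]
      omega
    · simp only [Finset.mem_union, Finset.mem_filter, hFb]
      constructor
      · rintro (h | h) <;> omega
      · intro h
        rcases Nat.lt_succ_iff_lt_or_eq.1 h with h | h
        · exact Or.inl h
        · exact Or.inr ⟨hGb t h, h⟩

end Tree

lemma rpow_neg_le_mul_sub {γ : ℝ} (hγ : 1 < γ) {x : ℝ} (hx : 1 ≤ x) :
    x ^ (-γ) ≤ 2 ^ γ / (γ - 1) * (x ^ (1 - γ) - (x + 1) ^ (1 - γ)) := by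
  have hx0 : 0 < x := by linarith
  have he : 0 < γ - 1 := by linarith
  have hlog : 1 / (x + 1) ≤ Real.log ((x + 1) / x) := by
    have := Real.one_sub_inv_le_log_of_pos (x := (x + 1) / x) (by positivity)
    have h2 : 1 - ((x + 1) / x)⁻¹ = 1 / (x + 1) := by field_simp; ring
    rwa [h2] at this
  have hratio : 1 + (γ - 1) * (1 / (x + 1)) ≤ ((x + 1) / x) ^ (γ - 1) := by
    rw [Real.rpow_def_of_pos (by positivity)]
    have := Real.add_one_le_exp (Real.log ((x + 1) / x) * (γ - 1))
    nlinarith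
  have hsplit : x ^ (1 - γ) = (x + 1) ^ (1 - γ) * ((x + 1) / x) ^ (γ - 1) := by
    rw [Real.div_rpow (by positivity) hx0.le, ← neg_sub γ 1, Real.rpow_neg hx0.le,
      Real.rpow_neg (by positivity : (0 : ℝ) ≤ x + 1)]
    field_simp
  have hdiff : (γ - 1) * (x + 1) ^ (-γ) ≤ x ^ (1 - γ) - (x + 1) ^ (1 - γ) := by
    have h1 : (x + 1) ^ (-γ) = (x + 1) ^ (1 - γ) * (1 / (x + 1)) := by
      rw [show -γ = (1 - γ) - 1 by ring, Real.rpow_sub_one (by positivity)]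
      ring
    rw [hsplit, h1]
    have : 0 < (x + 1) ^ (1 - γ) := by positivity
    nlinarith
  have hdouble : x ^ (-γ) ≤ 2 ^ γ * (x + 1) ^ (-γ) := by
    have : (2 * x) ^ (-γ) ≤ (x + 1) ^ (-γ) :=
      Real.rpow_le_rpow_of_nonpos (by positivity) (by linarith) (by linarith)
    rw [Real.mul_rpow two_pos.le hx0.le, Real.rpow_neg two_pos.le] at this
    rwa [inv_mul_le_iff₀ (by positivity)] at this
  calc x ^ (-γ) ≤ 2 ^ γ * (x + 1) ^ (-γ) := hdouble
    _ = 2 ^ γ / (γ - 1) * ((γ - 1) * (x + 1) ^ (-γ)) := by field_simp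
    _ ≤ _ := by gcongr

lemma sum_Ico_rpow_neg_le {γ : ℝ} (hγ : 1 < γ) {a : ℕ} (ha : 1 ≤ a) (N : ℕ) :
    ∑ g ∈ Finset.Ico a N, (g : ℝ) ^ (-γ) ≤ 2 ^ γ / (γ - 1) * (a : ℝ) ^ (1 - γ) := by
  have he : 0 < γ - 1 := by linarith
  rcases le_total N a with h | h
  · rw [Finset.Ico_eq_empty_of_le h, Finset.sum_empty]
    positivity
  have htel : ∑ g ∈ Finset.Ico a N, (g : ℝ) ^ (-γ) ≤
      2 ^ γ / (γ - 1) * ((a : ℝ) ^ (1 - γ) - (N : ℝ) ^ (1 - γ)) := by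
    induction N, h using Nat.le_induction with
    | base => simp
    | succ n hn ih =>
      rw [Finset.sum_Ico_succ_top hn]
      have := rpow_neg_le_mul_sub hγ (x := n) (by exact_mod_cast ha.trans hn)
      push_cast
      linarith
  refine htel.trans (mul_le_mul_of_nonneg_left ?_ (by positivity))
  exact sub_le_self _ (by positivity)

/-- Norm bound for a vector supported on the ancestors of `s` of generation at least `a`. -/
lemma norm_le_of_support_on_branch {T : Type} [PartialOrder T] [OrderBot T] (hT : IsTree T)
    {q : ℝ} [Fact (1 ≤ ENNReal.ofReal q)] (hq : 0 < q) {α σ : T → ℝ} (hα : ∀ t, 0 < α t)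
    (hσmono : ∀ ⦃t s : T⦄, t ≤ s → σ s ≤ σ t) {c γ : ℝ} (hc : 0 < c) (hγ : 1 < γ)
    (hw : ∀ t : T, 1 ≤ gen t → α t * σ t ≤ c * (gen t : ℝ) ^ (-(γ / q)))
    {a : ℕ} (ha : 1 ≤ a) (s : T) (f : ellQ T q)
    (hf0 : ∀ t, ¬(t ≤ s ∧ a ≤ gen t) → f t = 0) (hf : ∀ t ≤ s, |f t| ≤ α t * σ s) :
    ‖f‖ ≤ c * (2 ^ γ / (γ - 1)) ^ (1 / q) * (a : ℝ) ^ (-((γ - 1) / q)) := by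
  classical
  have he : 0 < γ - 1 := by linarith
  set R : Finset T := (hT.1 s).toFinset.filter fun t => a ≤ gen t
  have hR : ∀ t, t ∈ R ↔ t ≤ s ∧ a ≤ gen t := fun t => by simp [R]
  have hnorm : ‖f‖ ^ q = ∑ t ∈ R, |f t| ^ q := by
    refine (hasSum_ellQ_rpow hq f).unique (hasSum_sum_of_ne_finset_zero fun t ht => ?_)
    rw [hf0 t fun h => ht ((hR t).2 h), abs_zero, Real.zero_rpow hq.ne']
  have hterm : ∀ t ∈ R, |f t| ^ q ≤ c ^ q * (gen t : ℝ) ^ (-γ) := fun t ht => by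
    obtain ⟨hts, hat⟩ := (hR t).1 ht
    have hle : |f t| ≤ c * (gen t : ℝ) ^ (-(γ / q)) :=
      ((hf t hts).trans (mul_le_mul_of_nonneg_left (hσmono hts) (hα t).le)).trans
        (hw t (ha.trans hat))
    refine (Real.rpow_le_rpow (abs_nonneg _) hle hq.le).trans_eq ?_
    rw [Real.mul_rpow hc.le (by positivity), ← Real.rpow_mul (by positivity), neg_mul,
      div_mul_cancel₀ _ hq.ne']
  have hgen : ∑ t ∈ R, (gen t : ℝ) ^ (-γ) ≤ 2 ^ γ / (γ - 1) * (a : ℝ) ^ (1 - γ) := by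
    have hinj : Set.InjOn (gen : T → ℕ) R := fun x hx y hy hxy =>
      hT.gen_injOn_Iic s ((hR x).1 hx).1 ((hR y).1 hy).1 hxy
    rw [← Finset.sum_image (f := fun g : ℕ => (g : ℝ) ^ (-γ)) hinj]
    refine (Finset.sum_le_sum_of_subset_of_nonneg (t := Finset.Ico a (gen s + 1)) ?_
      fun g _ _ => by positivity).trans (sum_Ico_rpow_neg_le hγ ha _)
    intro g hg
    obtain ⟨t, ht, rfl⟩ := Finset.mem_image.1 hg
    obtain ⟨hts, hat⟩ := (hR t).1 ht
    have : gen t ≤ gen s := by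
      rcases hts.eq_or_lt with rfl | h
      · exact le_rfl
      · exact (hT.gen_lt_gen h).le
    exact Finset.mem_Ico.2 ⟨hat, by omega⟩
  have hpow : ‖f‖ ^ q ≤ c ^ q * (2 ^ γ / (γ - 1) * (a : ℝ) ^ (1 - γ)) := by
    rw [hnorm]
    refine (Finset.sum_le_sum hterm).trans ?_
    rw [← Finset.mul_sum]
    gcongr
  have := Real.rpow_le_rpow (by positivity) hpow (one_div_nonneg.2 hq.le)
  rw [← Real.rpow_mul (norm_nonneg _), mul_one_div_cancel hq.ne', Real.rpow_one,
    Real.mul_rpow (by positivity) (by positivity), Real.mul_rpow (by positivity) (by positivity),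
    ← Real.rpow_mul hc.le, ← Real.rpow_mul (by positivity), mul_one_div_cancel hq.ne',
    Real.rpow_one] at this
  rw [mul_assoc]
  convert this using 4
  ring

/-! ### Finite covers -/

/-- The range of `f` is covered by `N` closed balls of radius `ε`. -/
def HasCover {X Y : Type} [NormedAddCommGroup Y] (f : X → Y) (N : ℕ) (ε : ℝ) : Prop :=
  ∃ F : Finset Y, F.card ≤ N ∧ ∀ x, ∃ y ∈ F, ‖f x - y‖ ≤ ε

section Cover

variable {X Y : Type} [NormedAddCommGroup Y]

open scoped Pointwise in
lemma HasCover.add {f g : X → Y} {N M : ℕ} {ε δ : ℝ} (hf : HasCover f N ε)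
    (hg : HasCover g M δ) : HasCover (fun x => f x + g x) (N * M) (ε + δ) := by
  classical
  obtain ⟨F, hF, hfF⟩ := hf
  obtain ⟨G, hG, hgG⟩ := hg
  refine ⟨F + G, Finset.card_add_le.trans (Nat.mul_le_mul hF hG), fun x => ?_⟩
  obtain ⟨y, hy, hxy⟩ := hfF x
  obtain ⟨z, hz, hxz⟩ := hgG x
  refine ⟨y + z, Finset.add_mem_add hy hz, ?_⟩
  rw [add_sub_add_comm]
  exact (norm_add_le _ _).trans (add_le_add hxy hxz)

lemma hasCover_one_of_norm_le {f : X → Y} {ε : ℝ} (hf : ∀ x, ‖f x‖ ≤ ε) : HasCover f 1 ε :=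
  ⟨{0}, by simp, fun x => ⟨0, by simp, by simpa using hf x⟩⟩

lemma HasCover.sum_range {f : ℕ → X → Y} {b : ℕ → ℕ} {ε : ℕ → ℝ} {J : ℕ}
    (hf : ∀ j < J, HasCover (f j) (2 ^ b j) (ε j)) :
    HasCover (fun x => ∑ j ∈ Finset.range J, f j x) (2 ^ ∑ j ∈ Finset.range J, b j)
      (∑ j ∈ Finset.range J, ε j) := by
  induction J with
  | zero => simpa using hasCover_one_of_norm_le (f := fun _ : X => (0 : Y)) (by simp)
  | succ J ih =>
    simp only [Finset.sum_range_succ, pow_add]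
    exact (ih fun j hj => hf j (hj.trans J.lt_succ_self)).add (hf J J.lt_succ_self)

lemma HasCover.mono {f : X → Y} {N M : ℕ} {ε δ : ℝ} (hf : HasCover f N ε) (hN : N ≤ M)
    (hε : ε ≤ δ) : HasCover f M δ := by
  obtain ⟨F, hF, h⟩ := hf
  refine ⟨F, hF.trans hN, fun x => ?_⟩
  obtain ⟨y, hy, hxy⟩ := h x
  exact ⟨y, hy, hxy.trans hε⟩

end Cover

/-- Finitely supported coefficient families on `T` with absolute sum at most one. -/
abbrev UnitCoeffs (T : Type) := {p : Finset T × (T → ℝ) // ∑ s ∈ p.1, |p.2 s| ≤ 1}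

/-- The linear combination of the family `a` with the given coefficients. -/
def UnitCoeffs.comb {T Y : Type} [NormedAddCommGroup Y] [NormedSpace ℝ Y] (x : UnitCoeffs T)
    (a : T → Y) : Y :=
  ∑ s ∈ x.1.1, x.1.2 s • a s

section Comb

variable {T Y : Type} [NormedAddCommGroup Y] [NormedSpace ℝ Y]

lemma UnitCoeffs.norm_comb_le (x : UnitCoeffs T) {a : T → Y} {r : ℝ} (hr : 0 ≤ r)
    (ha : ∀ s, ‖a s‖ ≤ r) : ‖x.comb a‖ ≤ r := by
  calc ‖x.comb a‖ ≤ ∑ s ∈ x.1.1, |x.1.2 s| * r := by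
        refine (norm_sum_le _ _).trans (Finset.sum_le_sum fun s _ => ?_)
        rw [norm_smul, Real.norm_eq_abs]
        exact mul_le_mul_of_nonneg_left (ha s) (abs_nonneg _)
    _ ≤ r := by
        rw [← Finset.sum_mul]
        exact mul_le_of_le_one_left hr x.2

lemma UnitCoeffs.map_comb {Z : Type} [NormedAddCommGroup Z] [NormedSpace ℝ Z]
    (x : UnitCoeffs T) (a : T → Y) (Q : Y →L[ℝ] Z) : Q (x.comb a) = x.comb fun s => Q (a s) := by
  simp [comb]

lemma HasSmallSignedSums.hasCover_comb {η C : ℝ} (hY : HasSmallSignedSums Y η C)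
    (hη : 0 ≤ η) (hη1 : η < 1) (hC : 0 < C) (U : Finset T) (a : T → Y) {r : ℝ} (hr : 0 < r)
    (har : ∀ u ∈ U, ‖a u‖ ≤ r) (haU : ∀ s, ∃ u ∈ U, ∃ l : ℝ, |l| ≤ 1 ∧ a s = l • a u)
    {m : ℕ} (hm : 1 ≤ m) :
    HasCover (fun x : UnitCoeffs T => x.comb a) ((2 * U.card + 1) ^ m)
      ((C * (1 - (2 : ℝ) ^ (η - 1))⁻¹ + 1) * r * (m : ℝ) ^ (η - 1)) := by
  classical
  choose φ hφU l hl hal using haU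
  obtain ⟨F, hF, hcov⟩ := hY.exists_cover hη hη1 hC U a hr har hm
  refine ⟨F, hF, fun ⟨(S, x), hx⟩ => ?_⟩
  obtain ⟨y, hy, hle⟩ := hcov (fun u => ∑ s ∈ S with φ s = u, x s * l s) (by
    refine le_trans ?_ hx
    rw [← Finset.sum_fiberwise_of_maps_to (fun s (_ : s ∈ S) => hφU s) fun s => |x s|]
    refine Finset.sum_le_sum fun u _ => (Finset.abs_sum_le_sum_abs _ _).trans ?_
    refine Finset.sum_le_sum fun s _ => ?_
    rw [abs_mul]
    exact mul_le_of_le_one_right (abs_nonneg _) (hl s))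
  refine ⟨y, hy, ?_⟩
  convert hle using 3
  change ∑ s ∈ S, x s • a s = _
  rw [← Finset.sum_fiberwise_of_maps_to (fun s (_ : s ∈ S) => hφU s)]
  refine Finset.sum_congr rfl fun u _ => ?_
  rw [Finset.sum_smul]
  refine Finset.sum_congr rfl fun s hs => ?_
  rw [hal s, (Finset.mem_filter.1 hs).2, smul_smul]

end Comb

section Restriction

variable {T : Type} [DecidableEq T] {q : ℝ} [Fact (1 ≤ ENNReal.ofReal q)]

/-- Restriction of a sequence to the coordinates in a finite set. -/
def restrictTo (B : Finset T) : ellQ T q →L[ℝ] ellQ T q :=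
  ∑ t ∈ B, (lp.singleContinuousLinearMap ℝ (fun _ : T => ℝ) (ENNReal.ofReal q) t).comp
    (lp.evalCLM ℝ (fun _ : T => ℝ) (ENNReal.ofReal q) t)

lemma restrictTo_eq_sum (B : Finset T) (f : ellQ T q) :
    restrictTo B f = ∑ t ∈ B, lp.single (ENNReal.ofReal q) t (f t) := by
  simp only [restrictTo, sum_apply]
  rfl

lemma restrictTo_apply (B : Finset T) (f : ellQ T q) (t : T) :
    restrictTo B f t = if t ∈ B then f t else 0 := by
  rw [restrictTo_eq_sum, lp.coeFn_sum, Finset.sum_apply]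
  simp only [lp.single_apply]
  rw [Finset.sum_pi_single]

lemma restrictTo_sdiff_apply {A B : Finset T} (hAB : A ⊆ B) (f : ellQ T q) :
    restrictTo (B \ A) f = restrictTo B f - restrictTo A f := by
  ext t
  rw [lp.coeFn_sub, Pi.sub_apply]
  simp only [restrictTo_apply, Finset.mem_sdiff]
  by_cases hA : t ∈ A
  · simp [hA, hAB hA]
  · simp [hA]

/-- A grid cover of the coordinates in `B` of a bounded family. -/
lemma hasCover_restrictTo {X : Type} (B : Finset T) (f : X → ellQ T q) {K : ℝ} (hK : 0 < K)
    (hf : ∀ x t, |f x t| ≤ K) {G : ℕ} (hG : 0 < G) :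
    HasCover (fun x => restrictTo B (f x)) ((2 * G + 1) ^ B.card) (B.card * (K / G)) := by
  classical
  have hq0 : 0 < ENNReal.ofReal q := lt_of_lt_of_le one_pos Fact.out
  have hG0 : (0 : ℝ) < G := by exact_mod_cast hG
  refine ⟨(Finset.univ : Finset (B → Fin (2 * G + 1))).image fun i =>
    ∑ t : B, lp.single (ENNReal.ofReal q) t.1 (K * ((i t : ℝ) / G - 1)), ?_, fun x => ?_⟩
  · refine Finset.card_image_le.trans ?_
    simp
  have hlow : ∀ t, 0 ≤ (f x t / K + 1) * G := fun t => by
    have := (abs_le.1 (hf x t)).1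
    have : -1 ≤ f x t / K := by rw [le_div_iff₀ hK]; linarith
    exact mul_nonneg (by linarith) hG0.le
  have hup : ∀ t, (f x t / K + 1) * G ≤ 2 * G := fun t => by
    have := (abs_le.1 (hf x t)).2
    have : f x t / K ≤ 1 := by rw [div_le_iff₀ hK]; linarith
    gcongr
    linarith
  have hfloor : ∀ t, ⌊(f x t / K + 1) * G⌋₊ < 2 * G + 1 := fun t => by
    have : ⌊(f x t / K + 1) * G⌋₊ ≤ 2 * G := by
      refine Nat.floor_le_of_le ?_
      push_cast
      exact hup t
    omega
  refine ⟨_, Finset.mem_image_of_mem _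
    (Finset.mem_univ fun t : B => ⟨⌊(f x t / K + 1) * G⌋₊, hfloor t⟩), ?_⟩
  beta_reduce
  rw [restrictTo_eq_sum, ← Finset.sum_coe_sort B, ← Finset.sum_sub_distrib]
  refine (norm_sum_le _ _).trans ?_
  have hterm : ∀ t : B, ‖lp.single (E := fun _ : T => ℝ) (ENNReal.ofReal q) t.1 (f x t) -
      lp.single (ENNReal.ofReal q) t.1
        (K * ((⌊(f x t / K + 1) * G⌋₊ : ℝ) / G - 1))‖ ≤ K / G := fun t => by
    rw [← lp.single_sub, lp.norm_single hq0, Real.norm_eq_abs]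
    have h1 := Nat.floor_le (hlow t)
    have h2 := Nat.lt_floor_add_one ((f x t / K + 1) * G)
    set z : ℝ := (⌊(f x t / K + 1) * G⌋₊ : ℝ)
    have heq : f x t - K * (z / G - 1) = K / G * ((f x t / K + 1) * G - z) := by
      field_simp
      ring
    rw [heq, abs_mul, abs_of_pos (by positivity : 0 < K / G)]
    refine mul_le_of_le_one_right (by positivity) (abs_le.2 ⟨by linarith, by linarith⟩)
  refine (Finset.sum_le_card_nsmul _ _ _ fun t _ => hterm t).trans ?_
  simp [nsmul_eq_mul]

end Restriction

/-- Finite linear combinations of the images of unit vectors determine the entropy numbers. -/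
lemma entropyNumber_le_of_hasCover {T Y : Type} [DecidableEq T] [NormedAddCommGroup Y]
    [NormedSpace ℝ Y] (V : ellOne T →L[ℝ] Y) {n N : ℕ} {ε : ℝ} (hε : 0 < ε)
    (hN : N ≤ 2 ^ (n - 1))
    (h : HasCover (fun x : UnitCoeffs T => x.comb fun s => V (lp.single 1 s 1)) N ε) :
    entropyNumber n V ≤ 2 * ε := by
  obtain ⟨F, hF, hcov⟩ := h
  refine csInf_le ⟨0, fun x hx => hx.1.le⟩ ⟨by positivity, F, hF.trans hN, fun x hx => ?_⟩
  have hsum : HasSum (fun s => x s • V (lp.single 1 s 1)) (V x) := by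
    convert (lp.hasSum_single (p := 1) ENNReal.one_ne_top x).mapL V using 2 with s
    rw [← map_smul, ← lp.single_smul, smul_eq_mul, mul_one]
  obtain ⟨S, hS⟩ := (Metric.tendsto_atTop.1 hsum ε hε)
  have hSx : ∑ s ∈ S, |x s| ≤ 1 := by
    have := lp.sum_rpow_le_norm_rpow (p := 1) (by simp) x S
    simp only [ENNReal.toReal_one, Real.rpow_one, Real.norm_eq_abs] at this
    exact this.trans hx
  obtain ⟨y, hy, hle⟩ := hcov ⟨(S, x), hSx⟩
  refine ⟨y, hy, ?_⟩
  have hclose := hS S le_rfl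
  rw [dist_comm, dist_eq_norm] at hclose
  calc ‖V x - y‖ ≤ ‖V x - ∑ s ∈ S, x s • V (lp.single 1 s 1)‖ +
        ‖∑ s ∈ S, x s • V (lp.single 1 s 1) - y‖ := norm_sub_le_norm_sub_add_norm_sub _ _ _
    _ < ε + ε := add_lt_add_of_lt_of_le hclose hle
    _ = 2 * ε := by ring

lemma entropyNumber_le_norm_add_one {X Y : Type} [NormedAddCommGroup X] [NormedSpace ℝ X]
    [NormedAddCommGroup Y] [NormedSpace ℝ Y] (n : ℕ) (V : X →L[ℝ] Y) :
    entropyNumber n V ≤ ‖V‖ + 1 := by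
  refine csInf_le ⟨0, fun x hx => hx.1.le⟩
    ⟨by positivity, {0}, by simpa using Nat.one_le_two_pow, fun x hx => ⟨0, by simp, ?_⟩⟩
  rw [sub_zero]
  have := V.le_opNorm x
  nlinarith [norm_nonneg V]

/-! ### The weighted summation operator on blocks of generations -/

section Blocks

variable {T : Type} [PartialOrder T] {q : ℝ} {α σ : T → ℝ}

/-- The family `a` consists of the functions `α(t) σ(s)` supported on the branches `t ≤ s`. -/
def IsBranchFamily (α σ : T → ℝ) (a : T → ellQ T q) : Prop :=
  ∀ s t, (t ≤ s → a s t = α t * σ s) ∧ (¬t ≤ s → a s t = 0)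

lemma IsBranchFamily.norm_le [OrderBot T] [Fact (1 ≤ ENNReal.ofReal q)] {a : T → ellQ T q}
    (ha : IsBranchFamily α σ a) (hT : IsTree T) (hq : 0 < q) (hα : ∀ t, 0 < α t)
    (hσpos : ∀ t, 0 < σ t) (hσmono : ∀ ⦃t s : T⦄, t ≤ s → σ s ≤ σ t) {c γ : ℝ} (hc : 0 < c) (hγ : 1 < γ)
    (hw : ∀ t : T, 1 ≤ gen t → α t * σ t ≤ c * (gen t : ℝ) ^ (-(γ / q)))
    {k : ℕ} (hk : 1 ≤ k) (s : T) (f : ellQ T q) (hf : ∀ t, f t = a s t ∨ f t = 0)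
    (hf0 : ∀ t, gen t < k → f t = 0) :
    ‖f‖ ≤ c * (2 ^ γ / (γ - 1)) ^ (1 / q) * (k : ℝ) ^ (-((γ - 1) / q)) := by
  refine norm_le_of_support_on_branch hT hq hα hσmono hc hγ hw hk s f (fun t ht => ?_)
    fun t hts => ?_
  · by_cases hts : t ≤ s
    · exact hf0 t (by by_contra h; exact ht ⟨hts, by omega⟩)
    · obtain h | h := hf t
      · rw [h, (ha s t).2 hts]
      · exact h
  · have hpos := mul_pos (hα t) (hσpos s)
    obtain h | h := hf t
    · rw [h, (ha s t).1 hts, abs_of_pos hpos]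
    · rw [h, abs_zero]
      exact hpos.le

variable [DecidableEq T]

lemma isBranchFamily_map_single [Fact (1 ≤ ENNReal.ofReal q)] (V : ellOne T →L[ℝ] ellQ T q)
    (hV : ∀ (x : ellOne T) (t : T), (V x : ∀ _ : T, ℝ) t =
      α t * ∑' s : {s : T // t ≤ s}, σ s.1 * (x : ∀ _ : T, ℝ) s.1) :
    IsBranchFamily α σ fun s => V (lp.single 1 s 1) := by
  intro s t
  rw [hV]
  constructor
  · intro hts
    rw [tsum_eq_single (⟨s, hts⟩ : {s : T // t ≤ s})]
    · simp
    · intro u hu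
      have : u.1 ≠ s := fun h => hu (Subtype.ext h)
      simp [lp.single_apply, this]
  · intro hts
    have : ∀ u : {s : T // t ≤ s}, σ u.1 * (lp.single 1 s (1 : ℝ) : ellOne T) u.1 = 0 := by
      intro u
      have : u.1 ≠ s := fun h => hts (h ▸ u.2)
      simp [lp.single_apply, this]
    rw [tsum_congr this, tsum_zero, mul_zero]

variable [OrderBot T] [Fact (1 ≤ ENNReal.ofReal q)] {a : T → ellQ T q}

lemma IsBranchFamily.exists_smul_eq (ha : IsBranchFamily α σ a) (hT : IsTree T)
    (hσpos : ∀ t, 0 < σ t) (hσmono : ∀ ⦃t s : T⦄, t ≤ s → σ s ≤ σ t) {b : ℕ} (hb : 1 ≤ b)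
    {D : Finset T} (hD : ∀ t ∈ D, gen t < b) (s : T) :
    ∃ u, gen u < b ∧ ∃ l : ℝ, |l| ≤ 1 ∧ restrictTo D (a s) = l • restrictTo D (a u) := by
  obtain hs | hs := lt_or_ge (gen s) b
  · exact ⟨s, hs, 1, by simp, by simp⟩
  obtain ⟨u, hus, hu⟩ := hT.exists_ancestor s (k := b - 1) (by omega)
  refine ⟨u, by omega, σ s / σ u, ?_, ?_⟩
  · rw [abs_of_pos (div_pos (hσpos s) (hσpos u)), div_le_one (hσpos u)]
    exact hσmono hus
  ext t
  rw [lp.coeFn_smul, Pi.smul_apply, restrictTo_apply, restrictTo_apply, smul_eq_mul]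
  split_ifs with ht
  · have hiff : t ≤ u ↔ t ≤ s := by
      refine ⟨fun h => h.trans hus, fun h => ?_⟩
      obtain h' | h' := hT.2.1 s t u h hus
      · exact h'
      obtain h' | h' := h'.lt_or_eq
      · have := hT.gen_lt_gen h'
        have := hD t ht
        omega
      · exact h'.ge
    by_cases hts : t ≤ s
    · rw [(ha s t).1 hts, (ha u t).1 (hiff.2 hts)]
      have := (hσpos u).ne'
      field_simp
    · rw [(ha s t).2 hts, (ha u t).2 (mt hiff.1 hts), mul_zero]
  · rw [mul_zero]

end Blocks

/-- Block decomposition of the entropy numbers of the weighted summation operator: the first `L`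
generations are covered by a grid of mesh `2 ^ (-g)`, the generations between `L 2 ^ j` and
`L 2 ^ (j + 1)` by signed averages of length `m j`, and the remaining ones are neglected. -/
lemma exists_entropyNumber_le_block_sum {T : Type} [PartialOrder T] [OrderBot T]
    (hbin : IsBinaryTree T) (q : ℝ) (hq : 1 < q)
    (α σ : T → ℝ) (hα : ∀ t, 0 < α t) (hσpos : ∀ t, 0 < σ t)
    (hσmono : ∀ ⦃t s : T⦄, t ≤ s → σ s ≤ σ t)
    [Fact (1 ≤ ENNReal.ofReal q)]
    (V : ellOne T →L[ℝ] ellQ T q)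
    (hV : ∀ (x : ellOne T) (t : T), (V x : ∀ _ : T, ℝ) t =
      α t * ∑' s : {s : T // t ≤ s}, σ s.1 * (x : ∀ _ : T, ℝ) s.1)
    (c γ : ℝ) (hc : 0 < c) (hγ : 1 < γ)
    (hw : ∀ t : T, 1 ≤ gen t → α t * σ t ≤ c * (gen t : ℝ) ^ (-(γ / q))) :
    ∃ C > 0, ∀ (L J g n : ℕ) (m : ℕ → ℕ), 1 ≤ L → (∀ j, 1 ≤ m j) →
      (g + 2) * 2 ^ L + ∑ j ∈ Finset.range J, m j * (L * 2 ^ (j + 1) + 2) ≤ n - 1 →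
      entropyNumber n V ≤ C * ((2 : ℝ) ^ L / 2 ^ g +
        ∑ j ∈ Finset.range J, (L * 2 ^ j : ℝ) ^ (-((γ - 1) / q)) *
          (m j : ℝ) ^ (-(1 - max (1 / 2) (1 / q))) + (L * 2 ^ J : ℝ) ^ (-((γ - 1) / q))) := by
  classical
  have hq0 : 0 < q := by linarith
  set β := (γ - 1) / q
  set η : ℝ := max (1 / 2) (1 / q)
  have hη0 : 0 ≤ η := le_max_of_le_left (by norm_num)
  have hη1 : η < 1 := max_lt (by norm_num) (by rw [div_lt_one hq0]; exact hq)
  obtain ⟨C₀, hC₀, hsigned⟩ := exists_hasSmallSignedSums_ellQ T q hq0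
  have hinv : 0 < (1 - (2 : ℝ) ^ (η - 1))⁻¹ := by
    refine inv_pos.2 (sub_pos.2 (Real.rpow_lt_one_of_one_lt_of_neg (by norm_num) (by linarith)))
  set C₁ := C₀ * (1 - (2 : ℝ) ^ (η - 1))⁻¹ + 1
  have hC₁ : 1 ≤ C₁ := by
    have : 0 < C₀ * (1 - (2 : ℝ) ^ (η - 1))⁻¹ := by positivity
    linarith
  set M := c * (2 ^ γ / (γ - 1)) ^ (1 / q)
  have hγ1 : 0 < γ - 1 := by linarith
  have hM : 0 < M := by positivity
  set K := ‖V‖ + 1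
  have hK : 0 < K := by positivity
  set a : T → ellQ T q := fun s => V (lp.single 1 s 1)
  have ha : IsBranchFamily α σ a := isBranchFamily_map_single V hV
  have haK : ∀ (x : UnitCoeffs T) t, |x.comb a t| ≤ K := fun x t => by
    refine (lp.norm_apply_le_norm (by simpa using hq0) (x.comb a) t).trans
      (x.norm_comb_le hK.le fun s => ?_)
    refine (V.le_opNorm _).trans ?_
    rw [lp.norm_single (by simp)]
    simp [K]
  choose B hBcard hB using hbin.exists_finset_gen_lt
  have hBmono : ∀ {k b}, k ≤ b → B k ⊆ B b := fun hkb t ht =>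
    (hB _ t).2 (((hB _ t).1 ht).trans_le hkb)
  have hbits : ∀ k : ℕ, 2 * 2 ^ k + 1 ≤ 2 ^ (k + 2) := fun k => by
    have := Nat.one_le_two_pow (n := k)
    rw [pow_add]
    omega
  refine ⟨2 * (K + C₁ * M), by positivity, fun L J g n m hL hm hn => ?_⟩
  have hL0 : (0 : ℝ) < L := by exact_mod_cast hL
  -- the first generations
  have hlow : HasCover (fun x : UnitCoeffs T => restrictTo (B L) (x.comb a))
      (2 ^ ((g + 2) * 2 ^ L)) (2 ^ L * (K / 2 ^ g)) := by
    refine (hasCover_restrictTo (B L) (fun x : UnitCoeffs T => x.comb a) hK haK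
      (G := 2 ^ g) (by positivity)).mono ?_ ?_
    · rw [pow_mul]
      exact (Nat.pow_le_pow_left (hbits g) _).trans
        (Nat.pow_le_pow_right (by positivity) (hBcard L))
    · push_cast
      gcongr
      exact_mod_cast hBcard L
  -- the blocks
  have hblock : ∀ j < J, HasCover
      (fun x : UnitCoeffs T => restrictTo (B (L * 2 ^ (j + 1)) \ B (L * 2 ^ j)) (x.comb a))
      (2 ^ (m j * (L * 2 ^ (j + 1) + 2)))
      (C₁ * M * ((L * 2 ^ j : ℝ) ^ (-β) * (m j : ℝ) ^ (-(1 - η)))) := fun j _ => by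
    have hk : 1 ≤ L * 2 ^ j := Nat.mul_pos hL (by positivity)
    have hb : 1 ≤ L * 2 ^ (j + 1) := Nat.mul_pos hL (by positivity)
    have := hsigned.hasCover_comb hη0 hη1 hC₀ (B (L * 2 ^ (j + 1)))
      (fun s => restrictTo (B (L * 2 ^ (j + 1)) \ B (L * 2 ^ j)) (a s))
      (r := M * ((L * 2 ^ j : ℕ) : ℝ) ^ (-β)) (by positivity)
      (fun u _ => ha.norm_le hbin.1 hq0 hα hσpos hσmono hc hγ hw hk u _
        (fun t => by rw [restrictTo_apply]; split_ifs <;> simp)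
        (fun t ht => by rw [restrictTo_apply, if_neg]; simp [hB, ht]))
      (fun s => by
        simp only [hB]
        refine ha.exists_smul_eq hbin.1 hσpos hσmono hb (fun t ht => ?_) s
        simpa [hB] using (Finset.mem_sdiff.1 ht).1)
      (hm j)
    simp only [UnitCoeffs.map_comb]
    refine this.mono ?_ (le_of_eq ?_)
    · rw [mul_comm (m j), pow_mul]
      refine Nat.pow_le_pow_left (le_trans ?_ (hbits _)) _
      have := hBcard (L * 2 ^ (j + 1))
      omega
    · rw [neg_sub]
      push_cast
      ring
  -- the tail
  have htail : HasCover (fun x : UnitCoeffs T => x.comb a - restrictTo (B (L * 2 ^ J)) (x.comb a))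
      1 (M * (L * 2 ^ J : ℝ) ^ (-β)) := by
    refine hasCover_one_of_norm_le fun x => ?_
    have hk : 1 ≤ L * 2 ^ J := Nat.mul_pos hL (by positivity)
    set Q : ellQ T q →L[ℝ] ellQ T q := .id ℝ _ - restrictTo (B (L * 2 ^ J))
    have hQ : ∀ s t, Q (a s) t = a s t - if t ∈ B (L * 2 ^ J) then a s t else 0 := fun s t => by
      rw [← restrictTo_apply]
      rfl
    have := x.norm_comb_le (a := fun s => Q (a s))
      (r := M * ((L * 2 ^ J : ℕ) : ℝ) ^ (-β)) (by positivity) fun s =>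
        ha.norm_le hbin.1 hq0 hα hσpos hσmono hc hγ hw hk s _
        (fun t => by rw [hQ]; split_ifs <;> simp) (fun t ht => by simp [hQ, hB, ht])
    rw [← UnitCoeffs.map_comb] at this
    push_cast at this
    exact this
  have hall := (hlow.add (HasCover.sum_range hblock)).add htail
  have heq : ∀ x : UnitCoeffs T, restrictTo (B L) (x.comb a) +
      ∑ j ∈ Finset.range J, restrictTo (B (L * 2 ^ (j + 1)) \ B (L * 2 ^ j)) (x.comb a) +
      (x.comb a - restrictTo (B (L * 2 ^ J)) (x.comb a)) = x.comb a := fun x => by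
    have : ∀ j, restrictTo (B (L * 2 ^ (j + 1)) \ B (L * 2 ^ j)) (x.comb a) =
        restrictTo (B (L * 2 ^ (j + 1))) (x.comb a) - restrictTo (B (L * 2 ^ j)) (x.comb a) :=
      fun j => restrictTo_sdiff_apply
        (hBmono (Nat.mul_le_mul_left _ (Nat.pow_le_pow_right (by norm_num) j.le_succ))) _
    simp only [this]
    rw [Finset.sum_range_sub fun j => restrictTo (B (L * 2 ^ j)) (x.comb a)]
    simp
  simp only [heq, mul_one, ← pow_add] at hall
  set S := ∑ j ∈ Finset.range J, (L * 2 ^ j : ℝ) ^ (-β) * (m j : ℝ) ^ (-(1 - η)) with hS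
  have hS0 : 0 ≤ S := Finset.sum_nonneg fun j _ => by positivity
  have hR0 : 0 < (L * 2 ^ J : ℝ) ^ (-β) := by positivity
  have hG0 : 0 < (2 : ℝ) ^ L / 2 ^ g := by positivity
  rw [← Finset.mul_sum, ← hS] at hall
  have hε : 2 ^ L * (K / 2 ^ g) + C₁ * M * S + M * (L * 2 ^ J : ℝ) ^ (-β) ≤
      (K + C₁ * M) * ((2 : ℝ) ^ L / 2 ^ g + S + (L * 2 ^ J : ℝ) ^ (-β)) := by
    have h1 : (2 : ℝ) ^ L * (K / 2 ^ g) = K * (2 ^ L / 2 ^ g) := by ring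
    have h2 : M ≤ C₁ * M := le_mul_of_one_le_left hM.le hC₁
    have h3 := mul_le_mul_of_nonneg_right h2 hR0.le
    have h4 : 0 ≤ C₁ * M * (2 ^ L / 2 ^ g) := by positivity
    have h5 : 0 ≤ K * S := by positivity
    have h6 : 0 ≤ K * (L * 2 ^ J : ℝ) ^ (-β) := by positivity
    rw [h1]
    linarith
  rw [mul_assoc 2]
  exact entropyNumber_le_of_hasCover V (by positivity) (Nat.pow_le_pow_right (by norm_num) hn)
    (hall.mono le_rfl hε)

/-! ### Choice of the parameters -/

lemma sum_range_pow_le {ρ : ℝ} (h0 : 0 ≤ ρ) (h1 : ρ < 1) (J : ℕ) :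
    ∑ j ∈ Finset.range J, ρ ^ j ≤ (1 - ρ)⁻¹ := by
  rw [← tsum_geometric_of_lt_one h0 h1]
  exact (summable_geometric_of_lt_one h0 h1).sum_le_tsum _ fun j _ => by positivity

lemma sum_range_pow_sub_le {ρ : ℝ} (h0 : 0 ≤ ρ) (h1 : ρ < 1) (J : ℕ) :
    ∑ j ∈ Finset.range J, ρ ^ (J - j) ≤ (1 - ρ)⁻¹ := by
  refine le_trans (le_of_eq ?_) (sum_range_pow_succ_le h0 h1 J)
  rw [← Finset.sum_range_reflect]
  refine Finset.sum_congr rfl fun j hj => ?_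
  have := Finset.mem_range.1 hj
  congr 1
  omega

/-- Every large integer lies between two consecutive terms of a geometric progression. -/
lemma exists_mul_pow_le_of_le {A D n : ℕ} (hA : 1 ≤ A) (hD : 1 < D) (hn : A * D + 1 ≤ n) :
    ∃ k, 1 ≤ k ∧ A * D ^ k ≤ n - 1 ∧ n ≤ A * D ^ (k + 1) := by
  have hDn : D ≤ (n - 1) / A := by
    rw [Nat.le_div_iff_mul_le hA, mul_comm]
    omega
  refine ⟨Nat.log D ((n - 1) / A), Nat.log_pos hD hDn, ?_, ?_⟩
  · have := Nat.pow_log_le_self D (x := (n - 1) / A) (by omega)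
    rw [Nat.le_div_iff_mul_le hA] at this
    rwa [mul_comm]
  · have := Nat.lt_pow_succ_log_self hD ((n - 1) / A)
    rw [Nat.div_lt_iff_lt_mul hA, mul_comm, Nat.succ_eq_add_one] at this
    omega

/-- `e` obeys the bound of `exists_entropyNumber_le_block_sum` with exponents `β` and `θ`. -/
def HasBlockBound (e : ℕ → ℝ) (C β θ : ℝ) : Prop :=
  ∀ (L J g n : ℕ) (m : ℕ → ℕ), 1 ≤ L → (∀ j, 1 ≤ m j) →
    (g + 2) * 2 ^ L + ∑ j ∈ Finset.range J, m j * (L * 2 ^ (j + 1) + 2) ≤ n - 1 →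
    e n ≤ C * ((2 : ℝ) ^ L / 2 ^ g +
      ∑ j ∈ Finset.range J, (L * 2 ^ j : ℝ) ^ (-β) * (m j : ℝ) ^ (-θ) + (L * 2 ^ J : ℝ) ^ (-β))

lemma HasBlockBound.exists_le_rpow {e : ℕ → ℝ} {C β θ : ℝ} (h : HasBlockBound e C β θ)
    (hC : 0 < C) (hβ : 0 < β) (hβθ : β < θ) (hθ : θ ≤ 1) :
    ∃ C' > 0, ∃ N : ℕ, ∀ n ≥ N, e n ≤ C' * (n : ℝ) ^ (-β) := by
  have hθ0 : 0 < θ := hβ.trans hβθ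
  set δ := (θ - β) / (2 * θ)
  have hδ : 0 < δ := div_pos (by linarith) (by positivity)
  have hδθ : δ * θ = (θ - β) / 2 := by simp only [δ]; field_simp
  have hδ1 : δ ≤ 1 := by
    rw [div_le_one (by positivity)]
    linarith
  set ρ : ℝ := 2 ^ (-δ)
  have hρ0 : 0 < ρ := by positivity
  have hρ1 : ρ < 1 := Real.rpow_lt_one_of_one_lt_of_neg (by norm_num) (by linarith)
  set τ : ℝ := 2 ^ (-((θ - β) / 2))
  have hτ0 : 0 < τ := by positivity
  have hτ1 : τ < 1 := Real.rpow_lt_one_of_one_lt_of_neg (by norm_num) (by linarith)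
  have hρi : 0 < (1 - ρ)⁻¹ := inv_pos.2 (by linarith)
  have hτi : 0 < (1 - τ)⁻¹ := inv_pos.2 (by linarith)
  set A : ℕ := ⌈4 + 8 * (1 - ρ)⁻¹⌉₊
  have hA : 4 + 8 * (1 - ρ)⁻¹ ≤ A := Nat.le_ceil _
  have hA1 : 1 ≤ A := by
    have : (1 : ℝ) ≤ A := by linarith
    exact_mod_cast this
  have hA0 : (0 : ℝ) < A := by exact_mod_cast hA1
  refine ⟨C * (3 + (1 - τ)⁻¹) * (2 * A) ^ β, by positivity, A * 2 + 1, fun n hn => ?_⟩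
  obtain ⟨J, hJ, hJn, hnJ⟩ := exists_mul_pow_le_of_le hA1 (by norm_num) hn
  set x : ℕ → ℝ := fun j => 2 ^ (((J - j : ℕ) : ℝ) * (1 - δ))
  have hx1 : ∀ j, 1 ≤ x j := fun j =>
    Real.one_le_rpow (by norm_num) (mul_nonneg (by positivity) (by linarith))
  have hsub : ∀ j ∈ Finset.range J, ((J - j : ℕ) : ℝ) = J - j := fun j hj =>
    Nat.cast_sub (Finset.mem_range.1 hj).le
  have hceil : ∀ j, (⌈x j⌉₊ : ℝ) ≤ 2 * x j := fun j => by
    have := Nat.ceil_lt_add_one (zero_le_one.trans (hx1 j))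
    linarith [hx1 j]
  have hbits : (J + 2) * 2 ^ 1 + ∑ j ∈ Finset.range J, ⌈x j⌉₊ * (1 * 2 ^ (j + 1) + 2) ≤ n - 1 := by
    refine le_trans ?_ hJn
    have hsum : ∑ j ∈ Finset.range J, (⌈x j⌉₊ : ℝ) * (1 * 2 ^ (j + 1) + 2) ≤
        8 * 2 ^ J * (1 - ρ)⁻¹ := by
      refine le_trans ?_ (mul_le_mul_of_nonneg_left (sum_range_pow_sub_le hρ0.le hρ1 J)
        (by positivity))
      rw [Finset.mul_sum]
      refine Finset.sum_le_sum fun j hj => ?_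
      have h2 : (1 : ℝ) * 2 ^ (j + 1) + 2 ≤ 4 * 2 ^ j := by
        have : (1 : ℝ) ≤ 2 ^ j := one_le_pow₀ (by norm_num)
        rw [pow_succ]
        linarith
      have heq : x j * 2 ^ j = 2 ^ J * ρ ^ (J - j) := by
        simp only [x, ρ]
        rw [← Real.rpow_natCast, ← Real.rpow_natCast, ← Real.rpow_natCast,
          ← Real.rpow_mul (by norm_num), ← Real.rpow_add (by norm_num),
          ← Real.rpow_add (by norm_num), hsub j hj]
        congr 1
        ring
      calc (⌈x j⌉₊ : ℝ) * (1 * 2 ^ (j + 1) + 2) ≤ 2 * x j * (4 * 2 ^ j) := by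
            gcongr
            exact hceil j
        _ = 8 * (x j * 2 ^ j) := by ring
        _ = 8 * 2 ^ J * ρ ^ (J - j) := by rw [heq]; ring
    have hJ2 : (J : ℝ) + 2 ≤ 2 * 2 ^ J := by
      have h1 : J + 1 ≤ 2 ^ J := Nat.lt_two_pow_self
      have h2 : (J : ℝ) + 1 ≤ 2 ^ J := by exact_mod_cast h1
      have h3 : (1 : ℝ) ≤ 2 ^ J := one_le_pow₀ (by norm_num)
      linarith
    have : ((J : ℝ) + 2) * 2 ^ 1 + ∑ j ∈ Finset.range J, (⌈x j⌉₊ : ℝ) * (1 * 2 ^ (j + 1) + 2) ≤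
        A * 2 ^ J := by
      calc _ ≤ 2 * 2 ^ J * 2 ^ 1 + 8 * 2 ^ J * (1 - ρ)⁻¹ := by gcongr
        _ = (4 + 8 * (1 - ρ)⁻¹) * 2 ^ J := by ring
        _ ≤ _ := by gcongr
    exact_mod_cast this
  refine (h 1 J J n (fun j => ⌈x j⌉₊) le_rfl
    (fun j => Nat.one_le_ceil_iff.2 (zero_lt_one.trans_le (hx1 j))) hbits).trans ?_
  have hpow : ∀ k : ℕ, ((1 : ℕ) * 2 ^ k : ℝ) ^ (-β) = 2 ^ (-(k * β)) := fun k => by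
    rw [Nat.cast_one, one_mul, ← Real.rpow_natCast, ← Real.rpow_mul (by norm_num), mul_neg]
  have hsum : ∑ j ∈ Finset.range J, ((1 : ℕ) * 2 ^ j : ℝ) ^ (-β) * (⌈x j⌉₊ : ℝ) ^ (-θ) ≤
      2 ^ (-(J * β)) * (1 - τ)⁻¹ := by
    refine le_trans ?_ (mul_le_mul_of_nonneg_left (sum_range_pow_sub_le hτ0.le hτ1 J)
      (by positivity))
    rw [Finset.mul_sum]
    refine Finset.sum_le_sum fun j hj => ?_
    calc ((1 : ℕ) * 2 ^ j : ℝ) ^ (-β) * (⌈x j⌉₊ : ℝ) ^ (-θ)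
        ≤ 2 ^ (-(j * β)) * x j ^ (-θ) := by
          rw [hpow]
          refine mul_le_mul_of_nonneg_left (Real.rpow_le_rpow_of_nonpos
            (zero_lt_one.trans_le (hx1 j)) (Nat.le_ceil _) (by linarith)) (by positivity)
      _ = 2 ^ (-(J * β)) * τ ^ (J - j) := by
          simp only [x, τ]
          rw [← Real.rpow_natCast, ← Real.rpow_mul (by norm_num), ← Real.rpow_mul (by norm_num),
            ← Real.rpow_add (by norm_num), ← Real.rpow_add (by norm_num), hsub j hj]
          congr 1
          linear_combination (J - j : ℝ) * hδθ
  have hlow : (2 : ℝ) ^ 1 / 2 ^ J ≤ 2 * 2 ^ (-(J * β)) := by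
    rw [pow_one, div_eq_mul_inv, ← Real.rpow_natCast, ← Real.rpow_neg (by norm_num)]
    gcongr
    · norm_num
    · exact mul_le_of_le_one_right (by positivity) (by linarith)
  have hn0 : (0 : ℝ) < n := by
    have : 0 < n := by omega
    exact_mod_cast this
  have hconv : (2 : ℝ) ^ (-(J * β)) ≤ (2 * A) ^ β * (n : ℝ) ^ (-β) := by
    have hle : (n : ℝ) ≤ 2 * A * 2 ^ J := by
      have : (n : ℝ) ≤ A * 2 ^ (J + 1) := by exact_mod_cast hnJ
      rw [pow_succ] at this
      linarith
    have := Real.rpow_le_rpow_of_nonpos hn0 hle (by linarith : -β ≤ 0)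
    rw [Real.mul_rpow (by positivity) (by positivity), ← Real.rpow_natCast (2 : ℝ) J,
      ← Real.rpow_mul (by norm_num), mul_neg] at this
    calc (2 : ℝ) ^ (-(J * β)) = (2 * A) ^ β * ((2 * A) ^ (-β) * 2 ^ (-(J * β))) := by
          rw [← mul_assoc, ← Real.rpow_add (by positivity), add_neg_cancel, Real.rpow_zero, one_mul]
      _ ≤ _ := by gcongr
  rw [hpow]
  calc C * ((2 : ℝ) ^ 1 / 2 ^ J + ∑ j ∈ Finset.range J,
        ((1 : ℕ) * 2 ^ j : ℝ) ^ (-β) * (⌈x j⌉₊ : ℝ) ^ (-θ) + 2 ^ (-(J * β)))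
      ≤ C * (2 * 2 ^ (-(J * β)) + 2 ^ (-(J * β)) * (1 - τ)⁻¹ + 2 ^ (-(J * β))) := by gcongr
    _ = C * (3 + (1 - τ)⁻¹) * 2 ^ (-(J * β)) := by ring
    _ ≤ C * (3 + (1 - τ)⁻¹) * ((2 * A) ^ β * (n : ℝ) ^ (-β)) := by gcongr
    _ = _ := by ring

lemma HasBlockBound.exists_le_rpow_mul_log {e : ℕ → ℝ} {C β θ : ℝ} (h : HasBlockBound e C β θ)
    (hC : 0 < C) (hθ0 : 0 < θ) (hβθ : θ < β) :
    ∃ C' > 0, ∃ N : ℕ, ∀ n ≥ N, e n ≤ C' * (n : ℝ) ^ (-θ) * Real.log n ^ (θ - β) := by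
  have hβ : 0 < β := hθ0.trans hβθ
  set δ := (β - θ) / (2 * θ)
  have hδ : 0 < δ := div_pos (by linarith) (by positivity)
  have hδθ : δ * θ = (β - θ) / 2 := by simp only [δ]; field_simp
  set ρ : ℝ := 2 ^ (-δ)
  have hρ0 : 0 < ρ := by positivity
  have hρ1 : ρ < 1 := Real.rpow_lt_one_of_one_lt_of_neg (by norm_num) (by linarith)
  set τ : ℝ := 2 ^ (-((β - θ) / 2))
  have hτ0 : 0 < τ := by positivity
  have hτ1 : τ < 1 := Real.rpow_lt_one_of_one_lt_of_neg (by norm_num) (by linarith)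
  have hρi : 0 < (1 - ρ)⁻¹ := inv_pos.2 (by linarith)
  have hτi : 0 < (1 - τ)⁻¹ := inv_pos.2 (by linarith)
  set d : ℕ := ⌈2 * β⌉₊
  have hd : 2 * β ≤ d := Nat.le_ceil _
  set A : ℕ := ⌈(d + 3 : ℝ) + 4 * (1 - ρ)⁻¹ + 4⌉₊
  have hA : (d + 3 : ℝ) + 4 * (1 - ρ)⁻¹ + 4 ≤ A := Nat.le_ceil _
  have hA1 : 1 ≤ A := by
    have : (1 : ℝ) ≤ A := by
      have : (0 : ℝ) ≤ d := by positivity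
      linarith
    exact_mod_cast this
  have hA0 : (0 : ℝ) < A := by exact_mod_cast hA1
  set κ : ℝ := Real.log A + 2 * Real.log 4
  have hκ : 0 < κ := by
    have := Real.log_nonneg (by exact_mod_cast hA1 : (1 : ℝ) ≤ A)
    have := Real.log_pos (by norm_num : (1 : ℝ) < 4)
    positivity
  refine ⟨C * (1 + (1 - τ)⁻¹ + 2 ^ β) * ((4 * A) ^ θ * κ ^ (β - θ)), by positivity,
    A * 4 + 1, fun n hn => ?_⟩
  obtain ⟨L, hL, hLn, hnL⟩ := exists_mul_pow_le_of_le hA1 (by norm_num) hn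
  have hL1 : (1 : ℝ) ≤ L := by exact_mod_cast hL
  have hL0 : (0 : ℝ) < L := by linarith
  have hL4 : L ≤ 4 ^ L := (Nat.lt_pow_self (by norm_num)).le
  have hL4' : (L : ℝ) ≤ 4 ^ L := by exact_mod_cast hL4
  set J : ℕ := Nat.log 2 (4 ^ L / L)
  have hJle : (L : ℝ) * 2 ^ J ≤ 4 ^ L := by
    have := Nat.pow_log_le_self 2 (x := 4 ^ L / L) (Nat.div_pos hL4 hL).ne'
    rw [Nat.le_div_iff_mul_le hL, mul_comm] at this
    exact_mod_cast this
  have hJlt : (4 : ℝ) ^ L / 2 ≤ L * 2 ^ J := by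
    have := Nat.lt_pow_succ_log_self (b := 2) (by norm_num) (4 ^ L / L)
    rw [Nat.div_lt_iff_lt_mul hL, mul_comm, pow_succ] at this
    have : (4 : ℝ) ^ L < L * (2 ^ J * 2) := by exact_mod_cast this
    linarith
  set x : ℕ → ℝ := fun j => 4 ^ L / L * 2 ^ (-(j * (1 + δ)))
  have hx0 : ∀ j, 0 < x j := fun j => by positivity
  have hbits : (L * (d + 1) + 2) * 2 ^ L +
      ∑ j ∈ Finset.range J, ⌈x j⌉₊ * (L * 2 ^ (j + 1) + 2) ≤ n - 1 := by
    refine le_trans ?_ hLn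
    have hsum : ∑ j ∈ Finset.range J, (⌈x j⌉₊ : ℝ) * (L * 2 ^ (j + 1) + 2) ≤
        4 * 4 ^ L * (1 - ρ)⁻¹ + 4 * 4 ^ L := by
      have hgeom : ∑ j ∈ Finset.range J, (2 : ℝ) ^ j ≤ 2 ^ J := by
        rw [geom_sum_eq (by norm_num)]
        linarith
      calc ∑ j ∈ Finset.range J, (⌈x j⌉₊ : ℝ) * (L * 2 ^ (j + 1) + 2)
          ≤ ∑ j ∈ Finset.range J, (4 * 4 ^ L * ρ ^ j + 4 * L * 2 ^ j) := by
            refine Finset.sum_le_sum fun j _ => ?_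
            have h2 : (L : ℝ) * 2 ^ (j + 1) + 2 ≤ 4 * L * 2 ^ j := by
              have : (1 : ℝ) ≤ L * 2 ^ j :=
                one_le_mul_of_one_le_of_one_le hL1 (one_le_pow₀ (by norm_num))
              rw [pow_succ]
              linarith
            have heq : x j * (L * 2 ^ j) = 4 ^ L * ρ ^ j := by
              have : (2 : ℝ) ^ (-(j * (1 + δ))) * 2 ^ j = ρ ^ j := by
                simp only [ρ]
                rw [← Real.rpow_natCast, ← Real.rpow_natCast, ← Real.rpow_mul (by norm_num),
                  ← Real.rpow_add (by norm_num)]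
                congr 1
                ring
              rw [← this]
              simp only [x]
              field_simp
            calc (⌈x j⌉₊ : ℝ) * (L * 2 ^ (j + 1) + 2) ≤ (x j + 1) * (4 * L * 2 ^ j) := by
                  gcongr
                  exact (Nat.ceil_lt_add_one (hx0 j).le).le
              _ = 4 * (x j * (L * 2 ^ j)) + 4 * L * 2 ^ j := by ring
              _ = _ := by rw [heq]; ring
        _ = 4 * 4 ^ L * ∑ j ∈ Finset.range J, ρ ^ j +
            4 * L * ∑ j ∈ Finset.range J, (2 : ℝ) ^ j := by
            rw [Finset.sum_add_distrib, Finset.mul_sum, Finset.mul_sum]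
        _ ≤ 4 * 4 ^ L * (1 - ρ)⁻¹ + 4 * L * 2 ^ J := by
            gcongr
            exact sum_range_pow_le hρ0.le hρ1 J
        _ ≤ _ := by linarith
    have hlow : ((L : ℝ) * (d + 1) + 2) * 2 ^ L ≤ (d + 3) * 4 ^ L := by
      have h1 : (L : ℝ) ≤ 2 ^ L := by exact_mod_cast Nat.lt_two_pow_self.le
      have h3 : (1 : ℝ) ≤ 2 ^ L := one_le_pow₀ (by norm_num)
      have h4 : (4 : ℝ) ^ L = 2 ^ L * 2 ^ L := by rw [← mul_pow]; norm_num
      have h5 : (L : ℝ) * (d + 1) ≤ 2 ^ L * (d + 1) := by gcongr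
      rw [h4, ← mul_assoc]
      gcongr
      linarith
    have : ((L : ℝ) * (d + 1) + 2) * 2 ^ L +
        ∑ j ∈ Finset.range J, (⌈x j⌉₊ : ℝ) * (L * 2 ^ (j + 1) + 2) ≤ A * 4 ^ L := by
      calc _ ≤ (d + 3) * 4 ^ L + (4 * 4 ^ L * (1 - ρ)⁻¹ + 4 * 4 ^ L) := add_le_add hlow hsum
        _ = ((d + 3 : ℝ) + 4 * (1 - ρ)⁻¹ + 4) * 4 ^ L := by ring
        _ ≤ _ := by gcongr
    exact_mod_cast this
  refine (h L J (L * (d + 1)) n (fun j => ⌈x j⌉₊) hL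
    (fun j => Nat.one_le_ceil_iff.2 (hx0 j)) hbits).trans ?_
  set W : ℝ := (4 ^ L) ^ (-θ) * (L : ℝ) ^ (θ - β)
  have hW0 : 0 < W := by positivity
  have hβW : ((4 : ℝ) ^ L) ^ (-β) ≤ W := by
    have : -β = -θ + (θ - β) := by ring
    rw [this, Real.rpow_add (by positivity)]
    exact mul_le_mul_of_nonneg_left
      (Real.rpow_le_rpow_of_nonpos hL0 hL4' (by linarith)) (by positivity)
  have hsum : ∑ j ∈ Finset.range J, (L * 2 ^ j : ℝ) ^ (-β) * (⌈x j⌉₊ : ℝ) ^ (-θ) ≤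
      W * (1 - τ)⁻¹ := by
    refine le_trans ?_ (mul_le_mul_of_nonneg_left (sum_range_pow_le hτ0.le hτ1 J) hW0.le)
    rw [Finset.mul_sum]
    refine Finset.sum_le_sum fun j _ => ?_
    calc (L * 2 ^ j : ℝ) ^ (-β) * (⌈x j⌉₊ : ℝ) ^ (-θ) ≤ (L * 2 ^ j : ℝ) ^ (-β) * x j ^ (-θ) :=
          mul_le_mul_of_nonneg_left (Real.rpow_le_rpow_of_nonpos (hx0 j) (Nat.le_ceil _)
            (by linarith)) (by positivity)
      _ = W * τ ^ j := by
          have h1 : ((2 : ℝ) ^ j) ^ (-β) * (2 ^ (-(j * (1 + δ)))) ^ (-θ) = τ ^ j := by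
            simp only [τ]
            rw [← Real.rpow_natCast, ← Real.rpow_natCast, ← Real.rpow_mul (by norm_num),
              ← Real.rpow_mul (by norm_num), ← Real.rpow_mul (by norm_num),
              ← Real.rpow_add (by norm_num)]
            congr 1
            linear_combination (j : ℝ) * hδθ
          have h2 : (L : ℝ) ^ (-β) * (4 ^ L / L : ℝ) ^ (-θ) = W := by
            simp only [W]
            rw [Real.div_rpow (by positivity) hL0.le, Real.rpow_neg hL0.le θ,
              sub_eq_add_neg, Real.rpow_add hL0]
            field_simp
          simp only [x]
          rw [Real.mul_rpow hL0.le (by positivity), Real.mul_rpow (by positivity) (by positivity),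
            ← h1, ← h2]
          ring
  have hlow : (2 : ℝ) ^ L / 2 ^ (L * (d + 1)) ≤ W := by
    refine le_trans ?_ hβW
    have h4 : (4 : ℝ) ^ L = 2 ^ (2 * L : ℝ) := by
      rw [Real.rpow_mul (by norm_num), Real.rpow_natCast]
      norm_num
    rw [h4, ← Real.rpow_natCast, ← Real.rpow_natCast, ← Real.rpow_sub (by norm_num),
      ← Real.rpow_mul (by norm_num)]
    refine Real.rpow_le_rpow_of_exponent_le (by norm_num) ?_
    push_cast
    nlinarith
  have htail : (L * 2 ^ J : ℝ) ^ (-β) ≤ W * 2 ^ β := by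
    refine (Real.rpow_le_rpow_of_nonpos (by positivity) hJlt (by linarith)).trans ?_
    rw [Real.div_rpow (by positivity) (by norm_num), Real.rpow_neg (by norm_num : (0 : ℝ) ≤ 2),
      div_inv_eq_mul]
    gcongr
  have hn1 : 1 < n := by omega
  have hn0 : (0 : ℝ) < n := by exact_mod_cast zero_lt_one.trans hn1
  have hlogn : 0 < Real.log n := Real.log_pos (by exact_mod_cast hn1)
  have hnL' : (n : ℝ) ≤ A * 4 ^ (L + 1) := by exact_mod_cast hnL
  have hconv : W ≤ (4 * A) ^ θ * κ ^ (β - θ) * ((n : ℝ) ^ (-θ) * Real.log n ^ (θ - β)) := by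
    have h1 : ((4 : ℝ) ^ L) ^ (-θ) ≤ (4 * A) ^ θ * (n : ℝ) ^ (-θ) := by
      have hle : (n : ℝ) / (4 * A) ≤ 4 ^ L := by
        rw [div_le_iff₀ (by positivity)]
        rw [pow_succ] at hnL'
        linarith
      refine (Real.rpow_le_rpow_of_nonpos (by positivity) hle (by linarith)).trans_eq ?_
      rw [Real.div_rpow hn0.le (by positivity), Real.rpow_neg (by positivity : 0 ≤ 4 * (A : ℝ)),
        div_inv_eq_mul, mul_comm]
    have h2 : (L : ℝ) ^ (θ - β) ≤ κ ^ (β - θ) * Real.log n ^ (θ - β) := by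
      have hle : Real.log n / κ ≤ L := by
        rw [div_le_iff₀ hκ]
        have := Real.log_le_log hn0 hnL'
        rw [Real.log_mul hA0.ne' (by positivity), Real.log_pow] at this
        push_cast at this
        have h3 := Real.log_nonneg (by exact_mod_cast hA1 : (1 : ℝ) ≤ A)
        have h4 := Real.log_pos (by norm_num : (1 : ℝ) < 4)
        simp only [κ]
        nlinarith
      refine (Real.rpow_le_rpow_of_nonpos (by positivity) hle (by linarith)).trans_eq ?_
      have : θ - β = -(β - θ) := by ring
      rw [Real.div_rpow hlogn.le hκ.le, this, Real.rpow_neg hκ.le, div_inv_eq_mul, mul_comm]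
    calc W ≤ ((4 * A) ^ θ * (n : ℝ) ^ (-θ)) * (κ ^ (β - θ) * Real.log n ^ (θ - β)) := by
          simp only [W]
          gcongr
      _ = _ := by ring
  calc C * ((2 : ℝ) ^ L / 2 ^ (L * (d + 1)) + ∑ j ∈ Finset.range J,
        (L * 2 ^ j : ℝ) ^ (-β) * (⌈x j⌉₊ : ℝ) ^ (-θ) + (L * 2 ^ J : ℝ) ^ (-β))
      ≤ C * (W + W * (1 - τ)⁻¹ + W * 2 ^ β) := by gcongr
    _ = C * (1 + (1 - τ)⁻¹ + 2 ^ β) * W := by ring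
    _ ≤ C * (1 + (1 - τ)⁻¹ + 2 ^ β) *
        ((4 * A) ^ θ * κ ^ (β - θ) * ((n : ℝ) ^ (-θ) * Real.log n ^ (θ - β))) := by gcongr
    _ = _ := by ring

/-- An eventual bound on a bounded sequence by a positive one holds from the start, up to a
change of the constant. -/
lemma exists_forall_le_of_eventually_le {e f : ℕ → ℝ} {b C : ℝ} {k N : ℕ} (hb : 0 < b)
    (hC : 0 < C) (he : ∀ n, e n ≤ b) (hf : ∀ n, k ≤ n → 0 < f n)
    (h : ∀ n ≥ N, e n ≤ C * f n) : ∃ C' > 0, ∀ n, k ≤ n → e n ≤ C' * f n := by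
  have hpos : ∀ i ∈ Finset.Ico k N, 0 < b / f i := fun i hi =>
    div_pos hb (hf i (Finset.mem_Ico.1 hi).1)
  have hS : 0 ≤ ∑ i ∈ Finset.Ico k N, b / f i := Finset.sum_nonneg fun i hi => (hpos i hi).le
  refine ⟨C + ∑ i ∈ Finset.Ico k N, b / f i, by positivity, fun n hn => ?_⟩
  obtain hnN | hnN := lt_or_ge n N
  · refine (he n).trans ?_
    have hle := Finset.single_le_sum (fun i hi => (hpos i hi).le) (Finset.mem_Ico.2 ⟨hn, hnN⟩)
    rw [div_le_iff₀ (hf n hn)] at hle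
    nlinarith [hf n hn, mul_pos hC (hf n hn)]
  · refine (h n hnN).trans (mul_le_mul_of_nonneg_right ?_ (hf n hn).le)
    linarith

theorem stmt14 {T : Type} [Countable T] [PartialOrder T] [OrderBot T]
    (hbin : IsBinaryTree T) (q : ℝ) (hq : 1 < q)
    (α σ : T → ℝ) (hα : ∀ t, 0 < α t) (hσpos : ∀ t, 0 < σ t)
    (hσmono : ∀ ⦃t s : T⦄, t ≤ s → σ s ≤ σ t)
    (K : ℝ) (hK : ∀ s : T, (∑ᶠ r ∈ Set.Iic s, α r ^ q) ^ (1 / q) * σ s ≤ K)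
    [Fact (1 ≤ ENNReal.ofReal q)]
    (V : ellOne T →L[ℝ] ellQ T q)
    (hV : ∀ (x : ellOne T) (t : T), (V x : ∀ _ : T, ℝ) t =
      α t * ∑' s : {s : T // t ≤ s}, σ s.1 * (x : ∀ _ : T, ℝ) s.1)
    (c γ : ℝ) (hc : 0 < c) (hγ : 1 < γ)
    (hw : ∀ t : T, 1 ≤ gen t → α t * σ t ≤ c * (gen t : ℝ) ^ (-(γ / q)))
    (p p' q' : ℝ) (hp : p = min 2 q) (hp' : 1 / p' = 1 - 1 / p)
    (hq' : 1 / q' = 1 - 1 / q) (hγne : γ ≠ q / p' + 1) :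
    ∃ C > 0, ∀ n : ℕ, 2 ≤ n →
      (q ≤ 2 →
        (q < γ →
          entropyNumber n V ≤ C * (n : ℝ) ^ (-(1 / q')) * Real.log n ^ (1 - γ / q)) ∧
        (γ < q → entropyNumber n V ≤ C * (n : ℝ) ^ (-((γ - 1) / q)))) ∧
      (2 ≤ q →
        (q / 2 + 1 < γ →
          entropyNumber n V ≤
            C * (n : ℝ) ^ (-(1 / 2 : ℝ)) * Real.log n ^ (1 / 2 - (γ - 1) / q)) ∧
        (γ < q / 2 + 1 → entropyNumber n V ≤ C * (n : ℝ) ^ (-((γ - 1) / q)))) := by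
  have hq0 : 0 < q := by linarith
  obtain ⟨C, hC, hblock⟩ := exists_entropyNumber_le_block_sum hbin q hq α σ hα hσpos hσmono V hV
    c γ hc hγ hw
  set β := (γ - 1) / q with hβdef
  set θ : ℝ := 1 - max (1 / 2) (1 / q) with hθdef
  have hβ : 0 < β := div_pos (by linarith) hq0
  have hη1 : max (1 / 2) (1 / q) < 1 := max_lt (by norm_num) (by rwa [div_lt_one hq0])
  have hθ0 : 0 < θ := by linarith
  have hθ1 : θ ≤ 1 := by
    have := le_max_left (1 / 2 : ℝ) (1 / q)
    linarith
  have hbound : HasBlockBound (fun n => entropyNumber n V) C β θ := hblock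
  have hbdd : 0 < ‖V‖ + 1 := by positivity
  have hpow : ∀ n : ℕ, 2 ≤ n → 0 < (n : ℝ) ^ (-β) := fun n hn => by
    have : (0 : ℝ) < n := by exact_mod_cast (by omega : 0 < n)
    positivity
  have hpowlog : ∀ n : ℕ, 2 ≤ n → 0 < (n : ℝ) ^ (-θ) * Real.log n ^ (θ - β) := fun n hn => by
    have : (0 : ℝ) < n := by exact_mod_cast (by omega : 0 < n)
    have : 0 < Real.log n := Real.log_pos (by exact_mod_cast (by omega : 1 < n))
    positivity
  have hgap : ∃ C > 0, ∀ n : ℕ, 2 ≤ n →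
      (θ < β → entropyNumber n V ≤ C * ((n : ℝ) ^ (-θ) * Real.log n ^ (θ - β))) ∧
      (β < θ → entropyNumber n V ≤ C * (n : ℝ) ^ (-β)) := by
    obtain hlt | heq | hlt := lt_trichotomy β θ
    · obtain ⟨C', hC', N, hN⟩ := hbound.exists_le_rpow hC hβ hlt hθ1
      obtain ⟨D, hD, hle⟩ := exists_forall_le_of_eventually_le hbdd hC'
        (fun n => entropyNumber_le_norm_add_one n V) hpow hN
      exact ⟨D, hD, fun n hn => ⟨fun h => (lt_asymm h hlt).elim, fun _ => hle n hn⟩⟩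
    · exact ⟨1, one_pos, fun n _ => ⟨fun h => (h.ne' heq).elim, fun h => (h.ne heq).elim⟩⟩
    · obtain ⟨C', hC', N, hN⟩ := hbound.exists_le_rpow_mul_log hC hθ0 hlt
      simp only [mul_assoc] at hN
      obtain ⟨D, hD, hle⟩ := exists_forall_le_of_eventually_le hbdd hC'
        (fun n => entropyNumber_le_norm_add_one n V) hpowlog hN
      exact ⟨D, hD, fun n hn => ⟨fun _ => hle n hn, fun h => (lt_asymm h hlt).elim⟩⟩
  obtain ⟨D, hD, hle⟩ := hgap
  refine ⟨D, hD, fun n hn => ⟨fun hq2 => ?_, fun hq2 => ?_⟩⟩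
  · have hθ : θ = 1 - 1 / q := by
      rw [hθdef, max_eq_right (one_div_le_one_div_of_le hq0 hq2)]
    have hθβ : θ - β = 1 - γ / q := by
      rw [hθ, hβdef]
      ring
    rw [hq', ← hθ, ← hθβ, mul_assoc]
    refine ⟨fun h => (hle n hn).1 (sub_neg.1 ?_), fun h => (hle n hn).2 (sub_pos.1 ?_)⟩
    · rw [hθβ, sub_neg, one_lt_div hq0]
      exact h
    · rw [hθβ, sub_pos, div_lt_one hq0]
      exact h
  · have hθ : θ = 1 / 2 := by
      rw [hθdef, max_eq_left (one_div_le_one_div_of_le (by norm_num) hq2)]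
      norm_num
    rw [← hθ, mul_assoc]
    refine ⟨fun h => (hle n hn).1 ?_, fun h => (hle n hn).2 ?_⟩
    · rw [hθ, hβdef, lt_div_iff₀ hq0]
      linarith
    · rw [hθ, hβdef, div_lt_iff₀ hq0]
      linarith
end
end

section
/- Let T be the binary tree and suppose α(t)σ(t) ≤ c 2^{-(γ/q)|t|} for all t ∈ T, for some γ > 0 and c > 0. Then there are constants C, C' > 0 such that Ñ(T,d,ε) ≤ C ε^{-q/γ} for all sufficiently small ε > 0, and consequently e_n(V_{α,σ} : ℓ_1(T) → ℓ_q(T)) ≤ C' n^{-γ/q − 1/p'} for all n ≥ 1, where p = min{2,q} and 1/p' = 1 − 1/p. -/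
open scoped ENNReal NNReal
open MeasureTheory

noncomputable section

section Tree

variable {T : Type} [PartialOrder T] [OrderBot T]

lemma gen_lt_gen (h : IsTree T) {a b : T} (hab : a < b) : gen a < gen b :=
  Set.ncard_lt_ncard (Set.Iio_ssubset_Iio hab) ((h.1 b).subset Set.Iio_subset_Iic_self)

lemma eq_of_gen_eq (h : IsTree T) {a b s : T} (ha : a ≤ s) (hb : b ≤ s)
    (hab : gen a = gen b) : a = b := by
  rcases h.2.1 s a b ha hb with h1 | h1
  · by_contra hne
    exact (gen_lt_gen h (lt_of_le_of_ne h1 hne)).ne hab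
  · by_contra hne
    exact (gen_lt_gen h (lt_of_le_of_ne h1 (Ne.symm hne))).ne hab.symm

lemma exists_parent (h : IsTree T) {t : T} (ht : t ≠ ⊥) :
    ∃ u, u ⋖ t ∧ gen t = gen u + 1 := by
  have hfin : (Set.Iio t).Finite := (h.1 t).subset Set.Iio_subset_Iic_self
  obtain ⟨u, hu⟩ := hfin.exists_maximal ⟨⊥, bot_lt_iff_ne_bot.2 ht⟩
  have hut : u < t := hu.1
  have hmax : ∀ v, v < t → v ≤ u := fun v hv =>
    (h.2.1 t u v hut.le hv.le).elim (fun huv => hu.2 hv huv) id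
  refine ⟨u, ⟨hut, fun v huv hvt => (hmax v hvt).not_gt huv⟩, ?_⟩
  have hset : Set.Iio t = insert u (Set.Iio u) := by
    rw [Set.Iio_insert]
    ext v
    exact ⟨hmax v, fun hv => lt_of_le_of_lt hv hut⟩
  have hfu : (Set.Iio u).Finite := (h.1 u).subset Set.Iio_subset_Iic_self
  change (Set.Iio t).ncard = (Set.Iio u).ncard + 1
  rw [hset, Set.ncard_insert_of_notMem (by simp) hfu]

lemma gen_bot : gen (⊥ : T) = 0 := by simp [gen]

lemma exists_ancestor_gen_eq (h : IsTree T) (m : ℕ) (t : T) (hm : m ≤ gen t) :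
    ∃ s ≤ t, gen s = m := by
  induction hn : gen t generalizing t with
  | zero => exact ⟨t, le_rfl, by omega⟩
  | succ n ih =>
    rcases Nat.lt_or_ge n m with hlt | hle
    · exact ⟨t, le_rfl, by omega⟩
    · have ht : t ≠ ⊥ := by
        rintro rfl
        rw [gen_bot] at hn
        omega
      obtain ⟨u, hu, hg⟩ := exists_parent h ht
      obtain ⟨s, hs, hsm⟩ := ih u (by omega) (by omega)
      exact ⟨s, hs.trans hu.le, hsm⟩

/-- The `m`-th generation of a binary tree has at most `2 ^ m` nodes. -/
lemma exists_level (hbin : IsBinaryTree T) (m : ℕ) :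
    ∃ L : Finset T, (∀ t, t ∈ L ↔ gen t = m) ∧ L.card ≤ 2 ^ m := by
  classical
  suffices H : ∃ L : Finset T, (∀ t, gen t = m → t ∈ L) ∧ L.card ≤ 2 ^ m by
    obtain ⟨L, hL, hc⟩ := H
    refine ⟨L.filter (gen · = m), fun t => ?_, (Finset.card_filter_le _ _).trans hc⟩
    rw [Finset.mem_filter]
    exact ⟨And.right, fun ht => ⟨hL t ht, ht⟩⟩
  induction m with
  | zero =>
    refine ⟨{⊥}, fun t ht => ?_, by simp⟩
    by_contra hne
    obtain ⟨u, -, hu⟩ := exists_parent hbin.1 (t := t) (by simpa using hne)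
    omega
  | succ m ih =>
    obtain ⟨L, hL, hc⟩ := ih
    refine ⟨L.biUnion fun u => (hbin.1.2.2 u).toFinset, fun t ht => ?_, ?_⟩
    · have hne : t ≠ ⊥ := by
        rintro rfl
        rw [gen_bot] at ht
        omega
      obtain ⟨u, hu, hg⟩ := exists_parent hbin.1 hne
      simp only [Finset.mem_biUnion, Set.Finite.mem_toFinset]
      exact ⟨u, hL u (by omega), hu⟩
    · have h2 : ∀ u ∈ L, ((hbin.1.2.2 u).toFinset).card ≤ 2 := fun u _ => by
        rw [← Set.ncard_eq_toFinset_card _ (hbin.1.2.2 u)]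
        exact (hbin.2 u).le
      calc _ ≤ L.card * 2 := Finset.card_biUnion_le_card_mul _ _ _ h2
        _ ≤ 2 ^ (m + 1) := by rw [pow_succ]; omega

/-- There are at most `2 ^ (m + 1)` nodes of generation at most `m`. -/
lemma exists_finset_gen_le (hbin : IsBinaryTree T) (m : ℕ) :
    ∃ S : Finset T, (∀ t, t ∈ S ↔ gen t ≤ m) ∧ S.card ≤ 2 ^ (m + 1) := by
  classical
  choose L hL hc using exists_level hbin
  refine ⟨(Finset.range (m + 1)).biUnion L, fun t => ?_, ?_⟩
  · simp [hL]
  · calc _ ≤ ∑ j ∈ Finset.range (m + 1), (L j).card := Finset.card_biUnion_le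
      _ ≤ ∑ j ∈ Finset.range (m + 1), 2 ^ j := Finset.sum_le_sum fun j _ => hc j
      _ ≤ 2 ^ (m + 1) := by
        rw [Nat.geomSum_eq le_rfl]
        simp

end Tree
section Net

variable {T : Type} [PartialOrder T] [OrderBot T]

lemma sum_two_rpow_le {γ : ℝ} (hγ : 0 < γ) (m : ℕ) (J : Finset ℕ) (hJ : ∀ j ∈ J, m ≤ j) :
    ∑ j ∈ J, (2 : ℝ) ^ (-γ * (j : ℝ)) ≤ (1 - (2 : ℝ) ^ (-γ))⁻¹ * (2 : ℝ) ^ (-γ * (m : ℝ)) := by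
  have h0 : (0 : ℝ) < 2 ^ (-γ) := by positivity
  have h1 : (2 : ℝ) ^ (-γ) < 1 := Real.rpow_lt_one_of_one_lt_of_neg one_lt_two (by linarith)
  have hsum := summable_geometric_of_lt_one h0.le h1
  have hinj : Set.InjOn (fun j => j - m) (J : Set ℕ) := fun a ha b hb hab => by
    have := hJ a ha
    have := hJ b hb
    simp only at hab
    omega
  calc ∑ j ∈ J, (2 : ℝ) ^ (-γ * (j : ℝ))
      = ∑ j ∈ J, (2 : ℝ) ^ (-γ * (m : ℝ)) * ((2 : ℝ) ^ (-γ)) ^ (j - m) := by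
        refine Finset.sum_congr rfl fun j hj => ?_
        rw [← Real.rpow_natCast, ← Real.rpow_mul zero_le_two, ← Real.rpow_add two_pos,
          Nat.cast_sub (hJ j hj)]
        ring_nf
    _ = (2 : ℝ) ^ (-γ * (m : ℝ)) * ∑ j ∈ J.image (fun j => j - m), ((2 : ℝ) ^ (-γ)) ^ j := by
        rw [Finset.sum_image hinj, Finset.mul_sum]
    _ ≤ (2 : ℝ) ^ (-γ * (m : ℝ)) * (1 - (2 : ℝ) ^ (-γ))⁻¹ := by
        rw [← tsum_geometric_of_lt_one h0.le h1]
        gcongr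
        exact hsum.sum_le_tsum _ fun _ _ => by positivity
    _ = _ := mul_comm _ _

lemma dOrd_le (h : IsTree T) {q : ℝ} (hq : 1 < q) {α σ : T → ℝ} (hα : ∀ t, 0 < α t)
    (hσpos : ∀ t, 0 < σ t) (hσmono : ∀ ⦃t s : T⦄, t ≤ s → σ s ≤ σ t)
    {c γ : ℝ} (hc : 0 < c) (hγ : 0 < γ)
    (hw : ∀ t : T, α t * σ t ≤ c * (2 : ℝ) ^ (-(γ / q) * (gen t : ℝ))) (t s : T) :
    dOrd q α σ t s ≤
      c * ((1 - (2 : ℝ) ^ (-γ))⁻¹) ^ (1 / q) * (2 : ℝ) ^ (-(γ / q) * (gen t : ℝ)) := by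
  have hq0 : 0 < q := by linarith
  have h1 : (2 : ℝ) ^ (-γ) < 1 := Real.rpow_lt_one_of_one_lt_of_neg one_lt_two (by linarith)
  have h1' : 0 < (1 - (2 : ℝ) ^ (-γ))⁻¹ := inv_pos.2 (by linarith)
  refine Real.sSup_le ?_ (by positivity)
  rintro _ ⟨v, -, rfl⟩
  have hfin : (Set.Ioc t v).Finite := (h.1 v).subset Set.Ioc_subset_Iic_self
  simp only
  rw [finsum_mem_eq_finite_toFinset_sum _ hfin]
  set A := hfin.toFinset
  have hA : ∀ r ∈ A, t < r ∧ r ≤ v := fun r hr => by simpa [A] using hr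
  have hinj : Set.InjOn gen (A : Set T) := fun a ha b hb hab =>
    eq_of_gen_eq h (hA a ha).2 (hA b hb).2 hab
  have hsum : (∑ r ∈ A, α r ^ q) * σ v ^ q ≤
      c ^ q * ((1 - (2 : ℝ) ^ (-γ))⁻¹ * (2 : ℝ) ^ (-γ * (gen t : ℝ))) := by
    classical
    calc (∑ r ∈ A, α r ^ q) * σ v ^ q
        ≤ ∑ r ∈ A, c ^ q * (2 : ℝ) ^ (-γ * (gen r : ℝ)) := by
          rw [Finset.sum_mul]
          refine Finset.sum_le_sum fun r hr => ?_
          rw [← Real.mul_rpow (hα r).le (hσpos v).le]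
          calc (α r * σ v) ^ q ≤ (c * (2 : ℝ) ^ (-(γ / q) * (gen r : ℝ))) ^ q := by
                have := hα r
                have := hσpos v
                refine Real.rpow_le_rpow (by positivity) (le_trans ?_ (hw r)) hq0.le
                have := hσmono (hA r hr).2
                gcongr
            _ = _ := by
                rw [Real.mul_rpow hc.le (by positivity), ← Real.rpow_mul zero_le_two]
                congr 2
                field_simp
      _ = c ^ q * ∑ j ∈ A.image gen, (2 : ℝ) ^ (-γ * (j : ℝ)) := by
          rw [Finset.sum_image hinj, Finset.mul_sum]
      _ ≤ _ := by
          gcongr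
          refine sum_two_rpow_le hγ _ _ fun j hj => ?_
          obtain ⟨r, hr, rfl⟩ := Finset.mem_image.1 hj
          exact (gen_lt_gen h (hA r hr).1).le
  have hs0 : 0 ≤ ∑ r ∈ A, α r ^ q := Finset.sum_nonneg fun r _ => by
    have := hα r
    positivity
  calc (∑ r ∈ A, α r ^ q) ^ (1 / q) * σ v
      = ((∑ r ∈ A, α r ^ q) * σ v ^ q) ^ (1 / q) := by
        have := hσpos v
        rw [Real.mul_rpow hs0 (by positivity), ← Real.rpow_mul this.le,
          mul_one_div_cancel hq0.ne', Real.rpow_one]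
    _ ≤ (c ^ q * ((1 - (2 : ℝ) ^ (-γ))⁻¹ * (2 : ℝ) ^ (-γ * (gen t : ℝ)))) ^ (1 / q) := by
        have := hσpos v
        exact Real.rpow_le_rpow (by positivity) hsum (by positivity)
    _ = _ := by
        rw [Real.mul_rpow (by positivity) (by positivity), ← Real.rpow_mul hc.le,
          mul_one_div_cancel hq0.ne', Real.rpow_one, Real.mul_rpow h1'.le (by positivity),
          ← Real.rpow_mul zero_le_two, ← mul_assoc]
        congr 2
        field_simp

lemma exists_orderCoveringNumber_le (hbin : IsBinaryTree T) {q : ℝ} (hq : 1 < q)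
    {α σ : T → ℝ} (hα : ∀ t, 0 < α t)
    (hσpos : ∀ t, 0 < σ t) (hσmono : ∀ ⦃t s : T⦄, t ≤ s → σ s ≤ σ t) (glb : T → T → T)
    {c γ : ℝ} (hc : 0 < c) (hγ : 0 < γ)
    (hw : ∀ t : T, α t * σ t ≤ c * (2 : ℝ) ^ (-(γ / q) * (gen t : ℝ))) :
    ∃ C > 0, ∃ ε₀ > 0, ∀ ε : ℝ, 0 < ε → ε < ε₀ →
      orderCoveringNumber (treeDist q α σ glb) ε ≤ ENNReal.ofReal (C * ε ^ (-(q / γ))) := by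
  have hq0 : 0 < q := by linarith
  have h1 : (2 : ℝ) ^ (-γ) < 1 := Real.rpow_lt_one_of_one_lt_of_neg one_lt_two (by linarith)
  have h1' : 0 < (1 - (2 : ℝ) ^ (-γ))⁻¹ := inv_pos.2 (by linarith)
  have hd := dOrd_le hbin.1 hq hα hσpos hσmono hc hγ hw
  set D := c * ((1 - (2 : ℝ) ^ (-γ))⁻¹) ^ (1 / q)
  have hD : 0 < D := by positivity
  refine ⟨4 * D ^ (q / γ), by positivity, D, hD, fun ε hε hεD => ?_⟩
  have hDε : 1 < D / ε := (one_lt_div hε).2 hεD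
  set x := Real.logb 2 ((D / ε) ^ (q / γ))
  have hx2 : (2 : ℝ) ^ x = (D / ε) ^ (q / γ) :=
    Real.rpow_logb two_pos (by norm_num) (by positivity)
  have hx0 : 0 ≤ x := Real.logb_nonneg one_lt_two (Real.one_le_rpow hDε.le (by positivity))
  set m := ⌊x⌋₊ + 1 with hm
  have hxm : x < m := by
    rw [hm]
    push_cast
    exact Nat.lt_floor_add_one x
  have hmx : (m : ℝ) ≤ x + 1 := by
    rw [hm]
    push_cast
    linarith [Nat.floor_le hx0]
  have hnet : D * (2 : ℝ) ^ (-(γ / q) * (m : ℝ)) < ε := by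
    have : (2 : ℝ) ^ (-(γ / q) * (m : ℝ)) < 2 ^ (-(γ / q) * x) :=
      Real.rpow_lt_rpow_of_exponent_lt one_lt_two
        (mul_lt_mul_of_neg_left hxm (neg_neg_of_pos (by positivity)))
    calc D * (2 : ℝ) ^ (-(γ / q) * (m : ℝ)) < D * 2 ^ (-(γ / q) * x) := by gcongr
      _ = D * (D / ε)⁻¹ := by
        rw [mul_comm (-(γ / q)) x, Real.rpow_mul zero_le_two, hx2,
          ← Real.rpow_mul (by positivity), ← Real.rpow_neg_one (D / ε)]
        congr 2
        field_simp
      _ = ε := by field_simp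
  obtain ⟨S, hS, hcard⟩ := exists_finset_gen_le hbin m
  refine (iInf₂_le S ?_).trans ?_
  · intro t
    rcases le_total (gen t) m with hle | hle
    · exact ⟨t, (hS t).2 hle, le_rfl, by simpa [treeDist, dOrd] using hε⟩
    · obtain ⟨s, hst, hsm⟩ := exists_ancestor_gen_eq hbin.1 m t hle
      refine ⟨s, (hS s).2 hsm.le, hst, ?_⟩
      rw [treeDist, if_pos hst]
      refine (hd s t).trans_lt ?_
      rwa [hsm]
  · rw [← ENNReal.ofReal_natCast]
    refine ENNReal.ofReal_le_ofReal ?_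
    calc (S.card : ℝ) ≤ 2 ^ (m + 1) := by exact_mod_cast hcard
      _ = (2 : ℝ) ^ ((m : ℝ) + 1) := by
        rw [← Real.rpow_natCast]
        push_cast
        rfl
      _ ≤ (2 : ℝ) ^ (x + 2) := Real.rpow_le_rpow_of_exponent_le one_le_two (by linarith)
      _ = 4 * D ^ (q / γ) * ε ^ (-(q / γ)) := by
        rw [Real.rpow_add two_pos, hx2, Real.div_rpow hD.le hε.le, Real.rpow_neg hε.le,
          Real.rpow_two]
        ring

end Net
section Scale

lemma hasSum_pow_natAbs {r : ℝ} (h0 : 0 ≤ r) (h1 : r < 1) :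
    HasSum (fun j : ℤ => r ^ j.natAbs) ((1 + r) / (1 - r)) := by
  have hne : 1 - r ≠ 0 := by linarith
  have hg := hasSum_geometric_of_lt_one h0 h1
  have hneg : (fun n : ℕ => r ^ (-((n : ℤ) + 1)).natAbs) = fun n => r * r ^ n := by
    funext n
    rw [← pow_succ']
    congr 1
  have := HasSum.of_nat_of_neg_add_one (f := fun j : ℤ => r ^ j.natAbs) (by simpa using hg)
    (hneg ▸ hg.mul_left r)
  convert this using 1
  field_simp

lemma exists_sum_min_rpow_le {a : ℝ} (ha : 0 < a) :
    ∃ B > 0, ∀ X > 0, ∀ J : Finset ℕ,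
      ∑ m ∈ J, (min ((2 : ℝ) ^ m / X) ((2 : ℝ) ^ m / X)⁻¹) ^ a ≤ B := by
  have h0 : (0 : ℝ) < 2 ^ (-a) := by positivity
  have h1 : (2 : ℝ) ^ (-a) < 1 := Real.rpow_lt_one_of_one_lt_of_neg one_lt_two (by linarith)
  have hs := hasSum_pow_natAbs h0.le h1
  refine ⟨2 ^ a * ((1 + 2 ^ (-a)) / (1 - 2 ^ (-a))), ?_, fun X hX J => ?_⟩
  · have : 0 < 1 - (2 : ℝ) ^ (-a) := by linarith
    positivity
  obtain ⟨M, hM1, hM2⟩ := exists_mem_Ico_zpow hX (one_lt_two (α := ℝ))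
  have hterm : ∀ m : ℕ, (min ((2 : ℝ) ^ m / X) ((2 : ℝ) ^ m / X)⁻¹) ^ a ≤
      2 ^ a * ((2 : ℝ) ^ (-a)) ^ ((m : ℤ) - M).natAbs := by
    intro m
    have hmin : min ((2 : ℝ) ^ m / X) ((2 : ℝ) ^ m / X)⁻¹ ≤
        2 * (2 : ℝ) ^ (-(((m : ℤ) - M).natAbs : ℤ)) := by
      rcases le_total M m with hle | hle
      · refine (min_le_right _ _).trans ?_
        have : (((m : ℤ) - M).natAbs : ℤ) = m - M := by omega
        rw [this, inv_div, div_le_iff₀ (by positivity)]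
        refine hM2.le.trans (le_of_eq ?_)
        rw [mul_assoc, ← zpow_natCast (2 : ℝ) m, ← zpow_add₀ two_ne_zero, zpow_add_one₀ two_ne_zero,
          mul_comm]
        congr 2
        ring
      · refine (min_le_left _ _).trans ?_
        have : (((m : ℤ) - M).natAbs : ℤ) = M - m := by omega
        rw [this, div_le_iff₀ hX]
        calc (2 : ℝ) ^ m = 2 ^ (-(M - m)) * 2 ^ M := by
              rw [← zpow_natCast (2 : ℝ) m, ← zpow_add₀ two_ne_zero]
              congr 1
              ring
          _ ≤ 2 ^ (-(M - m)) * X := by gcongr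
          _ ≤ 2 * 2 ^ (-(M - m)) * X := by
              have : (0 : ℝ) < 2 ^ (-(M - m)) * X := by positivity
              linarith
    calc _ ≤ (2 * (2 : ℝ) ^ (-(((m : ℤ) - M).natAbs : ℤ))) ^ a :=
          Real.rpow_le_rpow (by positivity) hmin ha.le
      _ = _ := by
          rw [Real.mul_rpow zero_le_two (by positivity), ← Real.rpow_natCast, ← Real.rpow_intCast,
            ← Real.rpow_mul zero_le_two, ← Real.rpow_mul zero_le_two]
          rw [Int.cast_neg, Int.cast_natCast]
          ring_nf
  have hinj : Set.InjOn (fun m : ℕ => (m : ℤ) - M) (J : Set ℕ) := fun x _ y _ hxy => by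
    simp only at hxy
    omega
  calc _ ≤ ∑ m ∈ J, 2 ^ a * ((2 : ℝ) ^ (-a)) ^ ((m : ℤ) - M).natAbs :=
        Finset.sum_le_sum fun m _ => hterm m
    _ = 2 ^ a * ∑ j ∈ J.image (fun m : ℕ => (m : ℤ) - M), ((2 : ℝ) ^ (-a)) ^ j.natAbs := by
        rw [Finset.sum_image hinj, Finset.mul_sum]
    _ ≤ _ := by
        gcongr
        exact sum_le_hasSum _ (fun _ _ => by positivity) hs

/-- The number of quantization steps used on a generation with `N` nodes, at budget `X`. -/
def resolution (a X N : ℝ) : ℝ :=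
  X * if N ≤ X then (N / X) ^ (-(2 * a)) else (N / X) ^ (-(a / 2))

variable {a X N : ℝ}

lemma resolution_pos (hX : 0 < X) (hN : 0 < N) : 0 < resolution a X N := by
  unfold resolution
  split_ifs <;> positivity

lemma resolution_error_le {γ q : ℝ} (hγ : 0 < γ) (hq : 1 < q) (hX : 0 < X) (hN : 0 < N) :
    N ^ (-γ) * resolution (γ / (q - 1)) X N ^ (-(q - 1)) ≤
      X ^ (-(γ + q - 1)) * (min (N / X) (N / X)⁻¹) ^ (γ / 2) := by
  have hq1 : 0 < q - 1 := by linarith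
  obtain ⟨v, rfl⟩ : ∃ v, N = X * v := ⟨N / X, by field_simp⟩
  have hv : 0 < v := pos_of_mul_pos_right hN hX.le
  have hXv : X * v / X = v := by field_simp
  have hsplit : X ^ (-(γ + q - 1)) = X ^ (-γ) * X ^ (-(q - 1)) := by
    rw [← Real.rpow_add hX]
    ring_nf
  rw [resolution, hXv, hsplit, Real.mul_rpow hX.le hv.le]
  split_ifs with hle
  · have hv1 : v ≤ 1 := by nlinarith
    have hmin : min v v⁻¹ = v := min_eq_left (hv1.trans ((one_le_inv₀ hv).2 hv1))
    rw [hmin, Real.mul_rpow hX.le (by positivity), ← Real.rpow_mul hv.le]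
    have he : -(2 * (γ / (q - 1))) * -(q - 1) = 2 * γ := by field_simp
    rw [he]
    calc _ = X ^ (-γ) * X ^ (-(q - 1)) * (v ^ (-γ) * v ^ (2 * γ)) := by ring
      _ ≤ _ := by
        rw [← Real.rpow_add hv]
        refine mul_le_mul_of_nonneg_left ?_ (by positivity)
        exact Real.rpow_le_rpow_of_exponent_ge hv hv1 (by linarith)
  · have hv1 : 1 ≤ v := by
      by_contra hlt
      exact hle (by nlinarith)
    have hmin : min v v⁻¹ = v⁻¹ := min_eq_right ((inv_le_one₀ hv).2 hv1 |>.trans hv1)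
    rw [hmin, Real.mul_rpow hX.le (by positivity), ← Real.rpow_mul hv.le]
    have he : -(γ / (q - 1) / 2) * -(q - 1) = γ / 2 := by field_simp
    rw [he, Real.inv_rpow hv.le, ← Real.rpow_neg hv.le]
    calc _ = X ^ (-γ) * X ^ (-(q - 1)) * (v ^ (-γ) * v ^ (γ / 2)) := by ring
      _ ≤ _ := by
        rw [← Real.rpow_add hv]
        refine mul_le_mul_of_nonneg_left ?_ (by positivity)
        exact Real.rpow_le_rpow_of_exponent_le hv1 (by linarith)

lemma log_one_add_le {x : ℝ} (hx : 0 ≤ x) : Real.log (1 + x) ≤ x := by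
  linarith [Real.log_le_sub_one_of_pos (show 0 < 1 + x by linarith)]

lemma resolution_count_le (ha : 0 < a) (hX : 0 < X) (hN : 0 < N) :
    resolution a X N * Real.log (1 + N / resolution a X N) +
        N * Real.log (1 + 2 * resolution a X N / N) ≤
      (7 + 4 * a + 4 * (1 + a / 2) / a) * X *
        (min (N / X) (N / X)⁻¹) ^ (min (1 / 2) (a / 4)) := by
  have hk := resolution_pos (a := a) hX hN
  obtain ⟨v, rfl⟩ : ∃ v, N = X * v := ⟨N / X, by field_simp⟩
  have hv : 0 < v := pos_of_mul_pos_right hN hX.le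
  have hXv : X * v / X = v := by field_simp
  set k := resolution a X (X * v) with hkdef
  have hlog1 : k * Real.log (1 + X * v / k) ≤ X * v := by
    calc k * Real.log (1 + X * v / k) ≤ k * (X * v / k) := by
          gcongr
          exact log_one_add_le (by positivity)
      _ = X * v := by field_simp
  have hlog2 : X * v * Real.log (1 + 2 * k / (X * v)) ≤ 2 * k := by
    calc _ ≤ X * v * (2 * k / (X * v)) := by
          gcongr
          exact log_one_add_le (by positivity)
      _ = 2 * k := by field_simp
  have hA : 0 < 4 * (1 + a / 2) / a := by positivity
  rw [resolution, hXv] at hkdef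
  rw [hXv]
  split_ifs at hkdef with hle
  · have hv1 : v ≤ 1 := by nlinarith
    have hmin : min v v⁻¹ = v := min_eq_left (hv1.trans ((one_le_inv₀ hv).2 hv1))
    have hmono : v ^ (1 / 2 : ℝ) ≤ v ^ (min (1 / 2) (a / 4)) :=
      Real.rpow_le_rpow_of_exponent_ge hv hv1 (min_le_left _ _)
    have hvhalf : v ≤ v ^ (1 / 2 : ℝ) := by
      simpa using Real.rpow_le_rpow_of_exponent_ge hv hv1 (show (1 / 2 : ℝ) ≤ 1 by norm_num)
    have hkN : k / (X * v) = v⁻¹ ^ (1 + 2 * a) := by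
      rw [hkdef, mul_div_mul_left _ _ hX.ne', Real.inv_rpow hv.le, ← Real.rpow_neg hv.le,
        ← Real.rpow_sub_one hv.ne']
      ring_nf
    have hvi : 1 ≤ v⁻¹ := (one_le_inv₀ hv).2 hv1
    have hvb : 1 ≤ v⁻¹ ^ (1 + 2 * a) := Real.one_le_rpow hvi (by positivity)
    have hvh : 1 ≤ v⁻¹ ^ (1 / 2 : ℝ) := Real.one_le_rpow hvi (by positivity)
    have hlog : Real.log (1 + 2 * k / (X * v)) ≤ (4 + 4 * a) * v⁻¹ ^ (1 / 2 : ℝ) := by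
      rw [mul_div_assoc, hkN]
      calc Real.log (1 + 2 * v⁻¹ ^ (1 + 2 * a)) ≤ Real.log (3 * v⁻¹ ^ (1 + 2 * a)) :=
            Real.log_le_log (by positivity) (by linarith)
        _ = Real.log 3 + (1 + 2 * a) * Real.log v⁻¹ := by
            rw [Real.log_mul (by norm_num) (by positivity), Real.log_rpow (by positivity)]
        _ ≤ 2 + (1 + 2 * a) * (v⁻¹ ^ (1 / 2 : ℝ) / (1 / 2)) := by
            gcongr
            · linarith [Real.log_le_sub_one_of_pos (show (0 : ℝ) < 3 by norm_num)]
            · exact Real.log_le_rpow_div (by positivity) (by norm_num)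
        _ ≤ _ := by linarith
    have hvv : v * v⁻¹ ^ (1 / 2 : ℝ) = v ^ (1 / 2 : ℝ) := by
      rw [Real.inv_rpow hv.le, ← Real.rpow_neg hv.le, ← Real.rpow_one_add' hv.le (by norm_num)]
      norm_num
    rw [hmin]
    calc _ ≤ X * v + X * v * ((4 + 4 * a) * v⁻¹ ^ (1 / 2 : ℝ)) := by gcongr
      _ = X * v + X * (4 + 4 * a) * (v * v⁻¹ ^ (1 / 2 : ℝ)) := by ring
      _ ≤ X * v ^ (1 / 2 : ℝ) + X * (4 + 4 * a) * v ^ (1 / 2 : ℝ) := by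
          rw [hvv]
          gcongr
      _ = (5 + 4 * a) * X * v ^ (1 / 2 : ℝ) := by ring
      _ ≤ _ :=
          mul_le_mul (mul_le_mul_of_nonneg_right (by linarith) hX.le) hmono (by positivity)
            (by positivity)
  · have hv1 : 1 ≤ v := by
      by_contra hlt
      exact hle (by nlinarith)
    have hvi : v⁻¹ ≤ 1 := (inv_le_one₀ hv).2 hv1
    have hmin : min v v⁻¹ = v⁻¹ := min_eq_right (hvi.trans hv1)
    have hmono : v⁻¹ ^ (a / 4) ≤ v⁻¹ ^ (min (1 / 2) (a / 4)) :=
      Real.rpow_le_rpow_of_exponent_ge (by positivity) hvi (min_le_right _ _)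
    have hkN : X * v / k = v ^ (1 + a / 2) := by
      rw [hkdef, mul_div_mul_left _ _ hX.ne', Real.rpow_neg hv.le, div_inv_eq_mul,
        Real.rpow_one_add' hv.le (by positivity)]
    have hvb : 1 ≤ v ^ (1 + a / 2) := Real.one_le_rpow hv1 (by positivity)
    have hvh : 1 ≤ v ^ (a / 4) := Real.one_le_rpow hv1 (by positivity)
    have hlog : Real.log (1 + X * v / k) ≤ (1 + 4 * (1 + a / 2) / a) * v ^ (a / 4) := by
      rw [hkN]
      calc Real.log (1 + v ^ (1 + a / 2)) ≤ Real.log (2 * v ^ (1 + a / 2)) :=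
            Real.log_le_log (by positivity) (by linarith)
        _ = Real.log 2 + (1 + a / 2) * Real.log v := by
            rw [Real.log_mul (by norm_num) (by positivity), Real.log_rpow (by positivity)]
        _ ≤ 1 + (1 + a / 2) * (v ^ (a / 4) / (a / 4)) := by
            gcongr
            · linarith [Real.log_le_sub_one_of_pos (show (0 : ℝ) < 2 by norm_num)]
            · exact Real.log_le_rpow_div (by positivity) (by positivity)
        _ = 1 + 4 * (1 + a / 2) / a * v ^ (a / 4) := by field_simp
        _ ≤ _ := by linarith
    have hkv : k * v ^ (a / 4) = X * v⁻¹ ^ (a / 4) := by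
      rw [hkdef, Real.inv_rpow hv.le, ← Real.rpow_neg hv.le, mul_assoc, ← Real.rpow_add hv]
      ring_nf
    rw [hmin]
    calc _ ≤ k * ((1 + 4 * (1 + a / 2) / a) * v ^ (a / 4)) + 2 * k := by gcongr
      _ ≤ k * ((1 + 4 * (1 + a / 2) / a) * v ^ (a / 4)) + 2 * (k * v ^ (a / 4)) := by
          gcongr
          exact le_mul_of_one_le_right hk.le hvh
      _ = (3 + 4 * (1 + a / 2) / a) * (k * v ^ (a / 4)) := by ring
      _ = (3 + 4 * (1 + a / 2) / a) * X * v⁻¹ ^ (a / 4) := by rw [hkv]; ring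
      _ ≤ _ :=
          mul_le_mul (mul_le_mul_of_nonneg_right (by linarith) hX.le) hmono (by positivity)
            (by positivity)

lemma exists_resolution_lt_one (ha : 0 < a) (hX : 0 < X) :
    ∃ m₀ : ℕ, ∀ m : ℕ, m₀ < m → resolution a X ((2 : ℝ) ^ m) < 1 := by
  have ht : Filter.Tendsto (fun m : ℕ => (2 : ℝ) ^ m) Filter.atTop Filter.atTop :=
    tendsto_pow_atTop_atTop_of_one_lt one_lt_two
  have h1 : Filter.Tendsto (fun m : ℕ => X * ((2 : ℝ) ^ m / X) ^ (-(a / 2)))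
      Filter.atTop (nhds (X * 0)) :=
    ((tendsto_rpow_neg_atTop (by positivity)).comp (ht.atTop_div_const hX)).const_mul X
  rw [mul_zero] at h1
  obtain ⟨m₀, hm₀⟩ := Filter.eventually_atTop.1
    ((h1.eventually_lt_const one_pos).and (ht.eventually_gt_atTop X))
  refine ⟨m₀, fun m hm => ?_⟩
  obtain ⟨h2, h3⟩ := hm₀ m hm.le
  rwa [resolution, if_neg h3.not_ge]

end Scale
section Count

/-- The number of integer vectors whose `ℓ₁`-norms on the fibres of `g` are bounded by `k`. -/
lemma exists_finset_int_card_le {ι : Type} [Fintype ι] (g : ι → ℕ) (J : Finset ℕ)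
    (hJ : ∀ i, g i ∈ J) (k N : ℕ → ℝ) (hk : ∀ m, 0 < k m) (hN : ∀ m, 0 < N m)
    (hcard : ∀ m, ((Finset.univ.filter fun i => g i = m).card : ℝ) ≤ N m) :
    ∃ Z : Finset (ι → ℤ),
      (∀ z : ι → ℤ, (∀ m, ∑ i with g i = m, |(z i : ℝ)| ≤ k m) → z ∈ Z) ∧
      (Z.card : ℝ) ≤ Real.exp (∑ m ∈ J,
        (k m * Real.log (1 + N m / k m) + N m * Real.log (1 + 2 * k m / N m))) := by
  classical
  set l : ℕ → ℝ := fun m => Real.log (1 + N m / k m) with hl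
  have hl0 : ∀ m, 0 ≤ l m := fun m => Real.log_nonneg (by
    have := div_pos (hN m) (hk m)
    linarith)
  set P : Finset (ι → ℤ) :=
    Fintype.piFinset fun i => Finset.Icc (-⌊k (g i)⌋) ⌊k (g i)⌋
  refine ⟨P.filter fun z => ∀ m, ∑ i with g i = m, |(z i : ℝ)| ≤ k m, fun z hz => ?_, ?_⟩
  · refine Finset.mem_filter.2 ⟨Fintype.mem_piFinset.2 fun i => ?_, hz⟩
    have h1 : |(z i : ℝ)| ≤ k (g i) :=
      (Finset.single_le_sum (f := fun i => |(z i : ℝ)|) (fun _ _ => abs_nonneg _)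
        (by simp)).trans (hz (g i))
    rw [Finset.mem_Icc, ← abs_le, Int.le_floor]
    exact_mod_cast h1
  have hgeom : ∀ i, ∑ j ∈ Finset.Icc (-⌊k (g i)⌋) ⌊k (g i)⌋,
      Real.exp (-l (g i)) ^ j.natAbs ≤ 1 + 2 * k (g i) / N (g i) := by
    intro i
    have hk' := hk (g i)
    have hN' := hN (g i)
    have he : Real.exp (-l (g i)) = k (g i) / (k (g i) + N (g i)) := by
      rw [Real.exp_neg, hl, Real.exp_log (by positivity)]
      field_simp
    have hs := hasSum_pow_natAbs (Real.exp_pos (-l (g i))).le (by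
      rw [he, div_lt_one (by positivity)]
      linarith)
    refine (sum_le_hasSum _ (fun _ _ => by positivity) hs).trans (le_of_eq ?_)
    rw [he]
    have : 1 - k (g i) / (k (g i) + N (g i)) = N (g i) / (k (g i) + N (g i)) := by
      field_simp
      ring
    rw [this]
    field_simp
    ring
  have hone : ∀ z ∈ P.filter fun z => ∀ m, ∑ i with g i = m, |(z i : ℝ)| ≤ k m,
      1 ≤ Real.exp (∑ m ∈ J, k m * l m) * ∏ i, Real.exp (-l (g i)) ^ (z i).natAbs := by
    intro z hz
    have hz' := (Finset.mem_filter.1 hz).2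
    have hprod : ∏ i, Real.exp (-l (g i)) ^ (z i).natAbs =
        Real.exp (-∑ m ∈ J, l m * ∑ i with g i = m, |(z i : ℝ)|) := by
      have hfib : ∑ m ∈ J, l m * ∑ i with g i = m, |(z i : ℝ)| =
          ∑ i, l (g i) * |(z i : ℝ)| := by
        rw [← Finset.sum_fiberwise_of_maps_to (s := Finset.univ) (t := J) (g := g)
          (fun i _ => hJ i)]
        refine Finset.sum_congr rfl fun m _ => ?_
        rw [Finset.mul_sum]
        refine Finset.sum_congr rfl fun i hi => ?_
        rw [(Finset.mem_filter.1 hi).2]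
      rw [hfib, ← Finset.sum_neg_distrib, Real.exp_sum]
      refine Finset.prod_congr rfl fun i _ => ?_
      rw [← Real.exp_nat_mul, Nat.cast_natAbs, Int.cast_abs]
      ring_nf
    rw [hprod, ← Real.exp_add]
    refine Real.one_le_exp ?_
    rw [← sub_eq_add_neg, sub_nonneg]
    refine Finset.sum_le_sum fun m _ => ?_
    rw [mul_comm (k m)]
    exact mul_le_mul_of_nonneg_left (hz' m) (hl0 m)
  have hprod2 : ∏ i, (1 + 2 * k (g i) / N (g i)) ≤
      Real.exp (∑ m ∈ J, N m * Real.log (1 + 2 * k m / N m)) := by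
    rw [← Finset.prod_fiberwise_of_maps_to' (s := Finset.univ) (t := J) (g := g)
      (fun i _ => hJ i) (fun m => 1 + 2 * k m / N m), Real.exp_sum]
    refine Finset.prod_le_prod (fun m _ => Finset.prod_nonneg fun i _ => ?_) fun m _ => ?_
    · have := hk m
      have := hN m
      positivity
    · have := hk m
      have := hN m
      have h1 : 1 ≤ 1 + 2 * k m / N m := by
        have : 0 < 2 * k m / N m := by positivity
        linarith
      rw [Finset.prod_const, mul_comm (N m), ← Real.rpow_def_of_pos (by positivity),
        ← Real.rpow_natCast]
      exact Real.rpow_le_rpow_of_exponent_le h1 (hcard m)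
  calc ((P.filter fun z => ∀ m, ∑ i with g i = m, |(z i : ℝ)| ≤ k m).card : ℝ)
      = ∑ z ∈ P.filter fun z => ∀ m, ∑ i with g i = m, |(z i : ℝ)| ≤ k m, (1 : ℝ) := by simp
    _ ≤ ∑ z ∈ P.filter fun z => ∀ m, ∑ i with g i = m, |(z i : ℝ)| ≤ k m,
          Real.exp (∑ m ∈ J, k m * l m) * ∏ i, Real.exp (-l (g i)) ^ (z i).natAbs :=
        Finset.sum_le_sum hone
    _ ≤ ∑ z ∈ P, Real.exp (∑ m ∈ J, k m * l m) *
          ∏ i, Real.exp (-l (g i)) ^ (z i).natAbs :=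
        Finset.sum_le_sum_of_subset_of_nonneg (Finset.filter_subset _ _)
          fun _ _ _ => by positivity
    _ = Real.exp (∑ m ∈ J, k m * l m) *
          ∏ i, ∑ j ∈ Finset.Icc (-⌊k (g i)⌋) ⌊k (g i)⌋, Real.exp (-l (g i)) ^ j.natAbs := by
        rw [← Finset.mul_sum, Finset.prod_univ_sum]
    _ ≤ Real.exp (∑ m ∈ J, k m * l m) *
          Real.exp (∑ m ∈ J, N m * Real.log (1 + 2 * k m / N m)) := by
        gcongr
        exact (Finset.prod_le_prod (fun i _ => Finset.sum_nonneg fun _ _ => by positivity)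
          fun i _ => hgeom i).trans hprod2
    _ = _ := by
        rw [← Real.exp_add, ← Finset.sum_add_distrib]

/-- Rounding towards zero. -/
lemma exists_int_abs_le (r : ℝ) : ∃ j : ℤ, |(j : ℝ)| ≤ |r| ∧ |r - j| ≤ 1 ∧ |r - j| ≤ |r| := by
  rcases le_total 0 r with h | h
  · have h1 := Int.floor_le r
    have h2 := Int.lt_floor_add_one r
    have h3 : (0 : ℝ) ≤ ⌊r⌋ := by exact_mod_cast Int.floor_nonneg.2 h
    refine ⟨⌊r⌋, ?_, ?_, ?_⟩
    · rwa [abs_of_nonneg h3, abs_of_nonneg h]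
    · rw [abs_of_nonneg (by linarith)]
      linarith
    · rw [abs_of_nonneg (by linarith), abs_of_nonneg h]
      linarith
  · have h1 := Int.le_ceil r
    have h2 := Int.ceil_lt_add_one r
    have h3 : (⌈r⌉ : ℝ) ≤ 0 := by exact_mod_cast Int.ceil_le.2 (by simpa using h)
    refine ⟨⌈r⌉, ?_, ?_, ?_⟩
    · rw [abs_of_nonpos h3, abs_of_nonpos h]
      linarith
    · rw [abs_of_nonpos (by linarith)]
      linarith
    · rw [abs_of_nonpos (by linarith), abs_of_nonpos h]
      linarith

/-- Error of rounding the coordinates of one generation to multiples of `1 / k`. -/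
lemma sum_rounding_error_le {T : Type} {q : ℝ} (hq : 1 < q) {k w : ℝ} (hk : 0 < k) (hw : 0 ≤ w)
    (L : Finset T) (b y z : T → ℝ) (hb : ∀ t ∈ L, 0 ≤ b t ∧ b t ≤ w)
    (hy : ∑ t ∈ L, |y t| ≤ 1)
    (hz : ∀ t ∈ L, |k * y t - z t| ≤ 1 ∧ |k * y t - z t| ≤ |k * y t|) :
    ∑ t ∈ L, |b t * y t - b t * (z t / k)| ^ q ≤ w ^ q * k ^ (-(q - 1)) := by
  have hterm : ∀ t ∈ L, |b t * y t - b t * (z t / k)| ^ q ≤ w ^ q * k ^ (-(q - 1)) * |y t| := by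
    intro t ht
    obtain ⟨hb0, hbw⟩ := hb t ht
    obtain ⟨hz1, hz2⟩ := hz t ht
    have hfac : b t * y t - b t * (z t / k) = b t * ((k * y t - z t) / k) := by
      field_simp
    rw [hfac, abs_mul, abs_of_nonneg hb0, abs_div, abs_of_pos hk,
      Real.mul_rpow hb0 (by positivity), mul_assoc]
    refine mul_le_mul (Real.rpow_le_rpow hb0 hbw (by linarith)) ?_ (by positivity)
      (Real.rpow_nonneg (hb0.trans hbw) _)
    set e := |k * y t - z t|
    have he0 : 0 ≤ e := abs_nonneg _
    have hsplit : (e / k) ^ q = (e / k) ^ (q - 1) * (e / k) := by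
      rw [← Real.rpow_add_one' (by positivity) (by linarith)]
      ring_nf
    rw [hsplit]
    refine mul_le_mul ?_ ?_ (by positivity) (by positivity)
    · rw [Real.rpow_neg hk.le, ← Real.inv_rpow hk.le]
      refine Real.rpow_le_rpow (by positivity) ?_ (by linarith)
      rw [← one_div]
      gcongr
    · rw [div_le_iff₀ hk, mul_comm]
      rwa [abs_mul, abs_of_pos hk] at hz2
  calc _ ≤ w ^ q * k ^ (-(q - 1)) * ∑ t ∈ L, |y t| := by
        rw [Finset.mul_sum]
        exact Finset.sum_le_sum hterm
    _ ≤ _ := mul_le_of_le_one_right (by positivity) hy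

end Count
section Entropy

variable {T : Type} [PartialOrder T] [OrderBot T]

/-- The averages of `x ∈ ℓ₁(T)` over the subtrees rooted in one generation have `ℓ₁`-norm at
most `‖x‖`. -/
lemma sum_abs_tsum_div_le (h : IsTree T) {σ : T → ℝ} (hσpos : ∀ t, 0 < σ t)
    (hσmono : ∀ ⦃t s : T⦄, t ≤ s → σ s ≤ σ t) (x : ellOne T) (m : ℕ) (L : Finset T)
    (hL : ∀ t ∈ L, gen t = m) :
    ∑ t ∈ L, |(∑' s : {s : T // t ≤ s}, σ s.1 * (x : ∀ _ : T, ℝ) s.1) / σ t| ≤ ‖x‖ := by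
  classical
  have hxs : Summable fun s => |(x : ∀ _ : T, ℝ) s| := by
    simpa using (lp.memℓp x).summable (by simp)
  have hnorm : ‖x‖ = ∑' s, |(x : ∀ _ : T, ℝ) s| := by
    simpa using lp.norm_eq_tsum_rpow (p := 1) (by simp) x
  have hind : ∀ t, Summable ((Set.Ici t).indicator fun s => |(x : ∀ _ : T, ℝ) s|) :=
    fun t => hxs.indicator _
  have hle : ∀ t, |(∑' s : {s : T // t ≤ s}, σ s.1 * (x : ∀ _ : T, ℝ) s.1) / σ t| ≤
      ∑' s, (Set.Ici t).indicator (fun s => |(x : ∀ _ : T, ℝ) s|) s := by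
    intro t
    have hsub : Summable fun s : {s : T // t ≤ s} => |(x : ∀ _ : T, ℝ) s.1| :=
      hxs.subtype (Set.Ici t)
    have hb : ∀ s : {s : T // t ≤ s},
        ‖σ s.1 * (x : ∀ _ : T, ℝ) s.1‖ ≤ σ t * |(x : ∀ _ : T, ℝ) s.1| := fun s => by
      rw [norm_mul, Real.norm_of_nonneg (hσpos _).le, Real.norm_eq_abs]
      exact mul_le_mul_of_nonneg_right (hσmono s.2) (abs_nonneg _)
    have := tsum_of_norm_bounded (hsub.mul_left (σ t)).hasSum hb
    rw [tsum_mul_left, Real.norm_eq_abs] at this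
    rw [abs_div, abs_of_pos (hσpos t), div_le_iff₀' (hσpos t),
      ← tsum_subtype (Set.Ici t) fun s => |(x : ∀ _ : T, ℝ) s|]
    exact this
  calc _ ≤ ∑ t ∈ L, ∑' s, (Set.Ici t).indicator (fun s => |(x : ∀ _ : T, ℝ) s|) s :=
        Finset.sum_le_sum fun t _ => hle t
    _ = ∑' s, ∑ t ∈ L, (Set.Ici t).indicator (fun s => |(x : ∀ _ : T, ℝ) s|) s :=
        (Summable.tsum_finsetSum fun t _ => hind t).symm
    _ ≤ ∑' s, |(x : ∀ _ : T, ℝ) s| := by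
        refine Summable.tsum_le_tsum (fun s => ?_) (summable_sum fun t _ => hind t) hxs
        by_cases hs : ∃ t ∈ L, t ≤ s
        · obtain ⟨t, ht, hts⟩ := hs
          rw [Finset.sum_eq_single_of_mem t ht]
          · exact Set.indicator_le_self' (fun _ _ => abs_nonneg _) s
          · intro u hu hut
            refine Set.indicator_of_notMem (fun hus => hut ?_) _
            exact eq_of_gen_eq h hus hts ((hL u hu).trans (hL t ht).symm)
        · push Not at hs
          exact (Finset.sum_eq_zero fun t ht =>
            Set.indicator_of_notMem (s := Set.Ici t) (hs t ht) _).trans_le (abs_nonneg _)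
    _ = ‖x‖ := hnorm.symm

/-- Finite nets of `V(B)` obtained by rounding every generation to its own resolution. -/
lemma exists_net (hbin : IsBinaryTree T) {q : ℝ} (hq : 1 < q)
    {α σ : T → ℝ} (hα : ∀ t, 0 < α t) (hσpos : ∀ t, 0 < σ t)
    (hσmono : ∀ ⦃t s : T⦄, t ≤ s → σ s ≤ σ t)
    [Fact (1 ≤ ENNReal.ofReal q)] (V : ellOne T →L[ℝ] ellQ T q)
    (hV : ∀ (x : ellOne T) (t : T), (V x : ∀ _ : T, ℝ) t =
      α t * ∑' s : {s : T // t ≤ s}, σ s.1 * (x : ∀ _ : T, ℝ) s.1)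
    {c γ : ℝ} (hc : 0 < c) (hγ : 0 < γ)
    (hw : ∀ t : T, α t * σ t ≤ c * (2 : ℝ) ^ (-(γ / q) * (gen t : ℝ))) :
    ∃ A > 0, ∃ D > 0, ∀ X > 0, ∃ F : Finset (ellQ T q), (F.card : ℝ) ≤ Real.exp (A * X) ∧
      ∀ x : ellOne T, ‖x‖ ≤ 1 → ∃ y ∈ F, ‖V x - y‖ ≤ D * X ^ (-((γ + q - 1) / q)) := by
  classical
  have hq0 : 0 < q := by linarith
  have hq1 : 0 < q - 1 := by linarith
  have htoReal : (ENNReal.ofReal q).toReal = q := ENNReal.toReal_ofReal hq0.le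
  set a := γ / (q - 1)
  have ha : 0 < a := by positivity
  obtain ⟨B, hB, hBsum⟩ := exists_sum_min_rpow_le (a := γ / 2) (by positivity)
  obtain ⟨B', hB', hBsum'⟩ := exists_sum_min_rpow_le (a := min (1 / 2) (a / 4)) (by positivity)
  refine ⟨(7 + 4 * a + 4 * (1 + a / 2) / a) * B', by positivity, c * B ^ (1 / q), by positivity,
    fun X hX => ?_⟩
  set k : ℕ → ℝ := fun m => resolution a X ((2 : ℝ) ^ m)
  have hk : ∀ m, 0 < k m := fun m => resolution_pos hX (by positivity)
  obtain ⟨m₀, hm₀⟩ := exists_resolution_lt_one ha hX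
  obtain ⟨S, hS, -⟩ := exists_finset_gen_le hbin m₀
  choose L hL hLcard using exists_level hbin
  obtain ⟨Z, hZ, hZcard⟩ := exists_finset_int_card_le (ι := {t // t ∈ S}) (fun i => gen i.1)
    (Finset.range (m₀ + 1)) (fun i => Finset.mem_range.2 (Nat.lt_succ_of_le ((hS _).1 i.2)))
    k (fun m => (2 : ℝ) ^ m) hk (fun m => by positivity) (fun m => by
      have hcard : (Finset.univ.filter fun i : {t // t ∈ S} => gen i.1 = m).card ≤ (L m).card :=
        Finset.card_le_card_of_injOn Subtype.val
          (fun i hi => (hL m i.1).2 (Finset.mem_filter.1 hi).2) Subtype.val_injective.injOn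
      exact_mod_cast hcard.trans (hLcard m))
  set b : T → ℝ := fun t => α t * σ t with hb_def
  have hb : ∀ t, 0 < b t := fun t => mul_pos (hα t) (hσpos t)
  let f : ({t // t ∈ S} → ℤ) → ellQ T q := fun z =>
    ⟨fun t => if h : t ∈ S then b t * (z ⟨t, h⟩ / k (gen t)) else 0,
      memℓp_gen (summable_of_ne_finset_zero (s := S) fun t ht => by
        rw [dif_neg ht, norm_zero, Real.zero_rpow (by rw [htoReal]; exact hq0.ne')])⟩
  refine ⟨Z.image f, ?_, fun x hx => ?_⟩
  · calc ((Z.image f).card : ℝ) ≤ Z.card := by exact_mod_cast Finset.card_image_le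
      _ ≤ _ := hZcard
      _ ≤ _ := by
        refine Real.exp_le_exp.2 ?_
        calc _ ≤ ∑ m ∈ Finset.range (m₀ + 1), (7 + 4 * a + 4 * (1 + a / 2) / a) * X *
              (min ((2 : ℝ) ^ m / X) ((2 : ℝ) ^ m / X)⁻¹) ^ (min (1 / 2) (a / 4)) :=
            Finset.sum_le_sum fun m _ => resolution_count_le ha hX (by positivity)
          _ ≤ (7 + 4 * a + 4 * (1 + a / 2) / a) * X * B' := by
            rw [← Finset.mul_sum]
            exact mul_le_mul_of_nonneg_left (hBsum' X hX _) (by positivity)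
          _ = _ := by ring
  set y : T → ℝ := fun t =>
    (∑' s : {s : T // t ≤ s}, σ s.1 * (x : ∀ _ : T, ℝ) s.1) / σ t with hy_def
  have hVy : ∀ t, (V x : ∀ _ : T, ℝ) t = b t * y t := fun t => by
    have := hσpos t
    rw [hV x t, hb_def, hy_def]
    field_simp
  have hy : ∀ m, ∀ A : Finset T, (∀ t ∈ A, gen t = m) → ∑ t ∈ A, |y t| ≤ 1 := fun m A hA =>
    (sum_abs_tsum_div_le hbin.1 hσpos hσmono x m A hA).trans hx
  choose j hj1 hj2 hj3 using fun t => exists_int_abs_le (k (gen t) * y t)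
  have hjS : ∀ t, t ∉ S → j t = 0 := by
    intro t ht
    have hgen : m₀ < gen t := not_le.1 fun hle => ht ((hS t).2 hle)
    have hyt : |y t| ≤ 1 := by simpa using hy (gen t) {t} (by simp)
    have hlt : |(j t : ℝ)| < 1 := by
      refine (hj1 t).trans_lt ?_
      rw [abs_mul, abs_of_pos (hk _)]
      exact (mul_le_of_le_one_right (hk _).le hyt).trans_lt (hm₀ _ hgen)
    exact Int.abs_lt_one_iff.1 (by exact_mod_cast hlt)
  refine ⟨f fun i => j i.1, Finset.mem_image_of_mem _ (hZ _ fun m => ?_), ?_⟩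
  · calc ∑ i : {t // t ∈ S} with gen i.1 = m, |(j i.1 : ℝ)|
        ≤ ∑ i : {t // t ∈ S} with gen i.1 = m, k m * |y i.1| := by
          refine Finset.sum_le_sum fun i hi => (hj1 i.1).trans (le_of_eq ?_)
          rw [abs_mul, abs_of_pos (hk _), (Finset.mem_filter.1 hi).2]
      _ = k m * ∑ t ∈ (Finset.univ.filter fun i : {t // t ∈ S} => gen i.1 = m).map
            (Function.Embedding.subtype _), |y t| := by
          rw [Finset.sum_map, Finset.mul_sum]
          rfl
      _ ≤ k m := by
          refine mul_le_of_le_one_right (hk m).le (hy m _ fun t ht => ?_)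
          obtain ⟨i, hi, rfl⟩ := Finset.mem_map.1 ht
          exact (Finset.mem_filter.1 hi).2
  have hcoord : ∀ t, ((V x - f fun i => j i.1 : ellQ T q) : ∀ _ : T, ℝ) t =
      b t * y t - b t * (j t / k (gen t)) := by
    intro t
    rw [lp.coeFn_sub, Pi.sub_apply, hVy t]
    congr 1
    change (if h : t ∈ S then b t * (j t / k (gen t)) else 0) = _
    split_ifs with h
    · rfl
    · simp [hjS t h]
  refine lp.norm_le_of_forall_sum_le (by rw [htoReal]; exact hq0) (by positivity) fun s => ?_
  rw [htoReal]
  simp_rw [hcoord, Real.norm_eq_abs]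
  rw [← Finset.sum_fiberwise_of_maps_to (s := s) (t := s.image gen) (g := gen)
    (fun t ht => Finset.mem_image_of_mem _ ht)]
  calc _ ≤ ∑ m ∈ s.image gen, c ^ q * X ^ (-(γ + q - 1)) *
        (min ((2 : ℝ) ^ m / X) ((2 : ℝ) ^ m / X)⁻¹) ^ (γ / 2) := by
        refine Finset.sum_le_sum fun m _ => ?_
        calc _ = ∑ t ∈ s with gen t = m, |b t * y t - b t * (j t / k m)| ^ q := by
              refine Finset.sum_congr rfl fun t ht => ?_
              rw [(Finset.mem_filter.1 ht).2]
          _ ≤ (c * (2 : ℝ) ^ (-(γ / q) * (m : ℝ))) ^ q * k m ^ (-(q - 1)) := by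
              refine sum_rounding_error_le hq (hk m) (by positivity) _ b y (fun t => j t)
                (fun t ht => ⟨(hb t).le, ?_⟩)
                (hy m _ fun t ht => (Finset.mem_filter.1 ht).2) (fun t ht => ?_)
              · rw [← (Finset.mem_filter.1 ht).2]
                exact hw t
              · rw [← (Finset.mem_filter.1 ht).2]
                exact ⟨hj2 t, hj3 t⟩
          _ = c ^ q * (((2 : ℝ) ^ m) ^ (-γ) * k m ^ (-(q - 1))) := by
              rw [Real.mul_rpow hc.le (by positivity), ← Real.rpow_mul zero_le_two,
                ← Real.rpow_natCast, ← Real.rpow_mul zero_le_two, mul_assoc]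
              congr 3
              field_simp
          _ ≤ c ^ q * (X ^ (-(γ + q - 1)) *
                (min ((2 : ℝ) ^ m / X) ((2 : ℝ) ^ m / X)⁻¹) ^ (γ / 2)) :=
              mul_le_mul_of_nonneg_left (resolution_error_le hγ hq hX (by positivity))
                (by positivity)
          _ = _ := by ring
    _ ≤ c ^ q * X ^ (-(γ + q - 1)) * B := by
        rw [← Finset.mul_sum]
        exact mul_le_mul_of_nonneg_left (hBsum X hX _) (by positivity)
    _ = _ := by
        rw [Real.mul_rpow (by positivity) (by positivity), Real.mul_rpow hc.le (by positivity),
          ← Real.rpow_mul hB.le, ← Real.rpow_mul hX.le, one_div_mul_cancel hq0.ne',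
          Real.rpow_one, neg_mul, div_mul_cancel₀ _ hq0.ne']
        ring

/-- Exponential-size nets with polynomial error give polynomial decay of the entropy numbers. -/
lemma exists_entropyNumber_le {E F : Type} [NormedAddCommGroup E] [NormedSpace ℝ E]
    [NormedAddCommGroup F] [NormedSpace ℝ F] (V : E →L[ℝ] F) {A D θ : ℝ} (hA : 0 < A)
    (hD : 0 < D)
    (hnet : ∀ X > 0, ∃ G : Finset F, (G.card : ℝ) ≤ Real.exp (A * X) ∧
      ∀ x : E, ‖x‖ ≤ 1 → ∃ y ∈ G, ‖V x - y‖ ≤ D * X ^ (-θ)) :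
    ∃ C > 0, ∀ n : ℕ, 1 ≤ n → entropyNumber n V ≤ C * (n : ℝ) ^ (-θ) := by
  have hbdd : ∀ n : ℕ, BddBelow {ε : ℝ | 0 < ε ∧ ∃ F : Finset F, F.card ≤ 2 ^ (n - 1) ∧
      ∀ x : E, ‖x‖ ≤ 1 → ∃ y ∈ F, ‖V x - y‖ < ε} := fun n => ⟨0, fun ε hε => hε.1.le⟩
  set κ := Real.log 2 / (2 * A) with hκ_def
  have hlog2 : 0 < Real.log 2 := Real.log_pos one_lt_two
  have hκ : 0 < κ := by positivity
  refine ⟨max (‖V‖ + 1) (2 * (D * κ ^ (-θ))), by positivity, fun n hn => ?_⟩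
  rcases hn.eq_or_lt with rfl | hn2
  · have : entropyNumber 1 V ≤ ‖V‖ + 1 := by
      refine csInf_le (hbdd 1) ⟨by positivity, {0}, by simp, fun x hx => ⟨0, by simp, ?_⟩⟩
      rw [sub_zero]
      linarith [V.le_of_opNorm_le_of_le le_rfl hx]
    simpa using Or.inl this
  have hn0 : (0 : ℝ) < n := by positivity
  obtain ⟨G, hGcard, hG⟩ := hnet (κ * n) (by positivity)
  have hcard : G.card ≤ 2 ^ (n - 1) := by
    have hn2' : (2 : ℝ) ≤ n := by exact_mod_cast hn2
    have : (G.card : ℝ) ≤ 2 ^ (n - 1) := by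
      calc (G.card : ℝ) ≤ Real.exp (A * (κ * n)) := hGcard
        _ ≤ Real.exp (Real.log 2 * ((n - 1 : ℕ) : ℝ)) := by
            refine Real.exp_le_exp.2 ?_
            have : A * (κ * n) = Real.log 2 * (n / 2) := by
              rw [hκ_def]
              field_simp
            rw [this, Nat.cast_sub hn]
            refine mul_le_mul_of_nonneg_left ?_ hlog2.le
            push_cast
            linarith
        _ = 2 ^ (n - 1) := by
            rw [← Real.rpow_def_of_pos two_pos, Real.rpow_natCast]
    exact_mod_cast this
  have hmul : D * (κ * n) ^ (-θ) = D * κ ^ (-θ) * (n : ℝ) ^ (-θ) := by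
    rw [Real.mul_rpow hκ.le hn0.le]
    ring
  have hpos : 0 < D * κ ^ (-θ) * (n : ℝ) ^ (-θ) := by positivity
  calc entropyNumber n V ≤ 2 * (D * κ ^ (-θ)) * (n : ℝ) ^ (-θ) := by
        refine csInf_le (hbdd n) ⟨by positivity, G, hcard, fun x hx => ?_⟩
        obtain ⟨y, hy, hxy⟩ := hG x hx
        refine ⟨y, hy, ?_⟩
        rw [hmul] at hxy
        linarith
    _ ≤ _ := by
        gcongr
        exact le_max_right _ _

end Entropy

theorem stmt15 {T : Type} [Countable T] [PartialOrder T] [OrderBot T]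
    (hbin : IsBinaryTree T) (q : ℝ) (hq : 1 < q)
    (α σ : T → ℝ) (hα : ∀ t, 0 < α t) (hσpos : ∀ t, 0 < σ t)
    (hσmono : ∀ ⦃t s : T⦄, t ≤ s → σ s ≤ σ t)
    (K : ℝ) (hK : ∀ s : T, (∑ᶠ r ∈ Set.Iic s, α r ^ q) ^ (1 / q) * σ s ≤ K)
    (glb : T → T → T) (hglb : IsGCA glb)
    [Fact (1 ≤ ENNReal.ofReal q)]
    (V : ellOne T →L[ℝ] ellQ T q)
    (hV : ∀ (x : ellOne T) (t : T), (V x : ∀ _ : T, ℝ) t =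
      α t * ∑' s : {s : T // t ≤ s}, σ s.1 * (x : ∀ _ : T, ℝ) s.1)
    (c γ : ℝ) (hc : 0 < c) (hγ : 0 < γ)
    (hw : ∀ t : T, α t * σ t ≤ c * (2 : ℝ) ^ (-(γ / q) * (gen t : ℝ)))
    (p p' : ℝ) (hp : p = min 2 q) (hp' : 1 / p' = 1 - 1 / p) :
    (∃ C > 0, ∃ ε₀ > 0, ∀ ε : ℝ, 0 < ε → ε < ε₀ →
      orderCoveringNumber (treeDist q α σ glb) ε ≤
        ENNReal.ofReal (C * ε ^ (-(q / γ)))) ∧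
    (∃ C' > 0, ∀ n : ℕ, 1 ≤ n →
      entropyNumber n V ≤ C' * (n : ℝ) ^ (-(γ / q) - 1 / p')) := by
  refine ⟨exists_orderCoveringNumber_le hbin hq hα hσpos hσmono glb hc hγ hw, ?_⟩
  obtain ⟨A, hA, D, hD, hnet⟩ := exists_net hbin hq hα hσpos hσmono V hV hc hγ hw
  obtain ⟨C, hC, hn⟩ := exists_entropyNumber_le V hA hD hnet
  refine ⟨C, hC, fun n hn1 => (hn n hn1).trans ?_⟩
  have hp0 : 0 < p := hp ▸ lt_min two_pos (by linarith)
  have hpq : 1 / q ≤ 1 / p := one_div_le_one_div_of_le hp0 (hp ▸ min_le_right _ _)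
  have hexp : (γ + q - 1) / q = γ / q + 1 - 1 / q := by
    field_simp
  refine mul_le_mul_of_nonneg_left
    (Real.rpow_le_rpow_of_exponent_le (by exact_mod_cast hn1) ?_) hC.le
  rw [hexp, hp']
  linarith
end
end

section
/- Let φ be a strictly decreasing continuous function on (0,∞) with ∫_0^∞ φ(x)dx < ∞ such that (α(t)σ(t))^q ≥ φ(|t|) for all t ∈ T with |t| ≥ 1, and let ρ be a continuous non-decreasing function on [0,∞) with ρ(0) = 1 and R(n) ≥ ρ(n) for all n ≥ 0. Then for every ε > 0, N(T,d,ε/2) ≥ ∫_1^{φ^{-1}(ε^q)−1} ρ(x)dx. -/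
open scoped ENNReal NNReal
open MeasureTheory

noncomputable section

/-- Every node strictly below `t` on the way to `s` contributes its own weight to `dOrd`. -/
lemma mul_le_dOrd {T : Type} [PartialOrder T] (hfin : ∀ s : T, (Set.Iic s).Finite)
    {q : ℝ} (hq : 0 < q) {α σ : T → ℝ} (hα : ∀ t, 0 < α t) (hσ : ∀ t, 0 < σ t)
    {t v s : T} (htv : t < v) (hvs : v ≤ s) : α v * σ v ≤ dOrd q α σ t s := by
  have hIoc : ∀ u : T, (Set.Ioc t u).Finite := fun u => (hfin u).subset fun x hx => hx.2
  have hle : α v ≤ (∑ᶠ r ∈ Set.Ioc t v, α r ^ q) ^ (1 / q) := by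
    rw [finsum_mem_eq_finite_toFinset_sum _ (hIoc v)]
    calc α v = (α v ^ q) ^ (1 / q) := by
          rw [one_div, Real.rpow_rpow_inv (hα v).le hq.ne']
      _ ≤ _ := Real.rpow_le_rpow (Real.rpow_nonneg (hα v).le q)
          (Finset.single_le_sum (f := fun r => α r ^ q)
            (fun r _ => Real.rpow_nonneg (hα r).le q) (by simpa using htv))
          (by positivity)
  exact (mul_le_mul_of_nonneg_right hle (hσ v).le).trans
    (le_csSup ((hIoc s).image _).bddAbove ⟨v, ⟨htv, hvs⟩, rfl⟩)

lemma dOrd_nonneg {T : Type} [PartialOrder T] {q : ℝ} {α σ : T → ℝ} (hα : ∀ t, 0 < α t)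
    (hσ : ∀ t, 0 < σ t) (t s : T) : 0 ≤ dOrd q α σ t s := by
  refine Real.sSup_nonneg ?_
  rintro _ ⟨v, -, rfl⟩
  exact mul_nonneg (Real.rpow_nonneg (finsum_nonneg fun r => finsum_nonneg fun _ =>
    Real.rpow_nonneg (hα r).le q) _) (hσ v).le

/-- A node whose weight is at least `δ` lies in an open `δ`-ball only if it is an ancestor of
the centre. -/
lemma le_of_treeDist_lt {T : Type} [PartialOrder T] (hfin : ∀ s : T, (Set.Iic s).Finite)
    {q : ℝ} (hq : 0 < q) {α σ : T → ℝ} (hα : ∀ t, 0 < α t) (hσ : ∀ t, 0 < σ t)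
    {glb : T → T → T} (hglb : IsGCA glb) {δ : ℝ} {c t : T} (ht : δ ≤ α t * σ t)
    (hct : treeDist q α σ glb c t < δ) : t ≤ c := by
  by_contra hn
  unfold treeDist at hct
  split_ifs at hct with hle
  · have hlt : c < t := lt_of_le_not_ge hle hn
    linarith [mul_le_dOrd hfin hq hα hσ hlt le_rfl]
  · obtain ⟨h1, h2, -⟩ := hglb c t
    have hlt : glb c t < t := lt_of_le_of_ne h2 fun h => hn (h ▸ h1)
    linarith [mul_le_dOrd hfin hq hα hσ hlt le_rfl,
      dOrd_nonneg (q := q) hα hσ (glb c t) c]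

/-- An open `δ`-ball contains at most one node whose weight is at least `δ`. -/
lemma eq_of_treeDist_lt {T : Type} [PartialOrder T] [OrderBot T] (htree : IsTree T)
    {q : ℝ} (hq : 0 < q) {α σ : T → ℝ} (hα : ∀ t, 0 < α t) (hσ : ∀ t, 0 < σ t)
    {glb : T → T → T} (hglb : IsGCA glb) {δ : ℝ} {c t s : T}
    (ht : δ ≤ α t * σ t) (hs : δ ≤ α s * σ s)
    (hct : treeDist q α σ glb c t < δ) (hcs : treeDist q α σ glb c s < δ) : t = s := by
  have not_lt : ∀ {a b : T}, δ ≤ α b * σ b → a ≤ c → b ≤ c →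
      treeDist q α σ glb c a < δ → ¬ a < b := by
    intro a b hb hac hbc hca hab
    have hnot : ¬ c ≤ a := fun h => (hab.trans_le hbc).not_ge h
    rw [treeDist, if_neg hnot, if_pos hac] at hca
    linarith [mul_le_dOrd htree.1 hq hα hσ hab hbc]
  have htc := le_of_treeDist_lt htree.1 hq hα hσ hglb ht hct
  have hsc := le_of_treeDist_lt htree.1 hq hα hσ hglb hs hcs
  rcases htree.2.1 c t s htc hsc with h | h
  · exact h.eq_of_not_lt (not_lt hs htc hsc hct)
  · exact (h.eq_of_not_lt (not_lt ht hsc htc hcs)).symm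

/-- The integral of a non-decreasing non-negative function over `(1, L - 1]` is at most the sum
of its values at `1, …, ⌊L⌋`. -/
lemma setIntegral_Ioc_le_sum_floor {ρ : ℝ → ℝ} (hρm : MonotoneOn ρ (Set.Ici 0))
    (hρ0 : 0 ≤ ρ 0) (L : ℝ) :
    ∫ x in Set.Ioc 1 (L - 1), ρ x ≤ ∑ n ∈ Finset.Icc 1 ⌊L⌋₊, ρ n := by
  have hnonneg : ∀ x : ℝ, 0 ≤ x → 0 ≤ ρ x := fun x hx =>
    hρ0.trans (hρm Set.self_mem_Ici hx hx)
  rcases le_or_gt (L - 1) 1 with hL | hL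
  · rw [Set.Ioc_eq_empty hL.not_gt, setIntegral_empty]
    exact Finset.sum_nonneg fun n _ => hnonneg n n.cast_nonneg
  have hN : 1 ≤ ⌊L⌋₊ := Nat.le_floor (by push_cast; linarith)
  have hN' : (1 : ℝ) ≤ (⌊L⌋₊ : ℝ) := by exact_mod_cast hN
  have hmono : MonotoneOn ρ (Set.Icc ((1 : ℕ) : ℝ) (⌊L⌋₊ : ℝ)) :=
    hρm.mono fun x hx => le_trans (Nat.cast_nonneg 1) hx.1
  have hint : IntegrableOn ρ (Set.Ioc 1 (⌊L⌋₊ : ℝ)) := by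
    rw [Nat.cast_one] at hmono
    exact (hmono.integrableOn_isCompact isCompact_Icc).mono_set Set.Ioc_subset_Icc_self
  calc ∫ x in Set.Ioc 1 (L - 1), ρ x ≤ ∫ x in Set.Ioc 1 (⌊L⌋₊ : ℝ), ρ x := by
        refine setIntegral_mono_set hint ?_ (Set.Ioc_subset_Ioc_right
          (Nat.sub_one_lt_floor L).le).eventuallyLE
        filter_upwards [ae_restrict_mem measurableSet_Ioc] with x hx
        exact hnonneg x (by linarith [hx.1])
    _ = ∫ x in ((1 : ℕ) : ℝ)..(⌊L⌋₊ : ℝ), ρ x := by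
        rw [Nat.cast_one, intervalIntegral.integral_of_le hN']
    _ ≤ ∑ i ∈ Finset.Ico 1 ⌊L⌋₊, ρ ((i + 1 : ℕ) : ℝ) := hmono.integral_le_sum_Ico hN
    _ = ∑ n ∈ Finset.Ico (1 + 1) (⌊L⌋₊ + 1), ρ n :=
        Finset.sum_Ico_add' (fun n : ℕ => ρ n) 1 ⌊L⌋₊ 1
    _ ≤ ∑ n ∈ Finset.Icc 1 ⌊L⌋₊, ρ n := by
        refine Finset.sum_le_sum_of_subset_of_nonneg ?_ fun n _ _ => hnonneg n n.cast_nonneg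
        intro n hn
        simp only [Finset.mem_Ico, Finset.mem_Icc] at hn ⊢
        omega

theorem stmt16 {T : Type} [Countable T] [PartialOrder T] [OrderBot T]
    (htree : IsTree T) (q : ℝ) (hq : 1 < q)
    (α σ : T → ℝ) (hα : ∀ t, 0 < α t) (hσpos : ∀ t, 0 < σ t)
    (hσmono : ∀ ⦃t s : T⦄, t ≤ s → σ s ≤ σ t)
    (K : ℝ) (hK : ∀ s : T, (∑ᶠ r ∈ Set.Iic s, α r ^ q) ^ (1 / q) * σ s ≤ K)
    (glb : T → T → T) (hglb : IsGCA glb)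
    (ρ φ : ℝ → ℝ)
    (hρc : ContinuousOn ρ (Set.Ici 0)) (hρm : MonotoneOn ρ (Set.Ici 0))
    (hρ0 : ρ 0 = 1)
    (hR : ∀ n : ℕ, ρ n ≤ (Nat.card {t : T | gen t = n} : ℝ))
    (hφc : ContinuousOn φ (Set.Ioi 0)) (hφa : StrictAntiOn φ (Set.Ioi 0))
    (hφi : IntegrableOn φ (Set.Ioi 0))
    (hw : ∀ t : T, 1 ≤ gen t → φ (gen t) ≤ (α t * σ t) ^ q)
    (φinv : ℝ → ℝ) (hφinv : ∀ y : ℝ, 0 < y → 0 < φinv y ∧ φ (φinv y) = y) :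
    ∀ ε : ℝ, 0 < ε →
      ENNReal.ofReal (∫ x in Set.Ioc 1 (φinv (ε ^ q) - 1), ρ x) ≤
        coveringNumber (treeDist q α σ glb) (ε / 2) := by
  intro ε hε
  have hq0 : 0 < q := zero_lt_one.trans hq
  obtain ⟨hL, hφL⟩ := hφinv (ε ^ q) (Real.rpow_pos_of_pos hε q)
  set L := φinv (ε ^ q)
  refine le_iInf₂ fun S hS => ?_
  choose c hcS hc using hS
  have hfin : ∀ n : ℕ, {t : T | gen t = n}.Finite := by
    intro n
    have h1 : ρ 0 ≤ ρ n := hρm Set.self_mem_Ici (Set.mem_Ici.mpr n.cast_nonneg) n.cast_nonneg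
    have h2 : (0 : ℝ) < Nat.card {t : T | gen t = n} := by linarith [hR n]
    exact Set.finite_coe_iff.mp (Nat.finite_of_card_ne_zero (by exact_mod_cast h2.ne'))
  have hheavy : ∀ t : T, 1 ≤ gen t → gen t ≤ ⌊L⌋₊ → ε / 2 ≤ α t * σ t := by
    intro t h1 h2
    have hpos : (0 : ℝ) < gen t := by exact_mod_cast h1
    have hφt : ε ^ q ≤ φ (gen t) :=
      hφL ▸ hφa.antitoneOn hpos hL ((Nat.le_floor_iff hL.le).mp h2)
    have := (Real.rpow_le_rpow_iff hε.le (mul_pos (hα t) (hσpos t)).le hq0).mp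
      (hφt.trans (hw t h1))
    linarith
  let level : ℕ → Finset T := fun n => (hfin n).toFinset
  have hdisj : (Finset.Icc 1 ⌊L⌋₊ : Set ℕ).PairwiseDisjoint level := by
    intro m _ n _ hmn
    refine Finset.disjoint_left.mpr fun t hm hn => hmn ?_
    simp only [level, Set.Finite.mem_toFinset, Set.mem_ofPred_eq] at hm hn
    exact hm.symm.trans hn
  have hcard : ((Finset.Icc 1 ⌊L⌋₊).disjiUnion level hdisj).card ≤ S.card := by
    refine Finset.card_le_card_of_injOn c (fun t _ => hcS t) ?_
    have hw' : ∀ t ∈ (Finset.Icc 1 ⌊L⌋₊).disjiUnion level hdisj, ε / 2 ≤ α t * σ t := by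
      intro t ht
      obtain ⟨n, hn, htn⟩ := Finset.mem_disjiUnion.mp ht
      obtain rfl : gen t = n := by simpa [level] using htn
      exact hheavy t (Finset.mem_Icc.mp hn).1 (Finset.mem_Icc.mp hn).2
    intro t ht s hs hts
    exact eq_of_treeDist_lt htree hq0 hα hσpos hglb (hw' t ht) (hw' s hs) (hc t)
      (hts ▸ hc s)
  have hsum : ∑ n ∈ Finset.Icc 1 ⌊L⌋₊, ρ n ≤ (S.card : ℝ) := by
    calc ∑ n ∈ Finset.Icc 1 ⌊L⌋₊, ρ n
        ≤ ∑ n ∈ Finset.Icc 1 ⌊L⌋₊, ((level n).card : ℝ) := by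
          refine Finset.sum_le_sum fun n _ => (hR n).trans_eq ?_
          rw [Nat.card_coe_set_eq, Set.ncard_eq_toFinset_card _ (hfin n)]
      _ ≤ (S.card : ℝ) := by
          rw [Finset.card_disjiUnion] at hcard
          exact_mod_cast hcard
  rw [← ENNReal.ofReal_natCast]
  exact ENNReal.ofReal_le_ofReal
    ((setIntegral_Ioc_le_sum_floor hρm (hρ0 ▸ zero_le_one) L).trans hsum)
end
end

section
/- Suppose R(n) ≥ c n^H for some H ≥ 0 and c > 0, and α(t)σ(t) ≥ c |t|^{-γ/q} for all t ∈ T with |t| ≥ 1, for some γ > 1. Then there is a constant c̃ > 0 such that e_n(V_{α,σ} : ℓ_1(T) → ℓ_q(T)) ≥ c̃ n^{-γ/(q(H+1)) − 1/q'} for all n ≥ 2, where 1/q' = 1 − 1/q. -/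
open scoped ENNReal NNReal
open MeasureTheory

noncomputable section

/-- An elementary Stirling-type lower bound for the Gamma function. -/
lemma rpow_mul_exp_neg_le_Gamma {s : ℝ} (hs : 0 < s) :
    s ^ s * Real.exp (-s) ≤ Real.Gamma (s + 1) := by
  have hconv : IntegrableOn (fun x : ℝ => Real.exp (-x) * x ^ (s + 1 - 1)) (Set.Ioi 0) :=
    Real.GammaIntegral_convergent (by linarith)
  rw [Real.Gamma_eq_integral (by linarith)]
  calc s ^ s * Real.exp (-s) = ∫ x in Set.Ioi s, s ^ s * Real.exp (-x) := by
        rw [integral_const_mul, integral_exp_neg_Ioi]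
    _ ≤ ∫ x in Set.Ioi s, Real.exp (-x) * x ^ (s + 1 - 1) := by
        refine setIntegral_mono_on ((integrableOn_exp_neg_Ioi s).const_mul _)
          (hconv.mono_set (Set.Ioi_subset_Ioi hs.le)) measurableSet_Ioi fun x hx => ?_
        rw [mul_comm, add_sub_cancel_right]
        gcongr
        exact le_of_lt hx
    _ ≤ ∫ x in Set.Ioi 0, Real.exp (-x) * x ^ (s + 1 - 1) := by
        refine setIntegral_mono_set hconv ?_ (Set.Ioi_subset_Ioi hs.le).eventuallyLE
        refine (ae_restrict_iff' measurableSet_Ioi).2 (.of_forall fun x hx => ?_)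
        have : (0 : ℝ) < x := hx
        positivity

/-- Volume comparison: if the image of the open `ℓ₁`-ball under a matrix is covered by finitely many
`ℓ_q`-balls of radius `ε`, then the determinant is controlled by the number of balls. -/
lemma abs_det_mul_le_of_cover {ι : Type*} [Fintype ι] [DecidableEq ι] [Nonempty ι] {q : ℝ}
    (hq : 1 ≤ q) (M : Matrix ι ι ℝ) {ε : ℝ} (hε : 0 ≤ ε) (F : Finset (ι → ℝ))
    (hF : ∀ x : ι → ℝ, ∑ i, |x i| < 1 →
      ∃ y ∈ F, (∑ i, |M.mulVec x i - y i| ^ q) ^ (1 / q) < ε) :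
    |M.det| * (2 ^ Fintype.card ι / (Fintype.card ι).factorial) ≤
      F.card * (ε ^ Fintype.card ι * ((2 * Real.Gamma (1 / q + 1)) ^ Fintype.card ι /
        Real.Gamma (Fintype.card ι / q + 1))) := by
  have hq0 : 0 < q := by linarith
  have hG : 0 < Real.Gamma (1 / q + 1) := Real.Gamma_pos_of_pos (by positivity)
  have hG' : 0 < Real.Gamma (Fintype.card ι / q + 1) := Real.Gamma_pos_of_pos (by positivity)
  have hball : volume {x : ι → ℝ | ∑ i, |x i| < 1} =
      ENNReal.ofReal (2 ^ Fintype.card ι / (Fintype.card ι).factorial) := by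
    have := volume_sum_rpow_lt_one ι (p := 1) le_rfl
    simp only [Real.rpow_one, div_one] at this
    rw [this, Real.Gamma_nat_eq_factorial]
    norm_num
  have hsub : Matrix.toLin' M '' {x : ι → ℝ | ∑ i, |x i| < 1} ⊆
      ⋃ y ∈ F, (fun z => z + -y) ⁻¹' {z : ι → ℝ | (∑ i, |z i| ^ q) ^ (1 / q) < ε} := by
    rintro _ ⟨x, hx, rfl⟩
    obtain ⟨y, hy, h⟩ := hF x hx
    simp only [Set.mem_iUnion]
    exact ⟨y, hy, by simpa [sub_eq_add_neg] using h⟩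
  have hvol := (measure_mono hsub).trans (measure_biUnion_finset_le (μ := volume) F _)
  simp only [Measure.addHaar_image_linearMap, measure_preimage_add_right, hball,
    volume_sum_rpow_lt ι hq, LinearMap.det_toLin', Finset.sum_const, nsmul_eq_mul] at hvol
  rw [← ENNReal.ofReal_pow hε, ← ENNReal.ofReal_mul (by positivity),
    ← ENNReal.ofReal_mul (by positivity), ← ENNReal.ofReal_natCast,
    ← ENNReal.ofReal_mul (by positivity)] at hvol
  exact (ENNReal.ofReal_le_ofReal_iff (by positivity)).1 hvol

/-- Lower bound for the radius of a covering by `2 ^ (n - 1)` balls, in dimension `n`. -/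
lemma radius_lower_bound_of_cover {ι : Type*} [Fintype ι] [DecidableEq ι] [Nonempty ι] {q : ℝ}
    (hq : 1 ≤ q) (M : Matrix ι ι ℝ) {δ ε : ℝ} (hε : 0 ≤ ε)
    (hdet : δ ^ Fintype.card ι ≤ |M.det|) (F : Finset (ι → ℝ))
    (hcard : F.card ≤ 2 ^ Fintype.card ι)
    (hF : ∀ x : ι → ℝ, ∑ i, |x i| < 1 →
      ∃ y ∈ F, (∑ i, |M.mulVec x i - y i| ^ q) ^ (1 / q) < ε) :
    (q * Real.exp 1) ^ (-(1 / q)) / (2 * Real.Gamma (1 / q + 1)) *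
      (δ * (Fintype.card ι : ℝ) ^ (1 / q - 1)) ≤ ε := by
  have hmain := abs_det_mul_le_of_cover hq M hε F hF
  set n := Fintype.card ι
  have hn0 : n ≠ 0 := Fintype.card_ne_zero
  have hnpos : (0 : ℝ) < n := by positivity
  have hq0 : 0 < q := by linarith
  have hG : 0 < Real.Gamma (1 / q + 1) := Real.Gamma_pos_of_pos (by positivity)
  set g := Real.Gamma (1 / q + 1)
  have hGn := rpow_mul_exp_neg_le_Gamma (s := n / q) (by positivity)
  have hpow : (n / q : ℝ) ^ (n / q : ℝ) * Real.exp (-(n / q)) =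
      ((n : ℝ) ^ (1 / q) * (q * Real.exp 1) ^ (-(1 / q))) ^ n := by
    rw [Real.rpow_neg (by positivity), ← div_eq_mul_inv,
      ← Real.div_rpow (by positivity) (by positivity), ← Real.rpow_natCast, ← Real.rpow_mul
        (by positivity), ← div_div, Real.div_rpow (x := n / q) (by positivity) (by positivity),
      Real.exp_one_rpow, Real.exp_neg, one_div_mul_eq_div, ← div_eq_mul_inv]
  rw [hpow] at hGn
  set a := (n : ℝ) ^ (1 / q) * (q * Real.exp 1) ^ (-(1 / q)) with ha
  have ha0 : 0 < a := by positivity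
  have hfact : (n.factorial : ℝ) ≤ (n : ℝ) ^ n := by exact_mod_cast Nat.factorial_le_pow n
  have hroot : (δ * 2 / n) ^ n ≤ (2 * (ε * (2 * g / a))) ^ n := by
    calc (δ * 2 / n) ^ n = δ ^ n * (2 ^ n / (n : ℝ) ^ n) := by
          rw [div_pow, mul_pow, mul_div_assoc]
      _ ≤ |M.det| * (2 ^ n / n.factorial) := by gcongr
      _ ≤ _ := hmain
      _ ≤ 2 ^ n * (ε ^ n * ((2 * g) ^ n / a ^ n)) := by
          gcongr
          exact_mod_cast hcard
      _ = _ := by rw [← div_pow, ← mul_pow, ← mul_pow]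
  have hle := le_of_pow_le_pow_left₀ hn0 (by positivity) hroot
  have hsplit : (n : ℝ) ^ (1 / q - 1) = (n : ℝ) ^ (1 / q) / n := by
    rw [Real.rpow_sub hnpos, Real.rpow_one]
  calc _ = (δ * 2 / n) * (a / (4 * g)) := by
        rw [hsplit, ha]; ring
    _ ≤ (2 * (ε * (2 * g / a))) * (a / (4 * g)) := by gcongr
    _ = ε := by field_simp; ring

/-- The matrix of the weighted summation operator on a finite set of nodes. -/
def summationMatrix {ι : Type*} [LE ι] [DecidableLE ι] (α σ : ι → ℝ) : Matrix ι ι ℝ :=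
  Matrix.of fun t s => if t ≤ s then α t * σ s else 0

lemma det_summationMatrix {ι : Type*} [PartialOrder ι] [DecidableLE ι] [Fintype ι] [DecidableEq ι]
    (α σ : ι → ℝ) : (summationMatrix α σ).det = ∏ t, α t * σ t := by
  let e : ι ≃ LinearExtension ι := Equiv.refl _
  let : Fintype (LinearExtension ι) := Fintype.ofEquiv ι e
  have htri : (Matrix.reindex e e (summationMatrix α σ)).BlockTriangular id := by
    intro i j hij
    refine if_neg fun h => ?_
    exact absurd (toLinearExtension.monotone h) (not_le_of_gt hij)
  rw [← Matrix.det_reindex_self e, Matrix.det_of_isUpperTriangular htri, ← e.prod_comp]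
  simp [summationMatrix]

/-- Sufficiently many nodes can be found in the generations between `N` and `2 * N`. -/
lemma exists_finset_gen_mem {T : Type} [PartialOrder T] {H c : ℝ} (hH : 0 ≤ H) (hc : 0 < c)
    (hR : ∀ n : ℕ, 1 ≤ n → c * (n : ℝ) ^ H ≤ (Nat.card {t : T | gen t = n} : ℝ))
    {N n : ℕ} (hN : 1 ≤ N) (hn : (n : ℝ) ≤ c * (N : ℝ) ^ (H + 1)) :
    ∃ S : Finset T, S.card = n ∧ ∀ t ∈ S, 1 ≤ gen t ∧ gen t ≤ 2 * N := by
  classical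
  have hfin : ∀ k : ℕ, 1 ≤ k → {t : T | gen t = k}.Finite := by
    intro k hk
    have hpos : (0 : ℝ) < Nat.card {t : T | gen t = k} :=
      lt_of_lt_of_le (by positivity) (hR k hk)
    exact Nat.finite_of_card_ne_zero (by exact_mod_cast hpos.ne')
  have hU : {t : T | gen t ∈ Finset.Ico N (2 * N)}.Finite := by
    refine ((Finset.Ico N (2 * N)).finite_toSet.biUnion (t := fun k => {t : T | gen t = k})
      fun k hk => hfin k (hN.trans (Finset.mem_Ico.1 hk).1)).subset fun t ht => ?_
    simpa using ht
  have hcard : n ≤ hU.toFinset.card := by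
    rw [Finset.card_eq_sum_card_fiberwise (f := gen) (t := Finset.Ico N (2 * N))
      fun t ht => by simpa using ht, ← Nat.cast_le (α := ℝ), Nat.cast_sum]
    calc (n : ℝ) ≤ c * (N : ℝ) ^ (H + 1) := hn
      _ = ∑ k ∈ Finset.Ico N (2 * N), c * (N : ℝ) ^ H := by
          rw [Finset.sum_const, Nat.card_Ico, nsmul_eq_mul, two_mul, Nat.add_sub_cancel,
            Real.rpow_add_one (by positivity)]
          ring
      _ ≤ _ := by
          refine Finset.sum_le_sum fun k hk => ?_
          have hNk := (Finset.mem_Ico.1 hk).1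
          have hfiber : hU.toFinset.filter (gen · = k) = (hfin k (hN.trans hNk)).toFinset := by
            ext t
            simp only [Finset.mem_filter, Set.Finite.mem_toFinset, Set.mem_ofPred_eq]
            exact ⟨And.right, fun h => ⟨h ▸ hk, h⟩⟩
          rw [hfiber, ← Set.ncard_eq_toFinset_card _ _, ← Nat.card_coe_set_eq]
          refine le_trans ?_ (hR k (hN.trans hNk))
          gcongr
  obtain ⟨S, hSU, hS⟩ := Finset.exists_subset_card_eq hcard
  refine ⟨S, hS, fun t ht => ?_⟩
  have := hSU ht
  simp only [Set.Finite.mem_toFinset, Set.mem_ofPred_eq, Finset.mem_Ico] at this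
  omega

/-- The weighted summation operator acts on finitely supported vectors through a matrix. -/
lemma apply_sum_single {T : Type} [PartialOrder T] [DecidableEq T] [DecidableLE T] {q : ℝ}
    [Fact (1 ≤ ENNReal.ofReal q)] {α σ : T → ℝ} (V : ellOne T →L[ℝ] ellQ T q)
    (hV : ∀ (x : ellOne T) (t : T), (V x : ∀ _ : T, ℝ) t =
      α t * ∑' s : {s : T // t ≤ s}, σ s.1 * (x : ∀ _ : T, ℝ) s.1)
    (S : Finset T) (x : S → ℝ) (t : S) :
    (V (∑ s : S, lp.single 1 s.1 (x s)) : ∀ _ : T, ℝ) t.1 =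
      (summationMatrix (fun s : S => α s) (fun s : S => σ s)).mulVec x t := by
  rw [map_sum, lp.coeFn_sum, Finset.sum_apply, Matrix.mulVec, dotProduct]
  refine Finset.sum_congr rfl fun s _ => ?_
  rw [hV]
  simp only [lp.single_apply, summationMatrix, Matrix.of_apply]
  by_cases h : t ≤ s
  · rw [if_pos h, tsum_eq_single ⟨s.1, h⟩]
    · simp [mul_assoc]
    · intro u hu
      rw [Pi.single_eq_of_ne, mul_zero]
      exact fun h' => hu (Subtype.ext h')
  · rw [if_neg h, zero_mul]
    convert mul_zero _
    convert tsum_zero with u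
    rw [Pi.single_eq_of_ne, mul_zero]
    rintro h'
    exact h (show t.1 ≤ s.1 from h' ▸ u.2)

/-- Lower bound for the entropy numbers of the summation operator in terms of `n` nodes whose
weights are bounded below by `δ`. -/
lemma le_entropyNumber_of_finset {T : Type} [PartialOrder T] {q : ℝ} (hq : 1 < q)
    [Fact (1 ≤ ENNReal.ofReal q)] {α σ : T → ℝ} (V : ellOne T →L[ℝ] ellQ T q)
    (hV : ∀ (x : ellOne T) (t : T), (V x : ∀ _ : T, ℝ) t =
      α t * ∑' s : {s : T // t ≤ s}, σ s.1 * (x : ∀ _ : T, ℝ) s.1)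
    {n : ℕ} (hn : n ≠ 0) (S : Finset T) (hS : S.card = n) {δ : ℝ} (hδ : 0 ≤ δ)
    (hw : ∀ t ∈ S, δ ≤ α t * σ t) :
    (q * Real.exp 1) ^ (-(1 / q)) / (2 * Real.Gamma (1 / q + 1)) *
      (δ * (n : ℝ) ^ (1 / q - 1)) ≤ entropyNumber n V := by
  classical
  refine le_csInf ⟨‖V‖ + 1, by positivity, {0}, by simpa using Nat.one_le_two_pow, fun x hx =>
    ⟨0, by simp, ?_⟩⟩ ?_
  · rw [sub_zero]
    have := V.le_of_opNorm_le_of_le le_rfl hx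
    linarith
  rintro ε ⟨hε, F, hF, hcov⟩
  have hcard : Fintype.card S = n := by simpa using hS
  have : Nonempty S := Fintype.card_pos_iff.1 (by omega)
  have hq0 : 0 < q := by linarith
  have hqr : (ENNReal.ofReal q).toReal = q := ENNReal.toReal_ofReal hq0.le
  have := radius_lower_bound_of_cover hq.le
    (summationMatrix (fun s : S => α s) (fun s : S => σ s)) (δ := δ) hε.le ?_
    (F.image fun (y : ellQ T q) (t : S) => (y : ∀ _ : T, ℝ) t.1) ?_ ?_
  · rwa [hcard] at this
  · have hconst : δ ^ Fintype.card S = ∏ _t : S, δ := by simp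
    rw [det_summationMatrix, hconst]
    exact (Finset.prod_le_prod (fun _ _ => hδ) fun (t : S) _ => hw t.1 t.2).trans (le_abs_self _)
  · rw [hcard]
    exact Finset.card_image_le.trans (hF.trans (Nat.pow_le_pow_right two_pos (Nat.sub_le _ _)))
  · intro x hx
    obtain ⟨y, hy, h⟩ := hcov (∑ s : S, lp.single 1 s.1 (x s)) (by
      refine (norm_sum_le _ _).trans ?_
      simpa [lp.norm_single] using hx.le)
    refine ⟨_, Finset.mem_image_of_mem _ hy, lt_of_le_of_lt ?_ h⟩
    have hsum := lp.sum_rpow_le_norm_rpow (by rw [hqr]; exact hq0)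
      (V (∑ s : S, lp.single 1 s.1 (x s)) - y) S
    rw [hqr, ← Finset.sum_coe_sort] at hsum
    refine (Real.rpow_le_rpow (by positivity) (le_of_eq_of_le ?_ hsum)
      (by positivity)).trans_eq ?_
    · refine Finset.sum_congr rfl fun t _ => ?_
      rw [lp.coeFn_sub, Pi.sub_apply, apply_sum_single V hV, Real.norm_eq_abs]
    · rw [← Real.rpow_mul (norm_nonneg _), mul_one_div_cancel hq0.ne', Real.rpow_one]

theorem stmt17 {T : Type} [Countable T] [PartialOrder T] [OrderBot T]
    (htree : IsTree T) (q : ℝ) (hq : 1 < q)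
    (α σ : T → ℝ) (hα : ∀ t, 0 < α t) (hσpos : ∀ t, 0 < σ t)
    (hσmono : ∀ ⦃t s : T⦄, t ≤ s → σ s ≤ σ t)
    (K : ℝ) (hK : ∀ s : T, (∑ᶠ r ∈ Set.Iic s, α r ^ q) ^ (1 / q) * σ s ≤ K)
    [Fact (1 ≤ ENNReal.ofReal q)]
    (V : ellOne T →L[ℝ] ellQ T q)
    (hV : ∀ (x : ellOne T) (t : T), (V x : ∀ _ : T, ℝ) t =
      α t * ∑' s : {s : T // t ≤ s}, σ s.1 * (x : ∀ _ : T, ℝ) s.1)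
    (H c γ : ℝ) (hH : 0 ≤ H) (hc : 0 < c) (hγ : 1 < γ)
    (hR : ∀ n : ℕ, 1 ≤ n → c * (n : ℝ) ^ H ≤ (Nat.card {t : T | gen t = n} : ℝ))
    (hw : ∀ t : T, 1 ≤ gen t → c * (gen t : ℝ) ^ (-(γ / q)) ≤ α t * σ t)
    (q' : ℝ) (hq' : 1 / q' = 1 - 1 / q) :
    ∃ ct > 0, ∀ n : ℕ, 2 ≤ n →
      ct * (n : ℝ) ^ (-(γ / (q * (H + 1))) - 1 / q') ≤ entropyNumber n V := by
  set A : ℝ := (1 / c) ^ (1 / (H + 1)) + 1 with hA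
  set B : ℝ := (q * Real.exp 1) ^ (-(1 / q)) / (2 * Real.Gamma (1 / q + 1))
  have hq0 : 0 < q := by linarith
  have hA0 : 0 < A := by positivity
  have hB0 : 0 < B := by
    have : 0 < Real.Gamma (1 / q + 1) := Real.Gamma_pos_of_pos (by positivity)
    positivity
  refine ⟨B * (c * (2 * A) ^ (-(γ / q))), by positivity, fun n hn => ?_⟩
  have hn0 : (0 : ℝ) < n := by positivity
  have hn1 : (1 : ℝ) ≤ n := by exact_mod_cast (by omega : 1 ≤ n)
  set N : ℕ := ⌈((n : ℝ) / c) ^ (1 / (H + 1))⌉₊ with hN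
  have hN1 : 1 ≤ N := Nat.ceil_pos.2 (by positivity)
  have hnN : (n : ℝ) ≤ c * (N : ℝ) ^ (H + 1) := by
    rw [← div_le_iff₀' hc]
    calc (n : ℝ) / c = (((n : ℝ) / c) ^ (1 / (H + 1))) ^ (H + 1) := by
          rw [← Real.rpow_mul (by positivity), one_div_mul_cancel (by positivity), Real.rpow_one]
      _ ≤ _ := by gcongr; exact Nat.le_ceil _
  have hNA : (N : ℝ) ≤ A * (n : ℝ) ^ (1 / (H + 1)) := by
    have h1 : (1 : ℝ) ≤ (n : ℝ) ^ (1 / (H + 1)) := Real.one_le_rpow hn1 (by positivity)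
    have h2 := (Nat.ceil_lt_add_one (a := ((n : ℝ) / c) ^ (1 / (H + 1))) (by positivity)).le
    have h3 : ((n : ℝ) / c) ^ (1 / (H + 1)) = (n : ℝ) ^ (1 / (H + 1)) * (1 / c) ^ (1 / (H + 1)) := by
      rw [← Real.mul_rpow (by positivity) (by positivity), mul_one_div]
    rw [← hN, h3] at h2
    rw [hA]
    linarith
  obtain ⟨S, hS, hgen⟩ := exists_finset_gen_mem hH hc hR hN1 hnN
  have hexp : -(γ / q) ≤ 0 := by
    have : 0 < γ / q := by positivity
    linarith
  have hbound := le_entropyNumber_of_finset hq V hV (n := n) (by omega) S hS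
    (δ := c * (2 * (A * (n : ℝ) ^ (1 / (H + 1)))) ^ (-(γ / q))) (by positivity) fun t ht => by
      obtain ⟨h1, h2⟩ := hgen t ht
      refine le_trans ?_ (hw t h1)
      have h3 : (0 : ℝ) < gen t := by exact_mod_cast h1
      have h4 : (gen t : ℝ) ≤ 2 * N := by exact_mod_cast h2
      exact mul_le_mul_of_nonneg_left
        (Real.rpow_le_rpow_of_nonpos h3 (by linarith) hexp) hc.le
  refine le_of_eq_of_le ?_ hbound
  rw [hq', ← mul_assoc 2 A, Real.mul_rpow (x := 2 * A) (by positivity) (by positivity),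
    ← Real.rpow_mul hn0.le, sub_eq_add_neg _ (1 - 1 / q), Real.rpow_add hn0, neg_sub,
    show 1 / (H + 1) * -(γ / q) = -(γ / (q * (H + 1))) by field_simp]
  ring
end
end
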